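/- Let A be an arrangement of n hyperplanes in ℂ^ℓ with Orlik–Solomon algebra A•. For each q and m, the resonance variety R^q_m(A) = {λ ∈ ℂ^n : dim H^q(A•, a_λ) ≥ m} is the union of a finite arrangement of linear subspaces in ℂ^n. -/

import Mathlib

/-!
STATEMENT 8: For an arrangement of n hyperplanes in ℂ^ℓ with Orlik–Solomon algebra A•,
each resonance variety R^q_m(A) = {λ ∈ ℂ^n : dim H^q(A•, a_λ) ≥ m} is the union of a
finite arrangement of linear subspaces of ℂ^n.
-/


open scoped Classical

noncomputable section

variable {n : ℕ}

/-- The degree `q` part of the exterior algebra on generators `e₁,…,e_n`, with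
coefficients in `C`, in the basis `{e_S : S ⊆ [n], |S| = q}`. -/
abbrev ExtDeg (n q : ℕ) (C : Type*) : Type _ := {S : Finset (Fin n) // S.card = q} → C

/-- The number of elements of `S` smaller than `j`. -/
def posIn (j : Fin n) (S : Finset (Fin n)) : ℕ := (S.filter (· < j)).card

/-- Left multiplication by the generator `e_j` on the degree `q` part. -/
def wedgeGen (C : Type*) [CommRing C] (q : ℕ) (j : Fin n) :
    ExtDeg n q C →ₗ[C] ExtDeg n (q + 1) C where
  toFun x V :=
    if h : j ∈ V.1 then
      ((-1 : C) ^ posIn j (V.1.erase j)) *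
        x ⟨V.1.erase j, by simp [Finset.card_erase_of_mem h, V.2]⟩
    else 0
  map_add' x y := by
    funext V
    by_cases h : j ∈ V.1 <;> simp [h, mul_add]
  map_smul' c x := by
    funext V
    by_cases h : j ∈ V.1 <;> simp [h, mul_left_comm]

/-- Multiplication by `a_λ = ∑ λ_j e_j` on the degree `q` part. -/
def dLam (lam : Fin n → ℂ) (q : ℕ) : ExtDeg n q ℂ →ₗ[ℂ] ExtDeg n (q + 1) ℂ :=
  ∑ j : Fin n, lam j • wedgeGen ℂ q j

/-- The sign with which `e_U ∧ e_T = ± e_{U ∪ T}` for disjoint `U`, `T`. -/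
def shuffleSign (U T : Finset (Fin n)) : ℤ :=
  (-1) ^ ((U ×ˢ T).filter fun p => p.2 < p.1).card

/-- The element `e_U ∧ ∂e_S` of the degree `q` part (in coordinates). -/
def osGen (S U : Finset (Fin n)) (q : ℕ) : ExtDeg n q ℂ := fun V =>
  ∑ j ∈ S,
    if Disjoint U (S.erase j) ∧ V.1 = U ∪ S.erase j then
      ((-1 : ℂ) ^ posIn j (S.erase j)) * (shuffleSign U (S.erase j) : ℤ)
    else 0

/-- The standard basis vector `e_W` of the degree `q` part. -/
def osBasisVec (W : {S : Finset (Fin n) // S.card = q}) : ExtDeg n q ℂ := fun V =>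
  if V = W then 1 else 0

/-- The degree `q` part of the Orlik–Solomon ideal `I(𝒜)`: the span of the elements
`e_U ∧ ∂e_S` for dependent `S`, together with the monomials `e_W` for `W` containing
a subset with empty intersection. -/
def osIdeal (dep emp : Finset (Fin n) → Prop) (q : ℕ) : Submodule ℂ (ExtDeg n q ℂ) :=
  Submodule.span ℂ
    ({x | ∃ S U : Finset (Fin n), dep S ∧ x = osGen S U q} ∪
     {x | ∃ W : {S : Finset (Fin n) // S.card = q}, (∃ S ⊆ W.1, emp S) ∧ x = osBasisVec W})

/-- Cocycles of the Orlik–Solomon complex `(A^•, a_λ)` (pulled back to the exterior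
algebra): elements whose image under `a_λ` lies in the ideal. -/
def osCocycles (dep emp : Finset (Fin n) → Prop) (lam : Fin n → ℂ) (q : ℕ) :
    Submodule ℂ (ExtDeg n q ℂ) :=
  (osIdeal dep emp (q + 1)).comap (dLam lam q)

/-- Coboundaries of the Orlik–Solomon complex (pulled back to the exterior algebra). -/
def osCobound (dep emp : Finset (Fin n) → Prop) (lam : Fin n → ℂ) :
    ∀ q : ℕ, Submodule ℂ (ExtDeg n q ℂ)
  | 0 => osIdeal dep emp 0
  | q + 1 => osIdeal dep emp (q + 1) ⊔ LinearMap.range (dLam lam q)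

/-- The cohomology `H^q(A^•(𝒜), a_λ)` of the Orlik–Solomon complex. -/
abbrev osCohomology (dep emp : Finset (Fin n) → Prop) (lam : Fin n → ℂ) (q : ℕ) :=
  ↥(osCocycles dep emp lam q) ⧸
    Submodule.comap (osCocycles dep emp lam q).subtype (osCobound dep emp lam q)

end

noncomputable section

variable {n ℓ : ℕ}

def alphaForm (b : Fin n → Fin (ℓ + 1) → ℂ) (j : Fin n) (u : Fin ℓ → ℂ) : ℂ :=
  b j 0 + ∑ k : Fin ℓ, b j k.succ * u k

def IsArrangement (b : Fin n → Fin (ℓ + 1) → ℂ) : Prop :=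
  ∀ j : Fin n, ∃ k : Fin ℓ, b j k.succ ≠ 0

/-- The linear part of the defining form of the `j`-th hyperplane. -/
def linPart (b : Fin n → Fin (ℓ + 1) → ℂ) (j : Fin n) : Fin ℓ → ℂ := fun k => b j k.succ

/-- `S` is a dependent set of hyperplanes: `∩_{j∈S} H_j ≠ ∅` and
`codim ∩_{j∈S} H_j < |S|`. -/
def depS (b : Fin n → Fin (ℓ + 1) → ℂ) (S : Finset (Fin n)) : Prop :=
  (∃ u, ∀ j ∈ S, alphaForm b j u = 0) ∧
    Module.finrank ℂ ↥(Submodule.span ℂ (linPart b '' ↑S)) < S.card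

/-- `S` has empty intersection: `∩_{j∈S} H_j = ∅`. -/
def empS (b : Fin n → Fin (ℓ + 1) → ℂ) (S : Finset (Fin n)) : Prop :=
  ¬ ∃ u, ∀ j ∈ S, alphaForm b j u = 0

/-- The resonance variety
`R^q_m(A) = {λ ∈ ℂ^n : dim_ℂ H^q(A^•(𝒜), a_λ) ≥ m}`. -/
def resonanceVariety (b : Fin n → Fin (ℓ + 1) → ℂ) (q m : ℕ) : Set (Fin n → ℂ) :=
  {lam | m ≤ Module.finrank ℂ (osCohomology (depS b) (empS b) lam q)}

end

noncomputable section
namespace RV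

/-- Polynomial functions on `ℂ^l`. -/
abbrev PR (l : ℕ) := MvPolynomial (Fin l) ℂ

/-- Rational functions on `ℂ^l`. -/
def KK (l : ℕ) : Type := FractionRing (PR l)

instance (l : ℕ) : Field (KK l) := inferInstanceAs (Field (FractionRing (PR l)))
instance (l : ℕ) : Algebra (PR l) (KK l) := inferInstanceAs (Algebra (PR l) (FractionRing (PR l)))
instance (l : ℕ) : Algebra ℂ (KK l) := inferInstanceAs (Algebra ℂ (FractionRing (PR l)))
instance (l : ℕ) : IsScalarTower ℂ (PR l) (KK l) :=
  inferInstanceAs (IsScalarTower ℂ (PR l) (FractionRing (PR l)))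
instance (l : ℕ) : IsFractionRing (PR l) (KK l) :=
  inferInstanceAs (IsFractionRing (PR l) (FractionRing (PR l)))

/-- The inclusion of polynomials. -/
def pk (l : ℕ) : PR l →ₐ[ℂ] KK l := IsScalarTower.toAlgHom ℂ (PR l) (KK l)

lemma pk_inj (l : ℕ) : Function.Injective (pk l) := IsFractionRing.injective (PR l) (KK l)

lemma pk_ne {l : ℕ} {f : PR l} (h : f ≠ 0) : pk l f ≠ 0 := by
  rw [Ne, map_eq_zero_iff _ (pk_inj l)]; exact h

lemma exists_frac {l : ℕ} (x : KK l) : ∃ a b : PR l, b ≠ 0 ∧ x = pk l a / pk l b := by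
  obtain ⟨a, b, hb, h⟩ := IsFractionRing.div_surjective (A := PR l) x
  exact ⟨a, b, nonZeroDivisors.ne_zero hb, h.symm⟩

/-- Lifting a homomorphism of polynomials to the dual numbers of the field. -/
def dualHom (l : ℕ) (j : Fin l) : PR l →ₐ[ℂ] TrivSqZeroExt (KK l) (KK l) :=
  MvPolynomial.aeval (fun i => TrivSqZeroExt.inl (pk l (MvPolynomial.X i)) +
    TrivSqZeroExt.inr (if i = j then 1 else 0))

lemma dualHom_fst (l : ℕ) (j : Fin l) (f : PR l) : (dualHom l j f).fst = pk l f := by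
  have : (TrivSqZeroExt.fstHom ℂ (KK l) (KK l)).comp (dualHom l j) = pk l := by
    apply MvPolynomial.algHom_ext
    intro i
    by_cases h : i = j <;> simp [dualHom, h]
  exact DFunLike.congr_fun this f

lemma dualHom_unit (l : ℕ) (j : Fin l) (y : nonZeroDivisors (PR l)) :
    IsUnit ((dualHom l j).toRingHom y) := by
  rw [TrivSqZeroExt.isUnit_iff_isUnit_fst]
  have := dualHom_fst l j y
  simp only [AlgHom.toRingHom_eq_coe, RingHom.coe_coe]
  rw [this]
  exact (pk_ne (nonZeroDivisors.coe_ne_zero y)).isUnit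

/-- Extension to the field. -/
def dualK (l : ℕ) (j : Fin l) : KK l →+* TrivSqZeroExt (KK l) (KK l) :=
  IsLocalization.lift (M := nonZeroDivisors (PR l)) (dualHom_unit l j)

lemma dualK_pk (l : ℕ) (j : Fin l) (f : PR l) : dualK l j (pk l f) = dualHom l j f :=
  IsLocalization.lift_eq (dualHom_unit l j) f

lemma dualK_fst (l : ℕ) (j : Fin l) (x : KK l) : (dualK l j x).fst = x := by
  obtain ⟨a, b, hb, rfl⟩ := exists_frac x
  have hb' := pk_ne hb
  have h1 : dualK l j (pk l a / pk l b) * dualK l j (pk l b) = dualK l j (pk l a) := by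
    rw [← map_mul, div_mul_cancel₀ _ hb']
  have h2 := congrArg TrivSqZeroExt.fst h1
  rw [TrivSqZeroExt.fst_mul, dualK_pk, dualK_pk, dualHom_fst, dualHom_fst] at h2
  exact eq_div_of_mul_eq hb' h2

/-- The partial derivative on rational functions. -/
def DD {l : ℕ} (j : Fin l) : KK l →ₗ[ℂ] KK l where
  toFun x := (dualK l j x).snd
  map_add' x y := by simp
  map_smul' c x := by
    have : (algebraMap ℂ (KK l) c) = pk l (MvPolynomial.C c) := by
      rw [← MvPolynomial.algebraMap_eq]; exact ((pk l).commutes c).symm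
    have h2 : dualK l j (algebraMap ℂ (KK l) c) = algebraMap ℂ _ c := by
      rw [this, dualK_pk, ← MvPolynomial.algebraMap_eq, AlgHom.commutes]
    simp only [RingHom.id_apply]
    rw [Algebra.smul_def, map_mul, h2, TrivSqZeroExt.snd_mul, Algebra.smul_def]
    simp [TrivSqZeroExt.algebraMap_eq_inl', Algebra.smul_def]

lemma DD_mul {l : ℕ} (j : Fin l) (x y : KK l) : DD j (x * y) = x * DD j y + y * DD j x := by
  show (dualK l j (x*y)).snd = x * (dualK l j y).snd + y * (dualK l j x).snd
  rw [map_mul, TrivSqZeroExt.snd_mul, dualK_fst, dualK_fst]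
  simp [mul_comm]

lemma DD_X {l : ℕ} (j i : Fin l) : DD j (pk l (MvPolynomial.X i)) = if i = j then 1 else 0 := by
  show (dualK l j _).snd = _
  rw [dualK_pk]; by_cases h : i = j <;> simp [dualHom, h]

lemma DD_one {l : ℕ} (j : Fin l) : DD j (1 : KK l) = 0 := by
  have := DD_mul j (1 : KK l) 1
  simpa using this

lemma DD_algebraMap {l : ℕ} (j : Fin l) (c : ℂ) : DD j (algebraMap ℂ (KK l) c) = 0 := by
  rw [Algebra.algebraMap_eq_smul_one, map_smul, DD_one, smul_zero]

lemma DD_inv {l : ℕ} (j : Fin l) (x : KK l) : DD j x⁻¹ = - (x⁻¹ * x⁻¹ * DD j x) := by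
  by_cases hx : x = 0
  · simp [hx]
  have := DD_mul j x x⁻¹
  rw [mul_inv_cancel₀ hx, DD_one] at this
  have h2 : x * (DD j x⁻¹ + x⁻¹ * x⁻¹ * DD j x) = 0 := by
    rw [mul_add]; field_simp; field_simp at this; linear_combination -this
  rcases mul_eq_zero.1 h2 with h | h
  · exact absurd h hx
  · linear_combination h

/-- Two additive maps that behave like derivations agree when they agree on coordinates. -/
lemma deriv_ext {l b : ℕ} (φ : KK l →+* KK b)
    (A B : KK l → KK b) (hA : ∀ x y, A (x + y) = A x + A y) (hB : ∀ x y, B (x + y) = B x + B y)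
    (hA1 : ∀ x y, A (x * y) = φ x * A y + φ y * A x)
    (hB1 : ∀ x y, B (x * y) = φ x * B y + φ y * B x)
    (hAc : ∀ c : ℂ, A (algebraMap ℂ _ c) = 0) (hBc : ∀ c : ℂ, B (algebraMap ℂ _ c) = 0)
    (h : ∀ i, A (pk l (MvPolynomial.X i)) = B (pk l (MvPolynomial.X i))) (x : KK l) : A x = B x := by
  have hp : ∀ f : PR l, A (pk l f) = B (pk l f) := by
    intro f
    induction f using MvPolynomial.induction_on with
    | C c =>
      have : pk l (MvPolynomial.C c) = algebraMap ℂ _ c := by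
        rw [← MvPolynomial.algebraMap_eq]; exact (pk l).commutes c
      rw [this, hAc, hBc]
    | add p q hp hq => rw [map_add, hA, hB, hp, hq]
    | mul_X p i hp => rw [map_mul, hA1, hB1, hp, h]
  obtain ⟨a, b, hb, rfl⟩ := exists_frac x
  have hb' : φ (pk l b) ≠ 0 := by
    rw [Ne, map_eq_zero_iff _ φ.injective]; exact pk_ne hb
  have e : pk l a = (pk l a / pk l b) * pk l b := by rw [div_mul_cancel₀ _ (pk_ne hb)]
  have h1 := hp a
  rw [e, hA1, hB1, hp b] at h1
  have := add_left_cancel h1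
  exact mul_left_cancel₀ hb' this

lemma DD_comm {l : ℕ} (i j : Fin l) (x : KK l) : DD i (DD j x) = DD j (DD i x) := by
  have : DD i (DD j x) - DD j (DD i x) = 0 := by
    refine deriv_ext (RingHom.id _) (fun x => DD i (DD j x) - DD j (DD i x)) (fun _ => 0)
      ?_ (by simp) ?_ (by simp) ?_ (by simp) ?_ x
    · intro x y; simp only [map_add]; ring
    · intro x y; simp only [DD_mul, map_add, RingHom.id_apply]; ring
    · intro c; simp [DD_algebraMap]
    · intro k
      rw [DD_X, DD_X]
      split_ifs <;> simp [DD_one]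
  exact sub_eq_zero.1 this

/-- Affine functions on `ℂ^l`: constant term and linear part. -/
abbrev Aff (l : ℕ) := ℂ × Module.Dual ℂ (Fin l → ℂ)

/-- Evaluation of affine functions. -/
def Aff.ev {l : ℕ} (a : Aff l) (u : Fin l → ℂ) : ℂ := a.1 + a.2 u

/-- Affine functions as polynomials. -/
def affP (l : ℕ) : Aff l →ₗ[ℂ] PR l where
  toFun a := MvPolynomial.C a.1 + ∑ i, MvPolynomial.C (a.2 (Pi.single i 1)) * MvPolynomial.X i
  map_add' a b := by simp [add_mul, Finset.sum_add_distrib]; ring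
  map_smul' c a := by
    simp [MvPolynomial.smul_eq_C_mul, Finset.mul_sum, mul_assoc]

lemma affP_eval {l : ℕ} (a : Aff l) (u : Fin l → ℂ) : MvPolynomial.eval u (affP l a) = a.ev u := by
  simp only [affP, Aff.ev, LinearMap.coe_mk, AddHom.coe_mk, map_add, MvPolynomial.eval_C, map_sum, map_mul, MvPolynomial.eval_X]
  congr 1
  conv_rhs => rw [LinearMap.pi_apply_eq_sum_univ a.2 u]
  apply Finset.sum_congr rfl
  intro i _
  rw [smul_eq_mul, mul_comm]
  congr 2
  ext k; simp [Pi.single_apply, eq_comm]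

lemma Aff.ev_inj {l : ℕ} {a b : Aff l} (h : ∀ u, a.ev u = b.ev u) : a = b := by
  have h0 : a.1 = b.1 := by simpa [Aff.ev] using h 0
  refine Prod.ext h0 (LinearMap.ext fun u => ?_)
  have := h u
  simp only [Aff.ev, h0] at this
  exact add_left_cancel this

lemma affP_inj (l : ℕ) : Function.Injective (affP l) := by
  intro a b h
  apply Aff.ev_inj
  intro u
  rw [← affP_eval, h, affP_eval]

/-- Affine functions as rational functions. -/
def affK {l : ℕ} : Aff l →ₗ[ℂ] KK l := (pk l).toLinearMap ∘ₗ affP l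

lemma affK_inj {l : ℕ} : Function.Injective (affK (l := l)) := (pk_inj l).comp (affP_inj l)

lemma affK_def {l : ℕ} (a : Aff l) : affK a = pk l (affP l a) := rfl

lemma affK_ne {l : ℕ} {a : Aff l} (h : a ≠ 0) : affK a ≠ 0 := by
  rw [Ne, map_eq_zero_iff _ affK_inj]; exact h

lemma DD_affK {l : ℕ} (j : Fin l) (a : Aff l) :
    DD j (affK a) = algebraMap ℂ _ (a.2 (Pi.single j 1)) := by
  have hC : ∀ c, pk l (MvPolynomial.C c) = algebraMap ℂ (KK l) c := by
    intro c; rw [← MvPolynomial.algebraMap_eq]; exact (pk l).commutes c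
  simp [affK_def, affP, hC, DD_algebraMap, DD_mul, DD_X]

/-- Coordinate functions. -/
def coordA {l : ℕ} (i : Fin l) : Aff l := (0, LinearMap.proj i)

lemma affK_coordA {l : ℕ} (i : Fin l) : affK (coordA i) = pk l (MvPolynomial.X i) := by
  simp [affK_def, affP, coordA, Pi.single_apply]

lemma affK_const {l : ℕ} (c : ℂ) : affK ((c, 0) : Aff l) = algebraMap ℂ (KK l) c := by
  have hC : ∀ c, pk l (MvPolynomial.C c) = algebraMap ℂ (KK l) c := by
    intro c; rw [← MvPolynomial.algebraMap_eq]; exact (pk l).commutes c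
  simp [affK_def, affP, hC]

/-- Linear part of an affine map given by a tuple of affine functions. -/
def linT {a b : ℕ} (t : Fin a → Aff b) : (Fin b → ℂ) →ₗ[ℂ] (Fin a → ℂ) :=
  LinearMap.pi (fun i => (t i).2)

/-- Composition of an affine function with an affine map. -/
def Aff.comp {a b : ℕ} (f : Aff a) (t : Fin a → Aff b) : Aff b :=
  (f.1 + f.2 (fun i => (t i).1), f.2 ∘ₗ linT t)

/-- Evaluation of affine maps. -/
def evT {a b : ℕ} (t : Fin a → Aff b) (u : Fin b → ℂ) : Fin a → ℂ := fun i => (t i).ev u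

lemma Aff.comp_ev {a b : ℕ} (f : Aff a) (t : Fin a → Aff b) (u : Fin b → ℂ) :
    (f.comp t).ev u = f.ev (evT t u) := by
  simp only [Aff.ev, Aff.comp, LinearMap.comp_apply, linT]
  have : evT t u = (fun i => (t i).1) + (LinearMap.pi (fun i => (t i).2)) u := by
    ext i; simp [evT, Aff.ev]
  rw [this, map_add]; ring

/-- Pullback of polynomials along an affine map. -/
def pbP {a b : ℕ} (t : Fin a → Aff b) : PR a →ₐ[ℂ] KK b := MvPolynomial.aeval (fun i => affK (t i))

/-- `x` is regular along `t` with pullback `y`. -/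
def IsReg {a b : ℕ} (t : Fin a → Aff b) (x : KK a) : Prop :=
  ∃ f g : PR a, pbP t g ≠ 0 ∧ x = pk a f / pk a g

lemma ne_of_pbP {a b : ℕ} {t : Fin a → Aff b} {g : PR a} (h : pbP t g ≠ 0) : pk a g ≠ 0 := by
  apply pk_ne; rintro rfl; simp at h

/-- The ring of rational functions that are regular along `t`. -/
def regSub {a b : ℕ} (t : Fin a → Aff b) : Subalgebra ℂ (KK a) where
  carrier := {x | IsReg t x}
  mul_mem' := by
    rintro x y ⟨f, g, hg, rfl⟩ ⟨f', g', hg', rfl⟩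
    exact ⟨f * f', g * g', by simpa using ⟨hg, hg'⟩, by rw [map_mul, map_mul, div_mul_div_comm]⟩
  add_mem' := by
    rintro x y ⟨f, g, hg, rfl⟩ ⟨f', g', hg', rfl⟩
    refine ⟨f * g' + g * f', g * g', by simpa using ⟨hg, hg'⟩, ?_⟩
    rw [div_add_div _ _ (ne_of_pbP hg) (ne_of_pbP hg')]; simp
  algebraMap_mem' c := ⟨MvPolynomial.C c, 1, by simp, by
    rw [map_one, div_one, ← MvPolynomial.algebraMap_eq]; exact ((pk a).commutes c).symm⟩

lemma exists_pb {a b : ℕ} (t : Fin a → Aff b) : ∃ r : KK a →ₗ[ℂ] KK b,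
    ∀ f g : PR a, pbP t g ≠ 0 → r (pk a f / pk a g) = pbP t f / pbP t g := by
  let F : regSub t → KK b := fun x => pbP t x.2.choose / pbP t x.2.choose_spec.choose
  have hF : ∀ (x : regSub t) (f g : PR a), pbP t g ≠ 0 → (x : KK a) = pk a f / pk a g →
      F x = pbP t f / pbP t g := by
    intro x f g hg hx
    obtain ⟨h1, h2⟩ := x.2.choose_spec.choose_spec
    show pbP t x.2.choose / pbP t x.2.choose_spec.choose = _
    generalize x.2.choose_spec.choose = g' at h1 h2 ⊢
    generalize x.2.choose = f' at h2 ⊢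
    rw [div_eq_div_iff h1 hg, ← map_mul, ← map_mul]
    congr 1
    apply pk_inj
    replace h2 := hx.symm.trans h2
    rw [div_eq_div_iff (ne_of_pbP hg) (ne_of_pbP h1)] at h2
    rw [map_mul, map_mul, h2]
  let r0 : (Subalgebra.toSubmodule (regSub t)) →ₗ[ℂ] KK b :=
    { toFun := F
      map_add' := by
        rintro ⟨x, hx⟩ ⟨y, hy⟩
        obtain ⟨f, g, hg, rfl⟩ := id hx
        obtain ⟨f', g', hg', rfl⟩ := id hy
        rw [hF ⟨_, hx⟩ f g hg rfl, hF ⟨_, hy⟩ f' g' hg' rfl,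
          hF _ (f * g' + g * f') (g * g') (by simpa using ⟨hg, hg'⟩)
          (by show pk a f / pk a g + pk a f' / pk a g' = _
              rw [div_add_div _ _ (ne_of_pbP hg) (ne_of_pbP hg')]; simp), div_add_div _ _ hg hg']
        simp
      map_smul' := by
        rintro c ⟨x, hx⟩
        obtain ⟨f, g, hg, rfl⟩ := id hx
        rw [hF ⟨_, hx⟩ f g hg rfl, hF _ (c • f) g hg
          (by show c • (pk a f / pk a g) = _
              rw [map_smul, smul_div_assoc])]
        simp [smul_div_assoc] }
  obtain ⟨r, hr⟩ := LinearMap.exists_extend r0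
  refine ⟨r, fun f g hg => ?_⟩
  have hm : pk a f / pk a g ∈ regSub t := ⟨f, g, hg, rfl⟩
  have := DFunLike.congr_fun hr ⟨_, hm⟩
  rw [← hF ⟨_, hm⟩ f g hg rfl]
  exact this

/-- Pullback of rational functions along an affine map (meaningful on `regSub t`). -/
def pb {a b : ℕ} (t : Fin a → Aff b) : KK a →ₗ[ℂ] KK b := (exists_pb t).choose

lemma pb_frac {a b : ℕ} (t : Fin a → Aff b) (f g : PR a) (hg : pbP t g ≠ 0) :
    pb t (pk a f / pk a g) = pbP t f / pbP t g := (exists_pb t).choose_spec f g hg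

lemma pb_pk {a b : ℕ} (t : Fin a → Aff b) (f : PR a) : pb t (pk a f) = pbP t f := by
  have := pb_frac t f 1 (by simp)
  simpa using this

lemma pk_reg {a b : ℕ} (t : Fin a → Aff b) (f : PR a) : pk a f ∈ regSub t :=
  ⟨f, 1, by simp, by simp⟩

lemma pb_mul {a b : ℕ} (t : Fin a → Aff b) {x y : KK a} (hx : x ∈ regSub t) (hy : y ∈ regSub t) :
    pb t (x * y) = pb t x * pb t y := by
  obtain ⟨f, g, hg, rfl⟩ := id hx
  obtain ⟨f', g', hg', rfl⟩ := id hy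
  rw [div_mul_div_comm, ← map_mul, ← map_mul, pb_frac _ _ _ (by simpa using ⟨hg, hg'⟩),
    pb_frac _ _ _ hg, pb_frac _ _ _ hg', div_mul_div_comm, map_mul, map_mul]

lemma pb_one {a b : ℕ} (t : Fin a → Aff b) : pb t 1 = 1 := by
  have := pb_pk t 1
  simpa using this

lemma pb_algebraMap {a b : ℕ} (t : Fin a → Aff b) (c : ℂ) :
    pb t (algebraMap ℂ _ c) = algebraMap ℂ _ c := by
  rw [Algebra.algebraMap_eq_smul_one, map_smul, pb_one, Algebra.algebraMap_eq_smul_one]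

lemma pb_affK {a b : ℕ} (t : Fin a → Aff b) (f : Aff a) : pb t (affK f) = affK (f.comp t) := by
  rw [affK_def, pb_pk]
  have h : f = f.1 • ((1, 0) : Aff a) + ∑ i, f.2 (Pi.single i 1) • coordA i := by
    apply Aff.ev_inj; intro u
    rw [← affP_eval, ← affP_eval, map_add, map_sum]
    simp only [map_smul, map_add, map_sum, affP_eval]
    simp only [MvPolynomial.smul_eval, affP_eval]
    rw [← affP_eval]
    simp [affP, coordA, Aff.ev]
  have h2 : f.comp t = f.1 • ((1, 0) : Aff b) + ∑ i, f.2 (Pi.single i 1) • t i := by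
    apply Aff.ev_inj; intro u
    rw [Aff.comp_ev]
    conv_lhs => rw [h]
    rw [← affP_eval, ← affP_eval]
    simp only [map_add, map_sum, map_smul, MvPolynomial.smul_eval, affP_eval]
    simp [Aff.ev, coordA, evT]
  conv_lhs => rw [h]
  rw [h2]
  simp only [map_add, map_sum, map_smul]
  congr 1
  · have : affP a (1, 0) = 1 := by simp [affP]
    rw [this, map_one]
    rw [affK_const, map_one]
  · refine Finset.sum_congr rfl fun i _ => ?_
    have : affP a (coordA i) = MvPolynomial.X i := by
      apply pk_inj; rw [← affK_def, affK_coordA]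
    rw [this, pbP, MvPolynomial.aeval_X]

lemma affK_reg {a b : ℕ} (t : Fin a → Aff b) (f : Aff a) : affK f ∈ regSub t := pk_reg t _

lemma inv_reg {a b : ℕ} (t : Fin a → Aff b) {x : KK a} (hx : x ∈ regSub t) (h : pb t x ≠ 0) :
    x⁻¹ ∈ regSub t := by
  obtain ⟨f, g, hg, rfl⟩ := id hx
  rw [pb_frac _ _ _ hg] at h
  refine ⟨g, f, ?_, by simp⟩
  rintro h0; simp [h0] at h

lemma pb_inv {a b : ℕ} (t : Fin a → Aff b) {x : KK a} (hx : x ∈ regSub t) (h : pb t x ≠ 0) :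
    pb t x⁻¹ = (pb t x)⁻¹ := by
  have h1 := pb_mul t hx (inv_reg t hx h)
  have hx0 : x ≠ 0 := by rintro rfl; simp at h
  rw [mul_inv_cancel₀ hx0, pb_one] at h1
  exact eq_inv_of_mul_eq_one_right h1.symm

lemma DD_pbP {a b : ℕ} (t : Fin a → Aff b) (j : Fin b) (f : PR a) :
    DD j (pbP t f) = ∑ i, (t i).2 (Pi.single j 1) • pb t (DD i (pk a f)) ∧
    ∀ i, DD i (pk a f) ∈ regSub t := by
  induction f using MvPolynomial.induction_on with
  | C c =>
    have hC : ∀ c, pk a (MvPolynomial.C c) = algebraMap ℂ (KK a) c := by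
      intro c; rw [← MvPolynomial.algebraMap_eq]; exact (pk a).commutes c
    rw [← pb_pk, hC, pb_algebraMap]
    simp [DD_algebraMap]
  | add p q hp hq =>
    refine ⟨?_, fun i => ?_⟩
    · simp only [map_add, hp.1, hq.1, smul_add, Finset.sum_add_distrib]
    · simp only [map_add]; exact add_mem (hp.2 i) (hq.2 i)
  | mul_X p k hp =>
    have hr : ∀ i, DD i (pk a (MvPolynomial.X k)) ∈ regSub t := by
      intro i; rw [DD_X]; split_ifs
      · exact one_mem _
      · exact zero_mem _
    refine ⟨?_, fun i => ?_⟩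
    · have e : ∀ i, pb t (DD i (pk a (p * MvPolynomial.X k))) =
          pbP t p * (if k = i then 1 else 0) + pbP t (MvPolynomial.X k) * pb t (DD i (pk a p)) := by
        intro i
        rw [map_mul, DD_mul, map_add, pb_mul t (pk_reg t _) (hr i), pb_mul t (pk_reg t _) (hp.2 i),
          pb_pk, pb_pk, DD_X]
        congr 2
        split_ifs
        · exact pb_one t
        · exact map_zero _
      rw [map_mul, DD_mul, hp.1]
      simp only [e]
      rw [show pbP t (MvPolynomial.X k) = affK (t k) by simp [pbP], DD_affK]
      simp only [Finset.mul_sum, Algebra.smul_def, mul_add, Finset.sum_add_distrib]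
      congr 1
      · simp [mul_comm]
      · refine Finset.sum_congr rfl fun i _ => ?_
        ring
    · rw [map_mul, DD_mul]
      exact add_mem (mul_mem (pk_reg t _) (hr i)) (mul_mem (pk_reg t _) (hp.2 i))

lemma DD_reg {a b : ℕ} (t : Fin a → Aff b) (i : Fin a) {x : KK a} (hx : x ∈ regSub t) :
    DD i x ∈ regSub t := by
  obtain ⟨f, g, hg, rfl⟩ := id hx
  rcases Nat.eq_zero_or_pos b with hb | hb
  · have h0 : ∀ f : PR a, DD i (pk a f) ∈ regSub t := by
      intro f
      induction f using MvPolynomial.induction_on with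
      | C c =>
        have hC : ∀ c, pk a (MvPolynomial.C c) = algebraMap ℂ (KK a) c := by
          intro c; rw [← MvPolynomial.algebraMap_eq]; exact (pk a).commutes c
        rw [hC, DD_algebraMap]; exact zero_mem _
      | add p q hp hq => rw [map_add, map_add]; exact add_mem hp hq
      | mul_X p k hp =>
        rw [map_mul, DD_mul, DD_X]
        refine add_mem (mul_mem (pk_reg t _) ?_) (mul_mem (pk_reg t _) hp)
        split_ifs
        · exact one_mem _
        · exact zero_mem _
    have hg' : (pk a g)⁻¹ ∈ regSub t := inv_reg t (pk_reg t g) (by rwa [pb_pk])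
    rw [div_eq_mul_inv, DD_mul, DD_inv]
    exact add_mem (mul_mem (pk_reg t _) (neg_mem (mul_mem (mul_mem hg' hg') (h0 g)))) (mul_mem hg' (h0 f))
  · have h0 : ∀ f : PR a, DD i (pk a f) ∈ regSub t := fun f => (DD_pbP t ⟨0, hb⟩ f).2 i
    have hg' : (pk a g)⁻¹ ∈ regSub t := inv_reg t (pk_reg t g) (by rwa [pb_pk])
    rw [div_eq_mul_inv, DD_mul, DD_inv]
    exact add_mem (mul_mem (pk_reg t _) (neg_mem (mul_mem (mul_mem hg' hg') (h0 g)))) (mul_mem hg' (h0 f))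

lemma DD_pb {a b : ℕ} (t : Fin a → Aff b) (j : Fin b) {x : KK a} (hx : x ∈ regSub t) :
    DD j (pb t x) = ∑ i, (t i).2 (Pi.single j 1) • pb t (DD i x) := by
  obtain ⟨f, g, hg, rfl⟩ := id hx
  have hg1 := ne_of_pbP hg
  set x := pk a f / pk a g with hxd
  have e : pk a f = x * pk a g := by rw [hxd, div_mul_cancel₀ _ hg1]
  have h1 := (DD_pbP t j f).1
  have h2 := (DD_pbP t j g).1
  rw [← pb_pk, e, pb_mul t hx (pk_reg t g), DD_mul] at h1
  have e2 : ∀ i, pb t (DD i (x * pk a g)) = pb t x * pb t (DD i (pk a g)) + pbP t g * pb t (DD i x) := by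
    intro i
    rw [DD_mul, map_add, pb_mul t hx (DD_reg t i (pk_reg t g)), pb_mul t (pk_reg t g) (DD_reg t i hx), pb_pk]
  simp only [e2, pb_pk, h2, smul_add, Finset.sum_add_distrib] at h1
  have h3 : pbP t g * DD j (pb t x) = pbP t g * ∑ i, (t i).2 (Pi.single j 1) • pb t (DD i x) := by
    have h4 : pb t x * ∑ i, (t i).2 (Pi.single j 1) • pb t (DD i (pk a g)) =
      ∑ i, (t i).2 (Pi.single j 1) • (pb t x * pb t (DD i (pk a g))) := by
      rw [Finset.mul_sum]; exact Finset.sum_congr rfl fun i _ => by rw [mul_smul_comm]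
    have h5 : pbP t g * ∑ i, (t i).2 (Pi.single j 1) • pb t (DD i x) =
      ∑ i, (t i).2 (Pi.single j 1) • (pbP t g * pb t (DD i x)) := by
      rw [Finset.mul_sum]; exact Finset.sum_congr rfl fun i _ => by rw [mul_smul_comm]
    rw [h4, ← h5] at h1
    exact add_left_cancel h1
  exact mul_left_cancel₀ hg h3

end RV

end

noncomputable section
namespace RV

/-- The exterior algebra of the tangent space. -/
abbrev XA (l : ℕ) := ExteriorAlgebra ℂ (Fin l → ℂ)

/-- Rational differential forms (of mixed degree) on `ℂ^l`. -/
abbrev Form (l : ℕ) := XA l →ₗ[ℂ] KK l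

/-- Contraction on the exterior algebra. -/
abbrev ctr {l : ℕ} (θ : Module.Dual ℂ (Fin l → ℂ)) : XA l →ₗ[ℂ] XA l :=
  CliffordAlgebra.contractLeft (Q := (0 : QuadraticForm ℂ (Fin l → ℂ))) θ

/-- Exterior multiplication of a form by a constant covector. -/
def EE {l : ℕ} (θ : Module.Dual ℂ (Fin l → ℂ)) : Form l →ₗ[ℂ] Form l :=
  LinearMap.lcomp ℂ (KK l) (ctr θ)

/-- Contraction of a form with a constant vector field. -/
def II {l : ℕ} (v : Fin l → ℂ) : Form l →ₗ[ℂ] Form l :=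
  LinearMap.lcomp ℂ (KK l) (LinearMap.mulLeft ℂ (ExteriorAlgebra.ι ℂ v))

/-- Coordinate covectors. -/
abbrev dx {l : ℕ} (j : Fin l) : Module.Dual ℂ (Fin l → ℂ) := LinearMap.proj j

/-- Coefficientwise derivative. -/
def DF {l : ℕ} (j : Fin l) : Form l →ₗ[ℂ] Form l := LinearMap.compRight ℂ (DD j)

/-- The exterior derivative. -/
def dd {l : ℕ} : Form l →ₗ[ℂ] Form l := ∑ j, DF j ∘ₗ EE (dx j)

@[simp] lemma EE_apply {l : ℕ} (θ) (z : Form l) (x : XA l) : EE θ z x = z (ctr θ x) := rfl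
@[simp] lemma II_apply {l : ℕ} (v) (z : Form l) (x : XA l) : II v z x = z (ExteriorAlgebra.ι ℂ v * x) := rfl
@[simp] lemma DF_apply {l : ℕ} (j) (z : Form l) (x : XA l) : DF j z x = DD j (z x) := rfl
lemma dd_apply {l : ℕ} (z : Form l) : dd z = ∑ j, DF j (EE (dx j) z) := by simp [dd]
lemma dd_apply' {l : ℕ} (z : Form l) (x : XA l) : dd z x = ∑ j, DD j (z (ctr (dx j) x)) := by
  simp [dd]

lemma EE_add {l : ℕ} (θ θ' : Module.Dual ℂ (Fin l → ℂ)) (z : Form l) :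
    EE (θ + θ') z = EE θ z + EE θ' z := by refine LinearMap.ext fun x => ?_; simp [map_add]
lemma EE_smul {l : ℕ} (c : ℂ) (θ : Module.Dual ℂ (Fin l → ℂ)) (z : Form l) :
    EE (c • θ) z = c • EE θ z := by refine LinearMap.ext fun x => ?_; simp
@[simp] lemma EE_zero {l : ℕ} (z : Form l) : EE (0 : Module.Dual ℂ (Fin l → ℂ)) z = 0 := by
  refine LinearMap.ext fun x => ?_; simp
lemma EE_sum {l : ℕ} {ι : Type*} (s : Finset ι) (θ : ι → Module.Dual ℂ (Fin l → ℂ)) (z : Form l) :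
    EE (∑ i ∈ s, θ i) z = ∑ i ∈ s, EE (θ i) z := by refine LinearMap.ext fun x => ?_; simp [map_sum]

@[simp] lemma EE_EE_self {l : ℕ} (θ) (z : Form l) : EE θ (EE θ z) = 0 := by
  refine LinearMap.ext fun x => ?_
  simp [CliffordAlgebra.contractLeft_contractLeft]

lemma EE_comm {l : ℕ} (θ θ') (z : Form l) : EE θ (EE θ' z) = - EE θ' (EE θ z) := by
  refine LinearMap.ext fun x => ?_
  simp only [EE_apply, LinearMap.neg_apply]
  rw [CliffordAlgebra.contractLeft_comm, map_neg]

lemma II_EE {l : ℕ} (v θ) (z : Form l) : II v (EE θ z) = θ v • z - EE θ (II v z) := by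
  refine LinearMap.ext fun x => ?_
  simp only [II_apply, EE_apply, LinearMap.sub_apply, LinearMap.smul_apply]
  have : ctr θ (ExteriorAlgebra.ι ℂ v * x) = θ v • x - ExteriorAlgebra.ι ℂ v * ctr θ x :=
    CliffordAlgebra.contractLeft_ι_mul ..
  rw [this, map_sub, map_smul]

lemma EE_ksmul {l : ℕ} (θ) (f : KK l) (z : Form l) : EE θ (f • z) = f • EE θ z := rfl
lemma II_ksmul {l : ℕ} (v) (f : KK l) (z : Form l) : II v (f • z) = f • II v z := rfl

lemma DF_EE {l : ℕ} (j : Fin l) (θ) (z : Form l) : DF j (EE θ z) = EE θ (DF j z) := rfl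
lemma DF_comm {l : ℕ} (i j : Fin l) (z : Form l) : DF i (DF j z) = DF j (DF i z) := by
  refine LinearMap.ext fun x => ?_; simp [DD_comm i j]

lemma dd_EE {l : ℕ} (θ) (z : Form l) : dd (EE θ z) = - EE θ (dd z) := by
  simp only [dd_apply, map_sum, ← Finset.sum_neg_distrib]
  refine Finset.sum_congr rfl fun j _ => ?_
  rw [EE_comm, map_neg, DF_EE]

lemma dd_dd {l : ℕ} (z : Form l) : dd (dd z) = 0 := by
  have e : dd (dd z) = ∑ i, ∑ j, DF i (DF j (EE (dx i) (EE (dx j) z))) := by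
    rw [dd_apply (dd z)]
    refine Finset.sum_congr rfl fun i _ => ?_
    rw [dd_apply z, map_sum, map_sum]
    exact Finset.sum_congr rfl fun j _ => by rw [DF_EE]; rfl
  have e2 : dd (dd z) = - dd (dd z) := by
    conv_lhs => rw [e, Finset.sum_comm]
    rw [e, ← Finset.sum_neg_distrib]
    refine Finset.sum_congr rfl fun i _ => ?_
    rw [← Finset.sum_neg_distrib]
    refine Finset.sum_congr rfl fun j _ => ?_
    rw [DF_comm, EE_comm]; simp
  have h2 : (2 : ℂ) • dd (dd z) = 0 := by
    rw [two_smul]; nth_rewrite 1 [e2]; simp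
  exact (smul_eq_zero.1 h2).resolve_left (by norm_num)

lemma dd_ksmul {l : ℕ} (f : KK l) (z : Form l) :
    dd (f • z) = f • dd z + ∑ j, DD j f • EE (dx j) z := by
  simp only [dd_apply, Finset.smul_sum, ← Finset.sum_add_distrib]
  refine Finset.sum_congr rfl fun j _ => ?_
  refine LinearMap.ext fun x => ?_
  simp only [DF_apply, EE_apply, LinearMap.smul_apply, LinearMap.add_apply, smul_eq_mul, DD_mul]
  ring

lemma dual_eq_sum {l : ℕ} (θ : Module.Dual ℂ (Fin l → ℂ)) :
    θ = ∑ j, θ (Pi.single j 1) • dx j := by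
  apply LinearMap.pi_ext'
  intro i
  ext
  simp [Pi.single_apply]

lemma dd_aff_smul {l : ℕ} (a : Aff l) (z : Form l) :
    dd (affK a • z) = affK a • dd z + EE a.2 z := by
  rw [dd_ksmul]
  congr 1
  conv_rhs => rw [dual_eq_sum a.2, EE_sum]
  refine Finset.sum_congr rfl fun j _ => ?_
  rw [DD_affK, EE_smul, algebraMap_smul]

lemma dd_inv_smul {l : ℕ} (a : Aff l) (z : Form l) :
    dd ((affK a)⁻¹ • z) = (affK a)⁻¹ • (dd z - (affK a)⁻¹ • EE a.2 z) := by
  rw [dd_ksmul, smul_sub, sub_eq_add_neg]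
  congr 1
  conv_rhs => rw [dual_eq_sum a.2, EE_sum]
  rw [Finset.smul_sum, Finset.smul_sum, ← Finset.sum_neg_distrib]
  refine Finset.sum_congr rfl fun j _ => ?_
  rw [DD_inv, DD_affK, EE_smul]
  refine LinearMap.ext fun x => ?_
  simp [Algebra.smul_def]
  ring

/-- Wedge with the logarithmic form `da / a`. -/
def wl {l : ℕ} (a : Aff l) : Form l →ₗ[ℂ] Form l where
  toFun z := (affK a)⁻¹ • EE a.2 z
  map_add' x y := by rw [map_add, smul_add]
  map_smul' c x := by rw [map_smul, RingHom.id_apply, smul_comm]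

lemma wl_def {l : ℕ} (a : Aff l) (z : Form l) : wl a z = (affK a)⁻¹ • EE a.2 z := rfl

lemma wl_ksmul {l : ℕ} (a : Aff l) (f : KK l) (z : Form l) : wl a (f • z) = f • wl a z := by
  rw [wl_def, wl_def, EE_ksmul, smul_comm]

lemma wl_EE {l : ℕ} (a : Aff l) (θ) (z : Form l) : wl a (EE θ z) = - EE θ (wl a z) := by
  rw [wl_def, wl_def, EE_ksmul, EE_comm, smul_neg]

lemma wl_comm {l : ℕ} (a b : Aff l) (z : Form l) : wl a (wl b z) = - wl b (wl a z) := by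
  rw [wl_def b, wl_def b, wl_ksmul, wl_EE, smul_neg]

@[simp] lemma wl_wl_self {l : ℕ} (a : Aff l) (z : Form l) : wl a (wl a z) = 0 := by
  rw [wl_def, wl_def, EE_ksmul, EE_EE_self, smul_zero, smul_zero]

lemma dd_wl {l : ℕ} (a : Aff l) (z : Form l) : dd (wl a z) = - wl a (dd z) := by
  rw [wl_def, dd_inv_smul, EE_EE_self, dd_EE, wl_def]; simp

lemma wl_smul_aff {l : ℕ} (c : ℂ) (hc : c ≠ 0) (a : Aff l) (z : Form l) : wl (c • a) z = wl a z := by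
  rw [wl_def, wl_def, map_smul]
  show _ • EE (c • a.2) z = _
  rw [EE_smul, Algebra.smul_def, mul_inv]
  refine LinearMap.ext fun x => ?_
  have : (algebraMap ℂ (KK l) c) ≠ 0 := by simpa using hc
  simp [Algebra.smul_def]
  field_simp

lemma wl_const {l : ℕ} (c : ℂ) (z : Form l) : wl ((c, 0) : Aff l) z = 0 := by
  simp [wl_def]

/-- The constant form `1`. -/
def oneF (l : ℕ) : Form l :=
  (Algebra.linearMap ℂ (KK l)) ∘ₗ (ExteriorAlgebra.algebraMapInv (R := ℂ) (M := Fin l → ℂ)).toLinearMap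

lemma II_one {l : ℕ} (v : Fin l → ℂ) : II v (oneF l) = 0 := by
  refine LinearMap.ext fun x => ?_
  simp [oneF, ExteriorAlgebra.algebraMapInv]

lemma dd_one {l : ℕ} : dd (oneF l) = 0 := by
  refine LinearMap.ext fun x => ?_
  rw [dd_apply']
  simp [oneF, DD_algebraMap]

/-- Pullback of forms along an affine map. -/
def Pb {a b : ℕ} (t : Fin a → Aff b) : Form a →ₗ[ℂ] Form b :=
  LinearMap.compRight ℂ (pb t) ∘ₗ LinearMap.lcomp ℂ (KK a) (ExteriorAlgebra.map (linT t)).toLinearMap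

lemma Pb_apply {a b : ℕ} (t : Fin a → Aff b) (z : Form a) (x : XA b) :
    Pb t z x = pb t (z (ExteriorAlgebra.map (linT t) x)) := rfl

/-- Regular forms along an affine map. -/
def RegF {a b : ℕ} (t : Fin a → Aff b) (z : Form a) : Prop := ∀ x, z x ∈ regSub t

lemma ctr_map {a b : ℕ} (L : (Fin b → ℂ) →ₗ[ℂ] (Fin a → ℂ)) (θ) (x : XA b) :
    ctr θ (ExteriorAlgebra.map L x) = ExteriorAlgebra.map L (ctr (θ ∘ₗ L) x) := by
  induction x using CliffordAlgebra.left_induction with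
  | algebraMap r =>
    simp only [AlgHom.commutes]
    rw [CliffordAlgebra.contractLeft_algebraMap, CliffordAlgebra.contractLeft_algebraMap, map_zero]
  | add x y hx hy => simp only [map_add, hx, hy]
  | ι_mul x m hx =>
    have h1 : ∀ (k : ℕ) (θ) (m : Fin k → ℂ) (x : XA k), ctr θ (ExteriorAlgebra.ι ℂ m * x) =
        θ m • x - ExteriorAlgebra.ι ℂ m * ctr θ x := fun k θ m x =>
      CliffordAlgebra.contractLeft_ι_mul ..
    have h2 : ExteriorAlgebra.map L (ExteriorAlgebra.ι ℂ m * x) =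
        ExteriorAlgebra.ι ℂ (L m) * ExteriorAlgebra.map L x := by
      rw [map_mul, ExteriorAlgebra.map_apply_ι]
    have h3 := h1 b (θ ∘ₗ L) m x
    refine (congrArg (ctr θ) h2).trans ?_
    rw [h1, hx]
    refine Eq.trans ?_ (congrArg (ExteriorAlgebra.map L) h3).symm
    rw [map_sub, map_smul, map_mul, ExteriorAlgebra.map_apply_ι]
    rfl

lemma Pb_EE {a b : ℕ} (t : Fin a → Aff b) (θ) (z : Form a) :
    Pb t (EE θ z) = EE (θ ∘ₗ linT t) (Pb t z) := by
  refine LinearMap.ext fun x => ?_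
  rw [Pb_apply, EE_apply, EE_apply, Pb_apply, ctr_map]

lemma Pb_II {a b : ℕ} (t : Fin a → Aff b) (v) (z : Form a) :
    Pb t (II (linT t v) z) = II v (Pb t z) := by
  refine LinearMap.ext fun x => ?_
  rw [Pb_apply, II_apply, II_apply, Pb_apply, map_mul (ExteriorAlgebra.map (linT t)),
    ExteriorAlgebra.map_apply_ι]

lemma Pb_one {a b : ℕ} (t : Fin a → Aff b) : Pb t (oneF a) = oneF b := by
  refine LinearMap.ext fun x => ?_
  rw [Pb_apply]
  simp only [oneF, LinearMap.comp_apply, Algebra.linearMap_apply, AlgHom.toLinearMap_apply, pb_algebraMap]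
  congr 1
  have : (ExteriorAlgebra.algebraMapInv.comp (ExteriorAlgebra.map (linT t)) : XA b →ₐ[ℂ] ℂ) = ExteriorAlgebra.algebraMapInv := by
    apply ExteriorAlgebra.hom_ext
    ext i
    simp [ExteriorAlgebra.algebraMapInv]
  exact DFunLike.congr_fun this x

lemma Pb_ksmul {a b : ℕ} (t : Fin a → Aff b) {f : KK a} (hf : f ∈ regSub t) {z : Form a} (hz : RegF t z) :
    Pb t (f • z) = pb t f • Pb t z := by
  refine LinearMap.ext fun x => ?_
  simp only [Pb_apply, LinearMap.smul_apply, smul_eq_mul]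
  exact pb_mul t hf (hz _)

lemma RegF.EE {a b : ℕ} {t : Fin a → Aff b} {z : Form a} (hz : RegF t z) (θ) : RegF t (EE θ z) :=
  fun _ => hz _
lemma RegF.II {a b : ℕ} {t : Fin a → Aff b} {z : Form a} (hz : RegF t z) (v) : RegF t (II v z) :=
  fun _ => hz _
lemma RegF.ksmul {a b : ℕ} {t : Fin a → Aff b} {z : Form a} (hz : RegF t z) {f : KK a} (hf : f ∈ regSub t) :
    RegF t (f • z) := fun _ => mul_mem hf (hz _)
lemma RegF.add {a b : ℕ} {t : Fin a → Aff b} {z y : Form a} (hz : RegF t z) (hy : RegF t y) :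
    RegF t (z + y) := fun _ => add_mem (hz _) (hy _)

lemma dd_Pb {a b : ℕ} (t : Fin a → Aff b) {z : Form a} (hz : RegF t z) :
    dd (Pb t z) = Pb t (dd z) := by
  refine LinearMap.ext fun x => ?_
  rw [dd_apply', Pb_apply, dd_apply', map_sum]
  simp only [Pb_apply, DD_pb t _ (hz _)]
  rw [Finset.sum_comm]
  refine Finset.sum_congr rfl fun i _ => ?_
  rw [ctr_map]
  have : (dx i ∘ₗ linT t : Module.Dual ℂ (Fin b → ℂ)) = ∑ j, (t i).2 (Pi.single j 1) • dx j := by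
    rw [← dual_eq_sum]; rfl
  rw [this]
  simp only [map_sum, LinearMap.sum_apply, map_smul, LinearMap.smul_apply]

lemma RegF.wl {a b : ℕ} {t : Fin a → Aff b} {z : Form a} (hz : RegF t z) {f : Aff a} (hf : f.comp t ≠ 0) :
    RegF t (wl f z) :=
  (hz.EE _).ksmul (inv_reg t (affK_reg t f) (by rw [pb_affK]; exact affK_ne hf))

lemma Pb_wl {a b : ℕ} (t : Fin a → Aff b) {z : Form a} (hz : RegF t z) {f : Aff a} (hf : f.comp t ≠ 0) :
    Pb t (wl f z) = wl (f.comp t) (Pb t z) := by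
  have h0 : pb t (affK f) ≠ 0 := by rw [pb_affK]; exact affK_ne hf
  rw [wl_def, Pb_ksmul t (inv_reg t (affK_reg t f) h0) (hz.EE _), pb_inv t (affK_reg t f) h0, pb_affK,
    Pb_EE]
  rfl

end RV

end

noncomputable section
namespace RV

/-- Regular functions on the complement of the arrangement. -/
def RA {l : ℕ} (A : Set (Aff l)) : Subalgebra ℂ (KK l) :=
  Algebra.adjoin ℂ (Set.range (affK (l := l)) ∪ (fun a => (affK a)⁻¹) '' A)

lemma affK_mem {l : ℕ} (A : Set (Aff l)) (f : Aff l) : affK f ∈ RA A :=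
  Algebra.subset_adjoin (Or.inl ⟨f, rfl⟩)

lemma inv_mem {l : ℕ} {A : Set (Aff l)} {a : Aff l} (h : a ∈ A) : (affK a)⁻¹ ∈ RA A :=
  Algebra.subset_adjoin (Or.inr ⟨a, h, rfl⟩)

lemma RA_le {l : ℕ} {A : Set (Aff l)} {S : Subalgebra ℂ (KK l)} (h1 : ∀ f, affK f ∈ S)
    (h2 : ∀ a ∈ A, (affK a)⁻¹ ∈ S) : RA A ≤ S := by
  apply Algebra.adjoin_le
  rintro x (⟨f, rfl⟩ | ⟨a, ha, rfl⟩)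
  · exact h1 f
  · exact h2 a ha

lemma RA_mono {l : ℕ} {A B : Set (Aff l)} (h : A ⊆ B) : RA A ≤ RA B :=
  RA_le (affK_mem B) (fun _ ha => inv_mem (h ha))

lemma pk_mem {l : ℕ} (A : Set (Aff l)) (f : PR l) : pk l f ∈ RA A := by
  induction f using MvPolynomial.induction_on with
  | C c =>
    have : pk l (MvPolynomial.C c) = algebraMap ℂ _ c := by
      rw [← MvPolynomial.algebraMap_eq]; exact (pk l).commutes c
    rw [this]; exact Subalgebra.algebraMap_mem _ _
  | add p q hp hq => rw [map_add]; exact add_mem hp hq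
  | mul_X p i hp => rw [map_mul, ← affK_coordA]; exact mul_mem hp (affK_mem _ _)

@[elab_as_elim]
lemma RA_induction {l : ℕ} {A : Set (Aff l)} {P : (x : KK l) → x ∈ RA A → Prop} (h1 : ∀ f, P (affK f) (affK_mem _ _))
    (h2 : ∀ a (ha : a ∈ A), P (affK a)⁻¹ (inv_mem ha))
    (hc : ∀ c : ℂ, P (algebraMap ℂ _ c) (Subalgebra.algebraMap_mem _ _))
    (hadd : ∀ x y (hx : x ∈ RA A) (hy : y ∈ RA A), P x hx → P y hy → P (x + y) (add_mem hx hy))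
    (hmul : ∀ x y (hx : x ∈ RA A) (hy : y ∈ RA A), P x hx → P y hy → P (x * y) (mul_mem hx hy))
    {x : KK l} (hx : x ∈ RA A) : P x hx := by
  refine Algebra.adjoin_induction (p := fun x h => P x h) ?_ hc hadd hmul hx
  rintro x (⟨f, rfl⟩ | ⟨a, ha, rfl⟩)
  · exact h1 f
  · exact h2 a ha

lemma DD_mem {l : ℕ} {A : Set (Aff l)} (j : Fin l) {x : KK l} (hx : x ∈ RA A) : DD j x ∈ RA A := by
  induction hx using RA_induction with
  | h1 f => rw [DD_affK]; exact Subalgebra.algebraMap_mem _ _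
  | h2 a ha =>
    rw [DD_inv, DD_affK]
    exact neg_mem (mul_mem (mul_mem (inv_mem ha) (inv_mem ha)) (Subalgebra.algebraMap_mem _ _))
  | hc c => rw [DD_algebraMap]; exact zero_mem _
  | hadd x y _ _ hx hy => rw [map_add]; exact add_mem hx hy
  | hmul x y hx hy hx' hy' => rw [DD_mul]; exact add_mem (mul_mem hx hy') (mul_mem hy hx')

/-- Forms with coefficients in a subalgebra. -/
def Om {l : ℕ} (A : Set (Aff l)) : Submodule ℂ (Form l) where
  carrier := {z | ∀ x, z x ∈ RA A}
  add_mem' h1 h2 x := add_mem (h1 x) (h2 x)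
  zero_mem' _ := zero_mem _
  smul_mem' c _ h x := Subalgebra.smul_mem _ (h x) c

lemma mem_Om {l : ℕ} {A : Set (Aff l)} {z : Form l} : z ∈ Om A ↔ ∀ x, z x ∈ RA A := Iff.rfl

lemma Om_mono {l : ℕ} {A B : Set (Aff l)} (h : A ⊆ B) : Om A ≤ Om B := fun _ hz x => RA_mono h (hz x)

lemma Om_EE {l : ℕ} {A : Set (Aff l)} (θ) {z : Form l} (hz : z ∈ Om A) : EE θ z ∈ Om A := fun _ => hz _
lemma Om_II {l : ℕ} {A : Set (Aff l)} (v) {z : Form l} (hz : z ∈ Om A) : II v z ∈ Om A := fun _ => hz _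
lemma Om_ksmul {l : ℕ} {A : Set (Aff l)} {f : KK l} (hf : f ∈ RA A) {z : Form l} (hz : z ∈ Om A) :
    f • z ∈ Om A := fun _ => mul_mem hf (hz _)
lemma Om_dd {l : ℕ} {A : Set (Aff l)} {z : Form l} (hz : z ∈ Om A) : dd z ∈ Om A := fun x => by
  rw [dd_apply']; exact sum_mem fun j _ => DD_mem j (hz _)
lemma Om_wl {l : ℕ} {A : Set (Aff l)} {a : Aff l} (ha : a ∈ A) {z : Form l} (hz : z ∈ Om A) :
    wl a z ∈ Om A := Om_ksmul (inv_mem ha) (Om_EE _ hz)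
lemma Om_one {l : ℕ} (A : Set (Aff l)) : oneF l ∈ Om A := fun _ => Subalgebra.algebraMap_mem _ _

/-- Brieskorn monomials. -/
inductive BrGen {l : ℕ} (A : Set (Aff l)) : Form l → Prop
  | one : BrGen A (oneF l)
  | wl (a : Aff l) (ha : a ∈ A) (z : Form l) (hz : BrGen A z) : BrGen A (wl a z)

/-- The Brieskorn algebra, generated by the logarithmic forms. -/
def Br {l : ℕ} (A : Set (Aff l)) : Submodule ℂ (Form l) := Submodule.span ℂ {z | BrGen A z}

lemma Br_one {l : ℕ} (A : Set (Aff l)) : oneF l ∈ Br A := Submodule.subset_span BrGen.one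

lemma Br_wl {l : ℕ} {A : Set (Aff l)} {a : Aff l} (ha : a ∈ A) {z : Form l} (hz : z ∈ Br A) :
    wl a z ∈ Br A := by
  have : (Br A).map (wl a) ≤ Br A := by
    rw [Br, Submodule.map_span_le]
    intro m hm
    exact Submodule.subset_span (BrGen.wl a ha m hm)
  exact this ⟨z, hz, rfl⟩

/-- Induction: `Br A` is the least submodule containing `1` closed under `wl a`. -/
lemma Br_le {l : ℕ} {A : Set (Aff l)} {N : Submodule ℂ (Form l)} (h1 : oneF l ∈ N)
    (h2 : ∀ a ∈ A, ∀ z ∈ Br A, z ∈ N → wl a z ∈ N) : Br A ≤ N := by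
  rw [Br, Submodule.span_le]
  intro z hz
  induction hz with
  | one => exact h1
  | wl a ha z hz ih => exact h2 a ha z (Submodule.subset_span hz) ih

lemma Br_mono {l : ℕ} {A B : Set (Aff l)} (h : A ⊆ B) : Br A ≤ Br B :=
  Br_le (Br_one B) (fun _ ha _ _ hz => Br_wl (h ha) hz)

lemma Br_le_Om {l : ℕ} (A : Set (Aff l)) : Br A ≤ Om A :=
  Br_le (Om_one A) (fun _ ha _ _ hz => Om_wl ha hz)

lemma dd_Br {l : ℕ} {A : Set (Aff l)} {z : Form l} (hz : z ∈ Br A) : dd z = 0 := by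
  have : Br A ≤ LinearMap.ker (dd (l := l)) := by
    refine Br_le (by simpa using dd_one) ?_
    intro a _ z _ hz
    rw [LinearMap.mem_ker] at hz ⊢
    rw [dd_wl, hz]; simp
  exact this hz

/-- Every element of `A` is constant or proportional to an element of `B`. -/
def Sub' {l : ℕ} (A B : Set (Aff l)) : Prop :=
  ∀ a ∈ A, a.2 = 0 ∨ ∃ c : ℂ, c ≠ 0 ∧ ∃ b ∈ B, a = c • b

lemma RA_sub' {l : ℕ} {A B : Set (Aff l)} (h : Sub' A B) : RA A ≤ RA B := by
  refine RA_le (affK_mem B) fun a ha => ?_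
  rcases h a ha with h | ⟨c, hc, b, hb, rfl⟩
  · have : a = (a.1, 0) := Prod.ext rfl h
    rw [this, affK_const, ← map_inv₀]
    exact Subalgebra.algebraMap_mem _ _
  · rw [map_smul, Algebra.smul_def, mul_inv, ← map_inv₀]
    exact mul_mem (Subalgebra.algebraMap_mem _ _) (inv_mem hb)

lemma Om_sub' {l : ℕ} {A B : Set (Aff l)} (h : Sub' A B) : Om A ≤ Om B := fun _ hz x => RA_sub' h (hz x)

lemma Br_sub' {l : ℕ} {A B : Set (Aff l)} (h : Sub' A B) : Br A ≤ Br B := by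
  refine Br_le (Br_one B) fun a ha z _ hz => ?_
  rcases h a ha with h | ⟨c, hc, b, hb, rfl⟩
  · have : a = (a.1, 0) := Prod.ext rfl h
    rw [this, wl_const]; exact zero_mem _
  · rw [wl_smul_aff c hc]; exact Br_wl hb hz

/-! ### regularity along an affine map -/

lemma RA_reg {a b : ℕ} {t : Fin a → Aff b} {A : Set (Aff a)} (h : ∀ f ∈ A, f.comp t ≠ 0) :
    RA A ≤ regSub t :=
  RA_le (affK_reg t) fun f hf => inv_reg t (affK_reg t f) (by rw [pb_affK]; exact affK_ne (h f hf))

lemma Om_reg {a b : ℕ} {t : Fin a → Aff b} {A : Set (Aff a)} (h : ∀ f ∈ A, f.comp t ≠ 0) {z : Form a}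
    (hz : z ∈ Om A) : RegF t z := fun x => RA_reg h (hz x)

lemma pb_RA {a b : ℕ} {t : Fin a → Aff b} {A : Set (Aff a)} {B : Set (Aff b)}
    (h : ∀ f ∈ A, f.comp t ≠ 0) (hB : ∀ f ∈ A, f.comp t ∈ B) {x : KK a} (hx : x ∈ RA A) :
    pb t x ∈ RA B := by
  induction hx using RA_induction with
  | h1 f => rw [pb_affK]; exact affK_mem _ _
  | h2 f hf =>
    rw [pb_inv t (affK_reg t f) (by rw [pb_affK]; exact affK_ne (h f hf)), pb_affK]
    exact inv_mem (hB f hf)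
  | hc c => rw [pb_algebraMap]; exact Subalgebra.algebraMap_mem _ _
  | hadd x y _ _ hx hy => rw [map_add]; exact add_mem hx hy
  | hmul x y hx hy hx' hy' => rw [pb_mul t (RA_reg h hx) (RA_reg h hy)]; exact mul_mem hx' hy'

lemma Pb_Om {a b : ℕ} {t : Fin a → Aff b} {A : Set (Aff a)} {B : Set (Aff b)}
    (h : ∀ f ∈ A, f.comp t ≠ 0) (hB : ∀ f ∈ A, f.comp t ∈ B) {z : Form a} (hz : z ∈ Om A) :
    Pb t z ∈ Om B := fun _ => pb_RA h hB (hz _)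

lemma Pb_Br {a b : ℕ} {t : Fin a → Aff b} {A : Set (Aff a)} {B : Set (Aff b)}
    (h : ∀ f ∈ A, f.comp t ≠ 0) (hB : ∀ f ∈ A, f.comp t ∈ B) {z : Form a} (hz : z ∈ Br A) :
    Pb t z ∈ Br B := by
  have : Br A ≤ (Br B).comap (Pb t) := by
    refine Br_le ?_ ?_
    · show Pb t _ ∈ Br B
      rw [Pb_one]; exact Br_one _
    · intro f hf z hzA hz
      show Pb t _ ∈ Br B
      rw [Pb_wl t (Om_reg h (Br_le_Om A hzA)) (h f hf)]
      exact Br_wl (hB f hf) hz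
  exact this hz

/-- Pullback of polynomials is polynomial. -/
lemma pbP_poly {a b : ℕ} (t : Fin a → Aff b) (f : PR a) : ∃ g : PR b, pbP t f = pk b g := by
  induction f using MvPolynomial.induction_on with
  | C c => exact ⟨MvPolynomial.C c, by
      rw [← MvPolynomial.algebraMap_eq, ← MvPolynomial.algebraMap_eq, AlgHom.commutes, AlgHom.commutes]⟩
  | add p q hp hq =>
    obtain ⟨g, hg⟩ := hp
    obtain ⟨g', hg'⟩ := hq
    exact ⟨g + g', by rw [map_add, map_add, hg, hg']⟩
  | mul_X p i hp =>
    obtain ⟨g, hg⟩ := hp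
    exact ⟨g * affP b (t i), by rw [map_mul, map_mul, hg]; simp [pbP, affK_def]⟩

lemma pb_pbP {a b c : ℕ} (t : Fin a → Aff b) (s : Fin b → Aff c) (f : PR a) :
    pb s (pbP t f) = pbP (fun i => (t i).comp s) f := by
  induction f using MvPolynomial.induction_on with
  | C c =>
      rw [← MvPolynomial.algebraMap_eq, AlgHom.commutes, AlgHom.commutes, pb_algebraMap]
  | add p q hp hq => simp only [map_add, hp, hq]
  | mul_X p i hp =>
    have h1 : ∀ f, pbP t f ∈ regSub s := fun f => by
      obtain ⟨g, hg⟩ := pbP_poly t f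
      rw [hg]; exact pk_reg s g
    rw [map_mul, pb_mul s (h1 _) (h1 _), map_mul, hp]
    congr 1
    simp [pbP, pb_affK]

lemma pbP_id {a : ℕ} (f : PR a) : pbP (fun i => coordA i) f = pk a f := by
  have : pbP (fun i : Fin a => coordA i) = pk a := by
    apply MvPolynomial.algHom_ext
    intro i; simp [pbP, affK_coordA]
  rw [this]

/-- Fibration data: a splitting `ℂ^(m+1) = ℂ^m × ℂ` adapted to a hyperplane `x = 0`. -/
structure FD (m : ℕ) where
  p : Fin m → Aff (m + 1)
  s : Fin (m + 1) → Aff m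
  x : Aff (m + 1)
  v : Fin (m + 1) → ℂ
  hps : ∀ i, (p i).comp s = coordA i
  hsp : ∀ i, coordA i = (s i).comp p + v i • x
  hxs : x.comp s = 0
  hxv : x.2 v = 1
  hpv : ∀ i, (p i).2 v = 0

namespace FD
variable {m : ℕ} (F : FD m)

lemma hps' (u) : evT F.p (evT F.s u) = u := by
  ext i
  have := congrArg (fun f => Aff.ev f u) (F.hps i)
  simp only [Aff.comp_ev] at this
  show (F.p i).ev (evT F.s u) = _
  rw [this]; simp [Aff.ev, coordA]

lemma hsp' (u) : u = evT F.s (evT F.p u) + F.x.ev u • F.v := by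
  ext i
  have := congrArg (fun f => Aff.ev f u) (F.hsp i)
  have e : ∀ f g : Aff (m+1), (f + g).ev u = f.ev u + g.ev u := by
    intro f g; simp [Aff.ev]; ring
  have e2 : ∀ (c : ℂ) (g : Aff (m+1)), (c • g).ev u = c * g.ev u := by
    intro f g; simp [Aff.ev]; ring
  simp only [e, e2, Aff.comp_ev] at this
  simp only [Pi.add_apply, Pi.smul_apply, smul_eq_mul]
  show _ = (F.s i).ev (evT F.p u) + _
  rw [mul_comm, ← this]; simp [Aff.ev, coordA]

lemma comp_p_s (f : Aff m) : (f.comp F.p).comp F.s = f := by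
  apply Aff.ev_inj; intro u
  rw [Aff.comp_ev, Aff.comp_ev, F.hps']

lemma decomp (f : Aff (m + 1)) : f = (f.comp F.s).comp F.p + f.2 F.v • F.x := by
  apply Aff.ev_inj; intro u
  have e : ∀ f g : Aff (m+1), (f + g).ev u = f.ev u + g.ev u := by
    intro f g; simp [Aff.ev]; ring
  have e2 : ∀ (c : ℂ) (g : Aff (m+1)), (c • g).ev u = c * g.ev u := by
    intro f g; simp [Aff.ev]; ring
  rw [e, e2, Aff.comp_ev, Aff.comp_ev]
  conv_lhs => rw [F.hsp' u]
  simp [Aff.ev]; ring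

lemma comp_p_v (f : Aff m) : (f.comp F.p).2 F.v = 0 := by
  show f.2 (linT F.p F.v) = 0
  have : linT F.p F.v = 0 := by ext i; simp [linT, F.hpv]
  rw [this, map_zero]

lemma comp_p_ne {f : Aff m} (hf : f ≠ 0) : f.comp F.p ≠ 0 := by
  intro h
  apply hf
  rw [← F.comp_p_s f, h]
  apply Aff.ev_inj; intro u; rw [Aff.comp_ev]; simp [Aff.ev]

lemma x_ne : F.x ≠ 0 := by
  intro h; have := F.hxv; rw [h] at this; simp at this

lemma pb_s_pbP (f : PR m) : pb F.s (pbP F.p f) = pk m f := by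
  rw [pb_pbP]
  have : (fun i => (F.p i).comp F.s) = fun i => coordA i := funext F.hps
  rw [this, pbP_id]

lemma pbP_p_ne {f : PR m} (hf : f ≠ 0) : pbP F.p f ≠ 0 := by
  intro h
  have := F.pb_s_pbP f
  rw [h, map_zero] at this
  exact pk_ne hf this.symm

lemma p_reg (x : KK m) : x ∈ regSub F.p := by
  obtain ⟨a, b, hb, rfl⟩ := exists_frac x
  exact ⟨a, b, F.pbP_p_ne hb, rfl⟩

lemma p_regF (z : Form m) : RegF F.p z := fun _ => F.p_reg _

lemma pbP_reg (f : PR m) : pbP F.p f ∈ regSub F.s := by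
  obtain ⟨g, hg⟩ := pbP_poly F.p f
  rw [hg]; exact pk_reg _ _

lemma pb_p_reg (x : KK m) : pb F.p x ∈ regSub F.s := by
  obtain ⟨a, b, hb, rfl⟩ := exists_frac x
  rw [pb_frac _ _ _ (F.pbP_p_ne hb), div_eq_mul_inv]
  exact mul_mem (F.pbP_reg _) (inv_reg _ (F.pbP_reg _) (by rw [F.pb_s_pbP]; exact pk_ne hb))

lemma pb_s_p (x : KK m) : pb F.s (pb F.p x) = x := by
  obtain ⟨a, b, hb, rfl⟩ := exists_frac x
  have h0 : pb F.s (pbP F.p b) ≠ 0 := by rw [F.pb_s_pbP]; exact pk_ne hb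
  rw [pb_frac _ _ _ (F.pbP_p_ne hb), div_eq_mul_inv, pb_mul _ (F.pbP_reg _) (inv_reg _ (F.pbP_reg _) h0),
    pb_inv _ (F.pbP_reg _) h0, F.pb_s_pbP, F.pb_s_pbP, div_eq_mul_inv]

lemma linT_ps : linT F.p ∘ₗ linT F.s = LinearMap.id := by
  refine LinearMap.ext fun u => ?_
  ext i
  have := congrArg (fun f : Aff m => f.2 u) (F.hps i)
  exact this

lemma linT_sp (u) : linT F.s (linT F.p u) = u - F.x.2 u • F.v := by
  ext i
  have := congrArg (fun f : Aff (m+1) => f.2 u) (F.hsp i)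
  have h2 : u i = linT F.s (linT F.p u) i + F.v i * F.x.2 u := this
  simp only [Pi.sub_apply, Pi.smul_apply, smul_eq_mul]
  rw [h2]; ring

lemma Pb_s_p (z : Form m) : Pb F.s (Pb F.p z) = z := by
  refine LinearMap.ext fun x => ?_
  rw [Pb_apply, Pb_apply, F.pb_s_p]
  congr 1
  have h : (ExteriorAlgebra.map (linT F.p)).comp (ExteriorAlgebra.map (linT F.s)) = AlgHom.id ℂ (XA m) := by
    rw [ExteriorAlgebra.map_comp_map, linT_ps, ExteriorAlgebra.map_id]
  exact DFunLike.congr_fun h x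

lemma Pb_p_reg (z : Form m) : RegF F.s (Pb F.p z) := fun _ => F.pb_p_reg _

lemma II_Pb_p (z : Form m) : II F.v (Pb F.p z) = 0 := by
  rw [← Pb_II]
  have : linT F.p F.v = 0 := by ext i; simp [linT, F.hpv]
  rw [this]
  refine LinearMap.ext fun x => ?_
  simp [Pb_apply]

lemma Pb_s_x (z : Form (m+1)) : Pb F.s (EE F.x.2 z) = 0 := by
  rw [Pb_EE]
  have : F.x.2 ∘ₗ linT F.s = 0 := congrArg Prod.snd F.hxs
  rw [this, EE_zero]

lemma Pb_s_xsmul {z : Form (m+1)} (hz : RegF F.s z) : Pb F.s (affK F.x • z) = 0 := by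
  rw [Pb_ksmul _ (affK_reg _ _) hz, pb_affK, F.hxs, map_zero, zero_smul]

lemma Pb_p_inj : Function.Injective (Pb F.p) := fun a b h => by
  rw [← F.Pb_s_p a, h, F.Pb_s_p]

/-- Key polynomial division. -/
lemma div_poly (f : PR (m+1)) : ∃ g : PR (m+1), pk _ f - pb F.p (pbP F.s f) = affK F.x * pk _ g := by
  induction f using MvPolynomial.induction_on with
  | C c =>
      refine ⟨0, ?_⟩
      rw [← MvPolynomial.algebraMap_eq, AlgHom.commutes, AlgHom.commutes, pb_algebraMap]; simp
  | add f g hf hg =>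
    obtain ⟨a, ha⟩ := hf
    obtain ⟨b, hb⟩ := hg
    refine ⟨a + b, ?_⟩
    simp only [map_add, mul_add, ← ha, ← hb]; ring
  | mul_X f i hf =>
    obtain ⟨a, ha⟩ := hf
    have h1 : pbP F.s (MvPolynomial.X i) = affK (F.s i) := by simp [pbP]
    have h2 : affK ((F.s i).comp F.p) = pk _ (MvPolynomial.X i) - algebraMap ℂ _ (F.v i) * affK F.x := by
      rw [← affK_coordA, eq_sub_iff_add_eq, ← Algebra.smul_def, ← map_smul, ← map_add, ← F.hsp]
    refine ⟨a * MvPolynomial.X i + (f - affP _ F.x * a) * MvPolynomial.C (F.v i), ?_⟩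
    have hC : ∀ c, pk (m+1) (MvPolynomial.C c) = algebraMap ℂ (KK (m+1)) c := by
      intro c; rw [← MvPolynomial.algebraMap_eq]; exact (pk _).commutes c
    rw [map_mul (pbP F.s), pb_mul _ (F.p_reg _) (F.p_reg _), h1, pb_affK, h2]
    simp only [map_mul, map_add, map_sub, hC, ← affK_def]
    have h3 : pb F.p (pbP F.s f) = pk _ f - affK F.x * pk _ a := by rw [← ha]; ring
    rw [h3]; ring

lemma dvd_poly {f : PR (m+1)} (h : pbP F.s f = 0) : ∃ g : PR (m+1), pk _ f = affK F.x * pk _ g := by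
  obtain ⟨g, hg⟩ := F.div_poly f
  rw [h, map_zero, sub_zero] at hg
  exact ⟨g, hg⟩

end FD

/-- Elements of `RA A` are fractions with denominators invertible in `RA A`. -/
lemma RA_frac {l : ℕ} {A : Set (Aff l)} {x : KK l} (hx : x ∈ RA A) :
    ∃ f g : PR l, pk l g ≠ 0 ∧ (pk l g)⁻¹ ∈ RA A ∧ x * pk l g = pk l f := by
  induction hx using RA_induction with
  | h1 f => exact ⟨affP l f, 1, by simp, by simpa using one_mem _, by simp [affK_def]⟩
  | h2 a ha =>
    by_cases h0 : affK a = 0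
    · exact ⟨0, 1, by simp, by simpa using one_mem _, by simp [h0]⟩
    · exact ⟨1, affP l a, h0, inv_mem ha, by rw [← affK_def, inv_mul_cancel₀ h0, map_one]⟩
  | hc c => exact ⟨MvPolynomial.C c, 1, by simp, by simpa using one_mem _, by
      rw [← MvPolynomial.algebraMap_eq, AlgHom.commutes]; simp⟩
  | hadd x y _ _ hx hy =>
    obtain ⟨f, g, h1, h2, h3⟩ := hx
    obtain ⟨f', g', h1', h2', h3'⟩ := hy
    refine ⟨f * g' + f' * g, g * g', ?_, ?_, ?_⟩
    · rw [map_mul]; exact mul_ne_zero h1 h1'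
    · rw [map_mul, mul_inv]; exact mul_mem h2 h2'
    · simp only [map_add, map_mul, ← h3, ← h3']; ring
  | hmul x y _ _ hx hy =>
    obtain ⟨f, g, h1, h2, h3⟩ := hx
    obtain ⟨f', g', h1', h2', h3'⟩ := hy
    refine ⟨f * f', g * g', ?_, ?_, ?_⟩
    · rw [map_mul]; exact mul_ne_zero h1 h1'
    · rw [map_mul, mul_inv]; exact mul_mem h2 h2'
    · simp only [map_mul, ← h3, ← h3']; ring

namespace FD
variable {m : ℕ} (F : FD m)

lemma ker_RA {A : Set (Aff (m+1))} (hA : ∀ f ∈ A, f.comp F.s ≠ 0) {x : KK (m+1)} (hx : x ∈ RA A)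
    (h : pb F.s x = 0) : ∃ y ∈ RA A, x = affK F.x * y := by
  obtain ⟨f, g, h1, h2, h3⟩ := RA_frac hx
  have h4 : pbP F.s f = 0 := by
    rw [← pb_pk, ← h3, pb_mul _ (RA_reg hA hx) (pk_reg _ _), h, zero_mul]
  obtain ⟨k, hk⟩ := F.dvd_poly h4
  refine ⟨pk _ k * (pk _ g)⁻¹, mul_mem (pk_mem _ _) h2, ?_⟩
  rw [← mul_assoc, ← hk, ← h3, mul_assoc, mul_inv_cancel₀ h1, mul_one]

lemma RA_insert_pow {A : Set (Aff (m+1))} {x : KK (m+1)} (hx : x ∈ RA (insert F.x A)) :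
    ∃ k : ℕ, affK F.x ^ k * x ∈ RA A := by
  induction hx using RA_induction with
  | h1 f => exact ⟨0, by simpa using affK_mem _ _⟩
  | h2 a ha =>
    rcases ha with rfl | ha
    · exact ⟨1, by rw [pow_one, mul_inv_cancel₀ (affK_ne F.x_ne)]; exact one_mem _⟩
    · exact ⟨0, by simpa using inv_mem ha⟩
  | hc c => exact ⟨0, by simpa using Subalgebra.algebraMap_mem _ _⟩
  | hadd x y _ _ hx hy =>
    obtain ⟨k, hk⟩ := hx
    obtain ⟨k', hk'⟩ := hy
    refine ⟨k + k', ?_⟩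
    have : affK F.x ^ (k + k') * (x + y) = affK F.x ^ k' * (affK F.x ^ k * x) +
      affK F.x ^ k * (affK F.x ^ k' * y) := by ring
    rw [this]
    exact add_mem (mul_mem (pow_mem (affK_mem _ _) _) hk) (mul_mem (pow_mem (affK_mem _ _) _) hk')
  | hmul x y _ _ hx hy =>
    obtain ⟨k, hk⟩ := hx
    obtain ⟨k', hk'⟩ := hy
    refine ⟨k + k', ?_⟩
    have : affK F.x ^ (k + k') * (x * y) = (affK F.x ^ k * x) * (affK F.x ^ k' * y) := by ring
    rw [this]
    exact mul_mem hk hk'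

/-- An element regular along `x = 0` has no pole there. -/
lemma RA_of_reg {A : Set (Aff (m+1))} (hA : ∀ f ∈ A, f.comp F.s ≠ 0) {x : KK (m+1)}
    (hx : x ∈ RA (insert F.x A)) (hr : x ∈ regSub F.s) : x ∈ RA A := by
  obtain ⟨k, hk⟩ := F.RA_insert_pow hx
  induction k with
  | zero => simpa using hk
  | succ k ih =>
    apply ih
    have h0 : pb F.s (affK F.x ^ (k+1) * x) = 0 := by
      rw [pow_succ', mul_assoc, pb_mul _ (affK_reg _ _) (mul_mem (pow_mem (affK_reg _ _) _) hr), pb_affK,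
        F.hxs, map_zero, zero_mul]
    obtain ⟨y, hy, e⟩ := F.ker_RA hA hk h0
    have : affK F.x ^ k * x = y := by
      apply mul_left_cancel₀ (affK_ne F.x_ne)
      rw [← e]; ring
    rwa [this]

lemma Om_of_reg {A : Set (Aff (m+1))} (hA : ∀ f ∈ A, f.comp F.s ≠ 0) {z : Form (m+1)}
    (hx : z ∈ Om (insert F.x A)) (hr : RegF F.s z) : z ∈ Om A := fun x => F.RA_of_reg hA (hx x) (hr x)

lemma map_sub_mem (x : XA (m+1)) : ∃ w : XA (m+1),
    ExteriorAlgebra.map (linT F.s ∘ₗ linT F.p) x - x = ExteriorAlgebra.ι ℂ F.v * w := by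
  induction x using CliffordAlgebra.left_induction with
  | algebraMap r => exact ⟨0, by rw [AlgHom.commutes]; simp⟩
  | add x y hx hy =>
    obtain ⟨w, hw⟩ := hx
    obtain ⟨w', hw'⟩ := hy
    exact ⟨w + w', by rw [map_add, mul_add, ← hw, ← hw']; abel⟩
  | ι_mul y u hy =>
    obtain ⟨w, hw⟩ := hy
    have e : ExteriorAlgebra.map (linT F.s ∘ₗ linT F.p) y = y + ExteriorAlgebra.ι ℂ F.v * w := by
      rw [← hw]; abel
    have e2 : (linT F.s ∘ₗ linT F.p) u = u - F.x.2 u • F.v := F.linT_sp u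
    refine ⟨-(ExteriorAlgebra.ι ℂ u * w) - F.x.2 u • (y + ExteriorAlgebra.ι ℂ F.v * w), ?_⟩
    have e3 : ExteriorAlgebra.map (linT F.s ∘ₗ linT F.p) (ExteriorAlgebra.ι ℂ u * y) =
      (ExteriorAlgebra.ι ℂ u - F.x.2 u • ExteriorAlgebra.ι ℂ F.v) * (y + ExteriorAlgebra.ι ℂ F.v * w) := by
      rw [map_mul, ExteriorAlgebra.map_apply_ι, e, e2, map_sub, map_smul]
    have e4 : ExteriorAlgebra.ι ℂ u * (ExteriorAlgebra.ι ℂ F.v * w) =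
      - (ExteriorAlgebra.ι ℂ F.v * (ExteriorAlgebra.ι ℂ u * w)) := by
      have := ExteriorAlgebra.ι_add_mul_swap (R := ℂ) u F.v
      rw [← mul_assoc, ← mul_assoc, ← neg_mul, eq_neg_of_add_eq_zero_left this]
    refine (congrArg (· - _) e3).trans ?_
    rw [sub_mul, mul_add, e4, mul_sub, mul_neg, smul_mul_assoc, mul_smul_comm]
    show _ - ExteriorAlgebra.ι ℂ u * y = _
    abel

/-- Forms vanishing on `x = 0`. -/
lemma ker_Om {A : Set (Aff (m+1))} (hA : ∀ f ∈ A, f.comp F.s ≠ 0) {z : Form (m+1)} (hz : z ∈ Om A)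
    (h : Pb F.s z = 0) : ∃ z1 ∈ Om A, ∃ z2 ∈ Om A, z = affK F.x • z1 + EE F.x.2 z2 := by
  set z0 := z - EE F.x.2 (II F.v z) with hz0
  have hII : II F.v z0 = 0 := by
    rw [hz0, map_sub, II_EE, F.hxv, one_smul]
    have : II F.v (II F.v z) = 0 := by
      refine LinearMap.ext fun x => ?_
      simp [← mul_assoc]
    rw [this]; simp
  have hO : z0 ∈ Om A := Submodule.sub_mem _ hz (Om_EE _ (Om_II _ hz))
  have hP : Pb F.s z0 = 0 := by rw [hz0, map_sub, h, F.Pb_s_x, sub_zero]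
  have key : ∀ x, pb F.s (z0 x) = 0 := by
    intro x
    obtain ⟨w, hw⟩ := F.map_sub_mem x
    have h1 : z0 x = z0 (ExteriorAlgebra.map (linT F.s ∘ₗ linT F.p) x) := by
      have h2 : z0 (ExteriorAlgebra.ι ℂ F.v * w) = 0 := by
        have := LinearMap.congr_fun hII w
        simpa using this
      rw [← hw, map_sub, sub_eq_zero] at h2
      exact h2.symm
    have h3 : ExteriorAlgebra.map (linT F.s ∘ₗ linT F.p) x =
      ExteriorAlgebra.map (linT F.s) (ExteriorAlgebra.map (linT F.p) x) := by
      rw [← ExteriorAlgebra.map_comp_map]; rfl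
    rw [h1, h3, ← Pb_apply, hP]; rfl
  refine ⟨(affK F.x)⁻¹ • z0, fun x => ?_, II F.v z, Om_II _ hz, ?_⟩
  · obtain ⟨y, hy, e⟩ := F.ker_RA hA (hO x) (key x)
    show (affK F.x)⁻¹ * z0 x ∈ _
    rw [e, inv_mul_cancel_left₀ (affK_ne F.x_ne)]; exact hy
  · rw [smul_inv_smul₀ (affK_ne F.x_ne), hz0]; abel

/-- The residue is well defined. -/
lemma res_zero {A B : Form (m+1)} (hA : RegF F.s A) (hB : RegF F.s B) (h : A + wl F.x B = 0) :
    Pb F.s B = 0 := by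
  have h1 : affK F.x • A + EE F.x.2 B = 0 := by
    have := congrArg (affK F.x • ·) h
    simpa [smul_add, wl_def, smul_inv_smul₀ (affK_ne F.x_ne)] using this
  have h2 : affK F.x • II F.v A + (B - EE F.x.2 (II F.v B)) = 0 := by
    have := congrArg (II F.v) h1
    rwa [map_add, II_ksmul, II_EE, F.hxv, one_smul, map_zero] at this
  have h3 := congrArg (Pb F.s) h2
  rwa [map_add, map_sub, F.Pb_s_x, F.Pb_s_xsmul (hA.II _), zero_add, sub_zero, map_zero] at h3

/-- pole filtration exhausts -/
lemma Om_insert_pow {A : Set (Aff (m+1))} {z : Form (m+1)} (hz : z ∈ Om (insert F.x A)) :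
    ∃ k : ℕ, affK F.x ^ k • z ∈ Om A := by
  let b := (Pi.basisFun ℂ (Fin (m+1))).ExteriorAlgebra
  choose k hk using fun i => F.RA_insert_pow (hz (b i))
  refine ⟨∑ i, k i, fun x => ?_⟩
  have hx : x ∈ Submodule.span ℂ (Set.range b) := by rw [b.span_eq]; trivial
  induction hx using Submodule.span_induction with
  | mem x hx =>
    obtain ⟨i, rfl⟩ := hx
    rw [← Finset.add_sum_erase _ _ (Finset.mem_univ i), LinearMap.smul_apply, smul_eq_mul, pow_add,
      mul_comm (affK F.x ^ k i), mul_assoc]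
    exact mul_mem (pow_mem (affK_mem _ _) _) (hk i)
  | zero => rw [map_zero]; exact zero_mem _
  | add x y _ _ hx hy => rw [map_add]; exact add_mem hx hy
  | smul c x _ hx => rw [map_smul]; exact Subalgebra.smul_mem _ hx c

end FD
end RV

end

noncomputable section
namespace RV

/-! ### vector valued forms -/

abbrev VF (κ : Type) (l : ℕ) := κ → Form l

/-- componentwise extension of a linear map -/
def cw {κ : Type} {a b : ℕ} (f : Form a →ₗ[ℂ] Form b) : VF κ a →ₗ[ℂ] VF κ b := f.compLeft κ

@[simp] lemma cw_apply {κ : Type} {a b : ℕ} (f : Form a →ₗ[ℂ] Form b) (z : VF κ a) (k : κ) :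
    cw f z k = f (z k) := rfl

/-- matrix action -/
def mm {κ : Type} [Fintype κ] {l : ℕ} (P : Matrix κ κ ℂ) : VF κ l →ₗ[ℂ] VF κ l where
  toFun z k := ∑ j, P k j • z j
  map_add' x y := by ext1 k; simp [smul_add, Finset.sum_add_distrib]
  map_smul' c x := by ext1 k; simp [Finset.smul_sum, smul_comm c]

section mm
variable {κ : Type} [Fintype κ] {l a b : ℕ}

lemma mm_apply (P : Matrix κ κ ℂ) (z : VF κ l) (k : κ) : mm P z k = ∑ j, P k j • z j := rfl

lemma mm_cw (P : Matrix κ κ ℂ) (f : Form a →ₗ[ℂ] Form b) (z : VF κ a) : mm P (cw f z) = cw f (mm P z) := by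
  ext1 k; simp [mm_apply]

lemma mm_mul (P Q : Matrix κ κ ℂ) (z : VF κ l) : mm (P * Q) z = mm P (mm Q z) := by
  ext1 k
  simp only [mm_apply, Matrix.mul_apply, Finset.sum_smul, Finset.smul_sum, mul_smul]
  rw [Finset.sum_comm]

@[simp] lemma mm_one (z : VF κ l) : mm (1 : Matrix κ κ ℂ) z = z := by
  ext1 k; simp [mm_apply, Matrix.one_apply]

@[simp] lemma mm_zero (z : VF κ l) : mm (0 : Matrix κ κ ℂ) z = 0 := by
  ext1 k; simp [mm_apply]

lemma mm_add (P Q : Matrix κ κ ℂ) (z : VF κ l) : mm (P + Q) z = mm P z + mm Q z := by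
  ext1 k; simp [mm_apply, add_smul, Finset.sum_add_distrib]

lemma mm_sub (P Q : Matrix κ κ ℂ) (z : VF κ l) : mm (P - Q) z = mm P z - mm Q z := by
  exact eq_sub_of_add_eq (by rw [← mm_add, sub_add_cancel])

lemma mm_smul (c : ℂ) (P : Matrix κ κ ℂ) (z : VF κ l) : mm (c • P) z = c • mm P z := by
  ext1 k; simp [mm_apply, Finset.smul_sum, mul_smul]

lemma mm_sum {ι : Type} (s : Finset ι) (P : ι → Matrix κ κ ℂ) (z : VF κ l) :
    mm (∑ i ∈ s, P i) z = ∑ i ∈ s, mm (P i) z := by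
  induction s using Finset.induction_on with
  | empty => simp
  | insert a s ha ih => rw [Finset.sum_insert ha, Finset.sum_insert ha, mm_add, ih]

lemma mm_ksmul (P : Matrix κ κ ℂ) (f : KK l) (z : VF κ l) : mm P (f • z) = f • mm P z := by
  ext1 k; simp [mm_apply, Finset.smul_sum, smul_comm f]

end mm

/-- vectors with components in a submodule -/
def pv {κ : Type} {l : ℕ} (M : Submodule ℂ (Form l)) : Submodule ℂ (VF κ l) :=
  Submodule.pi Set.univ (fun _ => M)

lemma mem_pv {κ : Type} {l : ℕ} {M : Submodule ℂ (Form l)} {z : VF κ l} : z ∈ pv M ↔ ∀ k, z k ∈ M := by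
  simp [pv, Submodule.mem_pi]

lemma pv_mono {κ : Type} {l : ℕ} {M N : Submodule ℂ (Form l)} (h : M ≤ N) :
    (pv M : Submodule ℂ (VF κ l)) ≤ pv N := fun z hz => by
  rw [mem_pv] at *; exact fun k => h (hz k)

lemma pv_mm {κ : Type} [Fintype κ] {l : ℕ} {M : Submodule ℂ (Form l)} (P : Matrix κ κ ℂ) {z : VF κ l}
    (hz : z ∈ pv M) : mm P z ∈ pv M := by
  rw [mem_pv] at *
  exact fun k => Submodule.sum_mem _ fun j _ => Submodule.smul_mem _ _ (hz j)

lemma pv_cw {κ : Type} {a b : ℕ} {M : Submodule ℂ (Form a)} {N : Submodule ℂ (Form b)}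
    {f : Form a →ₗ[ℂ] Form b} (h : ∀ z ∈ M, f z ∈ N) {z : VF κ a} (hz : z ∈ pv M) : cw f z ∈ pv N := by
  rw [mem_pv] at *
  exact fun k => h _ (hz k)

/-- connection form -/
def aa {ι κ : Type} [Fintype ι] [Fintype κ] {l : ℕ} (α : ι → Aff l) (P : ι → Matrix κ κ ℂ) :
    VF κ l →ₗ[ℂ] VF κ l := ∑ i, cw (wl (α i)) ∘ₗ mm (P i)

/-- the connection -/
def nab {ι κ : Type} [Fintype ι] [Fintype κ] {l : ℕ} (α : ι → Aff l) (P : ι → Matrix κ κ ℂ) :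
    VF κ l →ₗ[ℂ] VF κ l := cw dd + aa α P

def Flat {ι κ : Type} [Fintype ι] [Fintype κ] {l : ℕ} (α : ι → Aff l) (P : ι → Matrix κ κ ℂ) : Prop :=
  ∀ z : VF κ l, aa α P (aa α P z) = 0

section nab
variable {ι κ : Type} [Fintype ι] [Fintype κ] {l : ℕ} (α : ι → Aff l) (P : ι → Matrix κ κ ℂ)

lemma aa_apply (z : VF κ l) : aa α P z = ∑ i, cw (wl (α i)) (mm (P i) z) := by simp [aa]

lemma nab_apply (z : VF κ l) : nab α P z = cw dd z + aa α P z := rfl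

lemma aa_dd (z : VF κ l) : cw dd (aa α P z) = - aa α P (cw dd z) := by
  simp only [aa_apply, map_sum, ← Finset.sum_neg_distrib]
  refine Finset.sum_congr rfl fun i _ => ?_
  rw [mm_cw]; ext1 k; simp [dd_wl]

lemma cw_dd_dd (z : VF κ l) : cw dd (cw dd z) = 0 := by ext1 k; simp [dd_dd]

lemma nab_nab (h : Flat α P) (z : VF κ l) : nab α P (nab α P z) = 0 := by
  rw [nab_apply, nab_apply, map_add, map_add, cw_dd_dd, h, aa_dd]; simp

lemma aa_ksmul (f : KK l) (z : VF κ l) : aa α P (f • z) = f • aa α P z := by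
  simp only [aa_apply, Finset.smul_sum]
  refine Finset.sum_congr rfl fun i _ => ?_
  rw [mm_ksmul]; ext1 k; simp [wl_ksmul]

lemma aa_wl (a : Aff l) (z : VF κ l) : aa α P (cw (wl a) z) = - cw (wl a) (aa α P z) := by
  simp only [aa_apply, map_sum, ← Finset.sum_neg_distrib]
  refine Finset.sum_congr rfl fun i _ => ?_
  rw [mm_cw]; ext1 k; simp [wl_comm (α i)]

lemma aa_EE (θ) (z : VF κ l) : aa α P (cw (EE θ) z) = - cw (EE θ) (aa α P z) := by
  simp only [aa_apply, map_sum, ← Finset.sum_neg_distrib]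
  refine Finset.sum_congr rfl fun i _ => ?_
  rw [mm_cw]; ext1 k; simp [wl_EE (α i)]

lemma nab_wl (a : Aff l) (z : VF κ l) : nab α P (cw (wl a) z) = - cw (wl a) (nab α P z) := by
  rw [nab_apply, nab_apply, aa_wl, map_add, neg_add]
  congr 1
  ext1 k; simp [dd_wl]

lemma aa_mem {M : Submodule ℂ (Form l)} (h : ∀ i, ∀ z ∈ M, wl (α i) z ∈ M) {z : VF κ l}
    (hz : z ∈ pv M) : aa α P z ∈ pv M := by
  rw [aa_apply]
  exact Submodule.sum_mem _ fun i _ => pv_cw (h i) (pv_mm _ hz)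

lemma nab_mem {M : Submodule ℂ (Form l)} (hd : ∀ z ∈ M, dd z ∈ M) (h : ∀ i, ∀ z ∈ M, wl (α i) z ∈ M)
    {z : VF κ l} (hz : z ∈ pv M) : nab α P z ∈ pv M :=
  Submodule.add_mem _ (pv_cw hd hz) (aa_mem α P h hz)

lemma nab_Om {A : Set (Aff l)} (h : ∀ i, α i ∈ A) {z : VF κ l} (hz : z ∈ pv (Om A)) :
    nab α P z ∈ pv (Om A) := nab_mem α P (fun _ => Om_dd) (fun i _ => Om_wl (h i)) hz

lemma nab_Br {A : Set (Aff l)} (h : ∀ i, α i ∈ A) {z : VF κ l} (hz : z ∈ pv (Br A)) :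
    nab α P z ∈ pv (Br A) := nab_mem α P (fun z hz => by rw [dd_Br hz]; exact zero_mem _)
      (fun i _ => Br_wl (h i)) hz

lemma aa_Pb {b : ℕ} (t : Fin l → Aff b) (h : ∀ i, (α i).comp t ≠ 0) {z : VF κ l}
    (hz : ∀ k, RegF t (z k)) : cw (Pb t) (aa α P z) = aa (fun i => (α i).comp t) P (cw (Pb t) z) := by
  simp only [aa_apply, map_sum]
  refine Finset.sum_congr rfl fun i _ => ?_
  rw [mm_cw]; ext1 k
  simp only [cw_apply]
  refine Pb_wl t ?_ (h i)
  intro x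
  simp only [mm_apply, LinearMap.sum_apply, LinearMap.smul_apply]
  exact sum_mem fun j _ => Subalgebra.smul_mem _ (hz j x) _

lemma nab_Pb {b : ℕ} (t : Fin l → Aff b) (h : ∀ i, (α i).comp t ≠ 0) {z : VF κ l}
    (hz : ∀ k, RegF t (z k)) : cw (Pb t) (nab α P z) = nab (fun i => (α i).comp t) P (cw (Pb t) z) := by
  rw [nab_apply, map_add, aa_Pb α P t h hz, nab_apply]
  congr 1
  ext1 k
  exact (dd_Pb t (hz k)).symm
end nab

lemma dd_pow_inv {l : ℕ} {a : Aff l} (k : ℕ) (z : Form l) :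
    dd ((affK a ^ k)⁻¹ • z) = (affK a ^ k)⁻¹ • (dd z - (k : ℂ) • wl a z) := by
  induction k generalizing z with
  | zero => simp
  | succ k ih =>
    have e : ((k + 1 : ℕ) : ℂ) • wl a z = (k : ℂ) • wl a z + wl a z := by
      push_cast; rw [add_smul, one_smul]
    rw [pow_succ, mul_inv, mul_smul, ih, dd_inv_smul, wl_ksmul, mul_smul, e,
      smul_comm (k : ℂ) (affK a)⁻¹, ← wl_def a z]
    congr 1
    simp only [smul_sub, smul_add]
    abel

namespace FD
variable {m : ℕ} (F : FD m)

/-- forms with pole order at most `k` (plus a logarithmic term) along `x = 0` -/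
def YY (A : Set (Aff (m+1))) (k : ℕ) : Submodule ℂ (Form (m+1)) where
  carrier := {z | ∃ β ∈ Om A, ∃ γ ∈ Om A, z = (affK F.x ^ k)⁻¹ • (β + wl F.x γ)}
  add_mem' := by
    rintro _ _ ⟨β, hβ, γ, hγ, rfl⟩ ⟨β', hβ', γ', hγ', rfl⟩
    exact ⟨_, add_mem hβ hβ', _, add_mem hγ hγ', by rw [map_add, ← smul_add]; congr 1; abel⟩
  zero_mem' := ⟨0, zero_mem _, 0, zero_mem _, by simp⟩
  smul_mem' := by
    rintro c _ ⟨β, hβ, γ, hγ, rfl⟩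
    exact ⟨_, Submodule.smul_mem _ c hβ, _, Submodule.smul_mem _ c hγ, by
      rw [map_smul, ← smul_add, smul_comm]⟩

variable {F} {A : Set (Aff (m+1))}

lemma mem_YY {k : ℕ} {z : Form (m+1)} :
  z ∈ F.YY A k ↔ ∃ β ∈ Om A, ∃ γ ∈ Om A, z = (affK F.x ^ k)⁻¹ • (β + wl F.x γ) := Iff.rfl

lemma mem_YY0 {z : Form (m+1)} :
  z ∈ F.YY A 0 ↔ ∃ β ∈ Om A, ∃ γ ∈ Om A, z = β + wl F.x γ := by simp [mem_YY]

lemma YY_succ_le (k : ℕ) : F.YY A k ≤ F.YY A (k+1) := by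
  rintro _ ⟨β, hβ, γ, hγ, rfl⟩
  refine ⟨affK F.x • β, Om_ksmul (affK_mem _ _) hβ, affK F.x • γ, Om_ksmul (affK_mem _ _) hγ, ?_⟩
  rw [wl_ksmul, ← smul_add, smul_smul, pow_succ, mul_inv, mul_assoc, inv_mul_cancel₀ (affK_ne F.x_ne),
    mul_one]

lemma YY_mono {k k' : ℕ} (h : k ≤ k') : F.YY A k ≤ F.YY A k' :=
  monotone_nat_of_le_succ (f := fun k => F.YY A k) YY_succ_le h

lemma Om_le_YY0 : Om A ≤ F.YY A 0 := fun z hz => mem_YY0.2 ⟨z, hz, 0, zero_mem _, by simp⟩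

lemma wl_YY0 {a : Aff (m+1)} (ha : a ∈ A) {z : Form (m+1)} (hz : z ∈ F.YY A 0) : wl a z ∈ F.YY A 0 := by
  rw [mem_YY0] at *
  obtain ⟨β, hβ, γ, hγ, rfl⟩ := hz
  exact ⟨_, Om_wl ha hβ, _, neg_mem (Om_wl ha hγ), by rw [map_add, wl_comm a, map_neg]⟩

lemma wlx_YY0 {z : Form (m+1)} (hz : z ∈ F.YY A 0) : wl F.x z ∈ F.YY A 0 := by
  rw [mem_YY0] at *
  obtain ⟨β, hβ, γ, hγ, rfl⟩ := hz
  exact ⟨0, zero_mem _, _, hβ, by rw [map_add]; simp⟩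

lemma dd_YY0 {z : Form (m+1)} (hz : z ∈ F.YY A 0) : dd z ∈ F.YY A 0 := by
  rw [mem_YY0] at *
  obtain ⟨β, hβ, γ, hγ, rfl⟩ := hz
  exact ⟨_, Om_dd hβ, _, neg_mem (Om_dd hγ), by rw [map_add, dd_wl, map_neg]⟩

lemma Br_le_YY0 : Br (insert F.x A) ≤ F.YY A 0 := by
  refine Br_le (Om_le_YY0 (Om_one _)) ?_
  rintro a (rfl | ha) z _ hz
  · exact wlx_YY0 hz
  · exact wl_YY0 ha hz

lemma YY_exhaust {z : Form (m+1)} (hz : z ∈ Om (insert F.x A)) : ∃ k, z ∈ F.YY A k := by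
  obtain ⟨k, hk⟩ := F.Om_insert_pow hz
  exact ⟨k, _, hk, 0, zero_mem _, by
    rw [map_zero, add_zero, inv_smul_smul₀ (pow_ne_zero _ (affK_ne F.x_ne))]⟩

lemma YY_le_Om (k : ℕ) : F.YY A k ≤ Om (insert F.x A) := by
  rintro _ ⟨β, hβ, γ, hγ, rfl⟩
  refine Om_ksmul ?_ (add_mem (Om_mono (Set.subset_insert _ _) hβ)
    (Om_wl (Set.mem_insert _ _) (Om_mono (Set.subset_insert _ _) hγ)))
  rw [← inv_pow]
  exact pow_mem (inv_mem (Set.mem_insert _ _)) _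

lemma YY_drop (hA : ∀ f ∈ A, f.comp F.s ≠ 0) {k : ℕ} {β γ : Form (m+1)} (hβ : β ∈ Om A) (hγ : γ ∈ Om A) :
    (affK F.x ^ (k+1))⁻¹ • (β + wl F.x γ) ∈ F.YY A k ↔ Pb F.s β = 0 ∧ Pb F.s γ = 0 := by
  have hx0 := affK_ne F.x_ne
  have e0 : ∀ z : Form (m+1), wl F.x (affK F.x • z) = EE F.x.2 z := fun z => by
    rw [wl_def, EE_ksmul, inv_smul_smul₀ hx0]
  have e1 : ∀ z : Form (m+1), wl F.x (EE F.x.2 z) = 0 := fun z => by rw [wl_def, EE_EE_self, smul_zero]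
  have e2 : ∀ z : Form (m+1), affK F.x • wl F.x z = EE F.x.2 z := fun z => by
    rw [wl_def, smul_inv_smul₀ hx0]
  constructor
  · rintro ⟨A1, hA1, B1, hB1, h⟩
    have h1 : β + wl F.x γ = affK F.x • A1 + EE F.x.2 B1 := by
      have := congrArg (affK F.x ^ (k+1) • ·) h
      beta_reduce at this
      rw [smul_inv_smul₀ (pow_ne_zero _ hx0), pow_succ', mul_smul, smul_inv_smul₀ (pow_ne_zero _ hx0),
        smul_add, e2] at this
      exact this
    have hO : β - affK F.x • A1 - EE F.x.2 B1 ∈ Om A :=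
      sub_mem (sub_mem hβ (Om_ksmul (affK_mem _ _) hA1)) (Om_EE _ hB1)
    have hB : Pb F.s γ = 0 := by
      refine F.res_zero (Om_reg hA hO) (Om_reg hA hγ) ?_
      rw [← sub_eq_zero] at h1
      rw [← h1]; abel
    refine ⟨?_, hB⟩
    obtain ⟨C1, hC1, C2, hC2, rfl⟩ := F.ker_Om hA hγ hB
    rw [map_add, e0, e1, add_zero] at h1
    rw [eq_sub_of_add_eq h1, map_sub, map_add, F.Pb_s_x, F.Pb_s_x, F.Pb_s_xsmul (Om_reg hA hA1)]
    simp
  · rintro ⟨h1, h2⟩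
    obtain ⟨C1, hC1, C2, hC2, rfl⟩ := F.ker_Om hA hγ h2
    obtain ⟨D1, hD1, D2, hD2, rfl⟩ := F.ker_Om hA hβ h1
    refine ⟨D1, hD1, D2 + C1, add_mem hD2 hC1, ?_⟩
    rw [map_add, e0, e1, add_zero, pow_succ, mul_inv, mul_smul]
    congr 1
    rw [smul_add, smul_add, inv_smul_smul₀ hx0, map_add, add_assoc, ← smul_add, wl_def, wl_def, ← smul_add]

lemma lift_RA {B : Set (Aff m)} (hB : ∀ b ∈ B, ∃ a ∈ A, a.comp F.s = b ∧ b ≠ 0)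
    (hA : ∀ f ∈ A, f.comp F.s ≠ 0) {y : KK m} (hy : y ∈ RA B) : ∃ x ∈ RA A, pb F.s x = y := by
  induction hy using RA_induction with
  | h1 f => exact ⟨affK (f.comp F.p), affK_mem _ _, by rw [pb_affK, F.comp_p_s]⟩
  | h2 b hb =>
    obtain ⟨a, ha, rfl, h0⟩ := hB b hb
    exact ⟨(affK a)⁻¹, inv_mem ha, by
      rw [pb_inv _ (affK_reg _ _) (by rw [pb_affK]; exact affK_ne h0), pb_affK]⟩
  | hc c => exact ⟨algebraMap ℂ _ c, Subalgebra.algebraMap_mem _ _, pb_algebraMap _ _⟩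
  | hadd x y _ _ hx hy =>
    obtain ⟨x', hx', rfl⟩ := hx
    obtain ⟨y', hy', rfl⟩ := hy
    exact ⟨_, add_mem hx' hy', map_add _ _ _⟩
  | hmul x y _ _ hx hy =>
    obtain ⟨x', hx', rfl⟩ := hx
    obtain ⟨y', hy', rfl⟩ := hy
    exact ⟨_, mul_mem hx' hy', pb_mul _ (RA_reg hA hx') (RA_reg hA hy')⟩

lemma lift_Om {B : Set (Aff m)} (hB : ∀ b ∈ B, ∃ a ∈ A, a.comp F.s = b ∧ b ≠ 0)
    (hA : ∀ f ∈ A, f.comp F.s ≠ 0) {y : Form m} (hy : y ∈ Om B) : ∃ x ∈ Om A, Pb F.s x = y := by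
  let M : Submodule ℂ (KK (m+1)) := Subalgebra.toSubmodule (RA A)
  let N : Submodule ℂ (KK m) := M.map (pb F.s)
  let f : M →ₗ[ℂ] N := (pb F.s).restrict (fun x hx => ⟨x, hx, rfl⟩)
  have hf : Function.Surjective f := by
    rintro ⟨_, x, hx, rfl⟩
    exact ⟨⟨x, hx⟩, rfl⟩
  obtain ⟨g, hg⟩ := LinearMap.exists_rightInverse_of_surjective f (LinearMap.range_eq_top.2 hf)
  let y' : XA m →ₗ[ℂ] N := y.codRestrict N (fun x => by
    obtain ⟨w, hw, e⟩ := lift_RA hB hA (hy x)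
    exact ⟨w, hw, e⟩)
  refine ⟨M.subtype ∘ₗ g ∘ₗ y' ∘ₗ (ExteriorAlgebra.map (linT F.p)).toLinearMap, fun x => (g _).2, ?_⟩
  refine LinearMap.ext fun x => ?_
  rw [Pb_apply]
  have h : (ExteriorAlgebra.map (linT F.p)).comp (ExteriorAlgebra.map (linT F.s)) = AlgHom.id ℂ (XA m) := by
    rw [ExteriorAlgebra.map_comp_map, linT_ps, ExteriorAlgebra.map_id]
  have h2 := DFunLike.congr_fun h x
  show pb F.s (g (y' (ExteriorAlgebra.map (linT F.p) (ExteriorAlgebra.map (linT F.s) x)))) = _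
  have h3 : ExteriorAlgebra.map (linT F.p) (ExteriorAlgebra.map (linT F.s) x) = x := h2
  rw [h3]
  have h4 := LinearMap.congr_fun hg (y' x)
  exact congrArg Subtype.val h4

lemma lift_Br {B : Set (Aff m)} (hB : ∀ b ∈ B, ∃ a ∈ A, a.comp F.s = b ∧ b ≠ 0)
    (hA : ∀ f ∈ A, f.comp F.s ≠ 0) {y : Form m} (hy : y ∈ Br B) : ∃ x ∈ Br A, Pb F.s x = y := by
  have : Br B ≤ (Br A).map (Pb F.s) := by
    refine Br_le ⟨_, Br_one _, Pb_one _⟩ ?_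
    rintro b hb _ _ ⟨x, hx, rfl⟩
    obtain ⟨a, ha, rfl, h0⟩ := hB b hb
    exact ⟨wl a x, Br_wl ha hx, Pb_wl _ (Om_reg hA (Br_le_Om _ hx)) h0⟩
  exact this hy

/-- Logarithmic reduction along `x = 0`. -/
lemma LR {ι κ : Type} [Fintype ι] [Fintype κ] (hA : ∀ f ∈ A, f.comp F.s ≠ 0)
    {α : ι → Aff (m+1)} {P : ι → Matrix κ κ ℂ} (hα : ∀ i, α i ∈ A) (PH : Matrix κ κ ℂ)
    (N : VF κ (m+1) →ₗ[ℂ] VF κ (m+1)) (hN : ∀ z, N z = nab α P z + cw (wl F.x) (mm PH z))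
    (hNN : ∀ z, N (N z) = 0) (hinv : ∀ k : ℕ, 1 ≤ k → IsUnit (PH - (k : ℂ) • (1 : Matrix κ κ ℂ)))
    (D E : Submodule ℂ (VF κ (m+1))) (hDO : D ≤ pv (Om A))
    (hD : ∀ g ∈ pv (Om A), ∃ δ ∈ D, ∀ k, Pb F.s (δ k) = Pb F.s (g k))
    (hE : ∀ k : ℕ, ∀ δ ∈ D, (affK F.x ^ k)⁻¹ • δ ∈ E)
    {y : VF κ (m+1)} (hy : y ∈ pv (Om (insert F.x A))) (hNy : N y ∈ pv (F.YY A 0)) :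
    ∃ y' ∈ E, y - N y' ∈ pv (F.YY A 0) := by
  have main : ∀ k : ℕ, ∀ y : VF κ (m+1), y ∈ pv (F.YY A k) → N y ∈ pv (F.YY A 0) →
      ∃ y' ∈ E, y - N y' ∈ pv (F.YY A 0) := by
    intro k
    induction k with
    | zero => intro y hy _; exact ⟨0, zero_mem _, by simpa using hy⟩
    | succ k ih =>
      intro y hy hNy
      rw [mem_pv] at hy
      choose β hβ γ hγ e using hy
      have form : ∀ β γ : VF κ (m+1), N ((affK F.x ^ (k+1))⁻¹ • (β + cw (wl F.x) γ)) =
          (affK F.x ^ (k+1))⁻¹ • (nab α P β + cw (wl F.x) (mm (PH - ((k+1 : ℕ) : ℂ) • 1) β - nab α P γ)) := by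
        intro β γ
        have h1 : ∀ z : VF κ (m+1), N ((affK F.x ^ (k+1))⁻¹ • z) =
          (affK F.x ^ (k+1))⁻¹ • (N z - ((k+1 : ℕ) : ℂ) • cw (wl F.x) z) := by
          intro z
          rw [hN, hN, nab_apply, nab_apply, aa_ksmul, mm_ksmul]
          ext1 i
          simp only [Pi.add_apply, cw_apply, Pi.smul_apply, Pi.sub_apply, dd_pow_inv, wl_ksmul, smul_add, smul_sub]
          abel
        rw [h1, hN, map_add, map_add, map_add, map_add, nab_wl, mm_sub, mm_smul, mm_one, mm_cw]
        congr 1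
        ext1 i
        simp only [Pi.add_apply, cw_apply, Pi.smul_apply, Pi.sub_apply, Pi.neg_apply, wl_wl_self, map_sub,
          map_smul, add_zero]
        abel
      obtain ⟨Q, hQ⟩ := hinv (k+1) (by omega)
      have hQ1 : ∀ z : VF κ (m+1), mm (PH - ((k+1 : ℕ) : ℂ) • 1) (mm (↑Q⁻¹ : Matrix κ κ ℂ) z) = z := by
        intro z; rw [← mm_mul, ← hQ, Units.mul_inv, mm_one]
      have hQ2 : ∀ z : VF κ m, mm (↑Q⁻¹ : Matrix κ κ ℂ) (mm (PH - ((k+1 : ℕ) : ℂ) • 1) z) = z := by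
        intro z; rw [← mm_mul, ← hQ, Units.inv_mul, mm_one]
      obtain ⟨δ, hδ, hδs⟩ := hD (mm (↑Q⁻¹ : Matrix κ κ ℂ) γ) (pv_mm _ (mem_pv.2 hγ))
      have hδs' : cw (Pb F.s) δ = cw (Pb F.s) (mm (↑Q⁻¹ : Matrix κ κ ℂ) γ) := funext hδs
      set y1 := y - N ((affK F.x ^ (k+1))⁻¹ • δ) with hy1
      set β1 := β - nab α P δ with hβ1
      set γ1 := γ - mm (PH - ((k+1 : ℕ) : ℂ) • 1) δ with hγ1
      have e1 : y1 = (affK F.x ^ (k+1))⁻¹ • (β1 + cw (wl F.x) γ1) := by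
        have h2 := form δ 0
        rw [map_zero, add_zero, map_zero, sub_zero] at h2
        have h3 : y = (affK F.x ^ (k+1))⁻¹ • (β + cw (wl F.x) γ) := funext e
        rw [hy1, h2, h3, hβ1, hγ1, map_sub]
        ext1 i
        simp only [Pi.add_apply, cw_apply, Pi.smul_apply, Pi.sub_apply, smul_add, smul_sub]
        abel
      have hβ1O : β1 ∈ pv (Om A) := sub_mem (mem_pv.2 hβ) (nab_Om α P hα (hDO hδ))
      have hγ1O : γ1 ∈ pv (Om A) := sub_mem (mem_pv.2 hγ) (pv_mm _ (hDO hδ))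
      have hγs : cw (Pb F.s) γ1 = 0 := by
        rw [hγ1, map_sub, ← mm_cw, hδs', mm_cw, hQ1, sub_self]
      have hNy1 : N y1 = N y := by rw [hy1, map_sub, hNN, sub_zero]
      have hγ1s : cw (Pb F.s) (nab α P γ1) = 0 := by
        rw [nab_Pb α P F.s (fun i => hA _ (hα i)) (fun k => Om_reg hA (mem_pv.1 hγ1O k)), hγs, map_zero]
      have hβs : cw (Pb F.s) β1 = 0 := by
        have h5 : cw (Pb F.s) (mm (PH - ((k+1 : ℕ) : ℂ) • 1) β1 - nab α P γ1) = 0 := by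
          ext1 i
          have h6 := pv_mono (YY_mono (F := F) (A := A) (Nat.zero_le k)) hNy
          rw [← hNy1, e1, form, mem_pv] at h6
          exact ((YY_drop hA (mem_pv.1 (nab_Om α P hα hβ1O) i) (mem_pv.1 (sub_mem (pv_mm _ hβ1O)
            (nab_Om α P hα hγ1O)) i)).1 (h6 i)).2
        rw [map_sub, hγ1s, sub_zero, ← mm_cw] at h5
        have := hQ2 (cw (Pb F.s) β1)
        rw [h5, map_zero] at this
        exact this.symm
      have hy1Y : y1 ∈ pv (F.YY A k) := by
        rw [mem_pv]; intro i
        rw [e1]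
        exact (YY_drop hA (mem_pv.1 hβ1O i) (mem_pv.1 hγ1O i)).2 ⟨congrFun hβs i, congrFun hγs i⟩
      obtain ⟨y', hy', hh⟩ := ih y1 hy1Y (by rw [hNy1]; exact hNy)
      refine ⟨(affK F.x ^ (k+1))⁻¹ • δ + y', add_mem (hE _ _ hδ) hy', ?_⟩
      rw [map_add, ← sub_sub]
      exact hh
  have hex : ∃ k, y ∈ pv (F.YY A k) := by
    choose k hk using fun i => YY_exhaust (mem_pv.1 hy i)
    exact ⟨∑ i, k i, mem_pv.2 fun i => YY_mono (Finset.single_le_sum (f := k) (fun _ _ => Nat.zero_le _)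
      (Finset.mem_univ i)) (hk i)⟩
  obtain ⟨k, hk⟩ := hex
  exact main k y hk hNy

end FD
end RV

end

noncomputable section
namespace RV

lemma ev_add {l : ℕ} (f g : Aff l) (u) : (f + g).ev u = f.ev u + g.ev u := by simp [Aff.ev]; ring
lemma ev_sub {l : ℕ} (f g : Aff l) (u) : (f - g).ev u = f.ev u - g.ev u := by simp [Aff.ev]; ring
lemma ev_smul {l : ℕ} (c : ℂ) (g : Aff l) (u) : (c • g).ev u = c * g.ev u := by simp [Aff.ev]; ring
@[simp] lemma ev_zero {l : ℕ} (u) : (0 : Aff l).ev u = 0 := by simp [Aff.ev]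
@[simp] lemma ev_coordA {l : ℕ} (i : Fin l) (u) : (coordA i).ev u = u i := by simp [Aff.ev, coordA]
lemma ev_addv {l : ℕ} (f : Aff l) (u v) : f.ev (u + v) = f.ev u + f.2 v := by simp [Aff.ev]; ring

/-- base fibration data in direction `v` -/
lemma FD.exists_base {m : ℕ} (v : Fin (m+1) → ℂ) (hv : v ≠ 0) : ∃ F : FD m, F.v = v := by
  obtain ⟨j0, hj0⟩ : ∃ j, v j ≠ 0 := by
    by_contra! h
    exact hv (funext h)
  refine ⟨{ p := fun k => coordA (j0.succAbove k) - (v (j0.succAbove k) / v j0) • coordA j0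
            s := Fin.insertNth (α := fun _ => Aff m) j0 0 (fun k => coordA k)
            x := (v j0)⁻¹ • coordA j0
            v := v, hps := ?_, hsp := ?_, hxs := ?_, hxv := ?_, hpv := ?_ }, rfl⟩
  · intro i
    apply Aff.ev_inj; intro u
    rw [Aff.comp_ev, ev_sub, ev_smul]
    simp [evT]
  · intro i
    apply Aff.ev_inj; intro u
    rw [ev_add, ev_smul, ev_smul, Aff.comp_ev]
    rcases Fin.eq_self_or_eq_succAbove j0 i with rfl | ⟨k, rfl⟩
    · simp [hj0]
    · simp only [Fin.insertNth_apply_succAbove, ev_coordA, evT, ev_sub, ev_smul]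
      ring
  · apply Aff.ev_inj; intro u
    rw [Aff.comp_ev, ev_smul]
    simp [evT]
  · simp [coordA, hj0]
  · intro k
    simp [coordA, hj0]

/-- replacing the section -/
lemma FD.change {m : ℕ} (F : FD m) (α : Aff (m+1)) (h : α.2 F.v = 1) :
    ∃ G : FD m, G.p = F.p ∧ G.v = F.v ∧ G.x = α := by
  have hev : ∀ u, evT (fun i => F.s i - F.v i • α.comp F.s) u = evT F.s u + (-(α.ev (evT F.s u))) • F.v := by
    intro u; ext i
    simp [evT, ev_sub, ev_smul, Aff.comp_ev]; ring
  have e1 : ∀ u, evT F.p (u) = fun i => (F.p i).ev u := fun u => rfl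
  refine ⟨{ p := F.p, s := fun i => F.s i - F.v i • α.comp F.s, x := α, v := F.v, hps := ?_, hsp := ?_,
            hxs := ?_, hxv := h, hpv := F.hpv }, rfl, rfl, rfl⟩
  · intro i
    apply Aff.ev_inj; intro u
    rw [Aff.comp_ev, hev, ev_addv, map_smul, F.hpv, smul_zero, add_zero, ← Aff.comp_ev, F.hps]
  · intro i
    apply Aff.ev_inj; intro u
    rw [ev_add, ev_smul, Aff.comp_ev, ev_coordA, ev_sub, ev_smul, Aff.comp_ev]
    have h1 := F.hsp' u
    have h2 : α.ev u = α.ev (evT F.s (evT F.p u)) + F.x.ev u := by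
      conv_lhs => rw [h1, ev_addv, map_smul, h]
      simp
    have h3 := congrFun h1 i
    rw [h2]
    simp only [Pi.add_apply, Pi.smul_apply, smul_eq_mul] at h3
    have h4 : evT F.s (evT F.p u) i = (F.s i).ev (evT F.p u) := rfl
    rw [h4] at h3
    rw [h3]; ring
  · apply Aff.ev_inj; intro u
    rw [Aff.comp_ev, hev, ev_addv, map_smul, h]
    simp

lemma FD.exists_of_x {m : ℕ} (α : Aff (m+1)) (h : α.2 ≠ 0) : ∃ F : FD m, F.x = α := by
  obtain ⟨v, hv⟩ : ∃ v, α.2 v ≠ 0 := by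
    by_contra! h'
    exact h (LinearMap.ext h')
  obtain ⟨F, hF⟩ := FD.exists_base ((α.2 v)⁻¹ • v) (by
    intro h0
    apply hv
    rw [smul_eq_zero] at h0
    rcases h0 with h0 | h0
    · exact absurd (inv_eq_zero.1 h0) hv
    · rw [h0, map_zero])
  obtain ⟨G, -, -, hG⟩ := F.change α (by rw [hF, map_smul, smul_eq_mul, inv_mul_cancel₀ hv])
  exact ⟨G, hG⟩

/-! ### Exterior algebra side -/

/-- generator -/
def eg {n : ℕ} (j : Fin n) : XA n := ExteriorAlgebra.ι ℂ (Pi.single j 1)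

lemma eg_sq {n : ℕ} (j : Fin n) : eg j * eg j = 0 := ExteriorAlgebra.ι_sq_zero _
lemma eg_comm {n : ℕ} (i j : Fin n) : eg i * eg j = - (eg j * eg i) :=
  eq_neg_of_add_eq_zero_left (ExteriorAlgebra.ι_add_mul_swap _ _)

/-- boundary -/
def bd {n : ℕ} : XA n →ₗ[ℂ] XA n := ctr (∑ j, dx j)

lemma bd_eg {n : ℕ} (j : Fin n) (x : XA n) : bd (eg j * x) = x - eg j * bd x := by
  have := CliffordAlgebra.contractLeft_ι_mul (Q := (0 : QuadraticForm ℂ (Fin n → ℂ))) (∑ j, dx j)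
    (Pi.single j 1) x
  refine this.trans ?_
  have h : (∑ j : Fin n, dx j) (Pi.single j (1:ℂ)) = 1 := by
    simp [LinearMap.sum_apply, Pi.single_apply]
  rw [h, one_smul]; rfl

lemma bd_one {n : ℕ} : bd (1 : XA n) = 0 :=
  CliffordAlgebra.contractLeft_one (Q := (0 : QuadraticForm ℂ (Fin n → ℂ))) (d := ∑ j, dx j)

/-- monomial -/
def em {n : ℕ} (L : List (Fin n)) : XA n := (L.map eg).prod

@[simp] lemma em_nil {n : ℕ} : em ([] : List (Fin n)) = 1 := rfl
@[simp] lemma em_cons {n : ℕ} (j : Fin n) (L) : em (j :: L) = eg j * em L := rfl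

lemma em_swap {n : ℕ} (L : List (Fin n)) (j : Fin n) : eg j * em L = (-1 : ℂ)^L.length • (em L * eg j) := by
  induction L with
  | nil => simp
  | cons i L ih =>
    rw [em_cons, ← mul_assoc, eg_comm, neg_mul, mul_assoc, ih, List.length_cons, pow_succ]
    simp [mul_assoc]

/-- span of the monomials in the index set `T` -/
def FT {n : ℕ} (T : Finset (Fin n)) : Submodule ℂ (XA n) :=
  Submodule.span ℂ {x | ∃ L : List (Fin n), (∀ j ∈ L, j ∈ T) ∧ x = em L}

lemma em_FT {n : ℕ} {T : Finset (Fin n)} {L : List (Fin n)} (h : ∀ j ∈ L, j ∈ T) : em L ∈ FT T :=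
  Submodule.subset_span ⟨L, h, rfl⟩

lemma FT_le {n : ℕ} {T : Finset (Fin n)} {N : Submodule ℂ (XA n)}
    (h : ∀ L : List (Fin n), (∀ j ∈ L, j ∈ T) → em L ∈ N) : FT T ≤ N := by
  rw [FT, Submodule.span_le]
  rintro _ ⟨L, hL, rfl⟩
  exact h L hL

lemma FT_mono {n : ℕ} {T T' : Finset (Fin n)} (h : T ⊆ T') : FT T ≤ FT T' :=
  FT_le fun _ hL => em_FT fun j hj => h (hL j hj)

lemma eg_FT {n : ℕ} {T : Finset (Fin n)} {j : Fin n} (hj : j ∈ T) {x : XA n} (hx : x ∈ FT T) :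
    eg j * x ∈ FT T := by
  have : FT T ≤ (FT T).comap (LinearMap.mulLeft ℂ (eg j)) :=
    FT_le fun L hL => em_FT (L := j :: L) (by simpa using ⟨hj, hL⟩)
  exact this hx

lemma FT_univ {n : ℕ} (x : XA n) : x ∈ FT (Finset.univ : Finset (Fin n)) := by
  induction x using CliffordAlgebra.left_induction with
  | algebraMap r =>
    rw [Algebra.algebraMap_eq_smul_one]
    exact Submodule.smul_mem _ _ (em_FT (L := []) (by simp))
  | add x y hx hy => exact add_mem hx hy
  | ι_mul y u hy =>
    have hu : (CliffordAlgebra.ι (0 : QuadraticForm ℂ (Fin n → ℂ)) u : XA n) = ∑ j, u j • eg j := by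
      have : u = ∑ j, u j • (Pi.single j (1:ℂ) : Fin n → ℂ) := by
        ext i; simp [Pi.single_apply]
      conv_lhs => rw [this]
      rw [map_sum]
      simp only [map_smul]; rfl
    rw [hu, Finset.sum_mul]
    refine Submodule.sum_mem _ fun j _ => ?_
    rw [smul_mul_assoc]
    exact Submodule.smul_mem _ _ (eg_FT (Finset.mem_univ _) hy)

/-- decomposition along a new generator -/
lemma FT_insert {n : ℕ} {t : Fin n} {T : Finset (Fin n)} {x : XA n} (hx : x ∈ FT (insert t T)) :
    ∃ x' ∈ FT T, ∃ x'' ∈ FT T, x = x' + eg t * x'' := by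
  have : FT (insert t T) ≤ FT T ⊔ (FT T).map (LinearMap.mulLeft ℂ (eg t)) := by
    refine FT_le fun L hL => ?_
    induction L with
    | nil => exact Submodule.mem_sup_left (em_FT (by simp))
    | cons j L ih =>
      have ih' := ih (fun j hj => hL j (List.mem_cons_of_mem _ hj))
      obtain ⟨a, ha, _, ⟨b, hb, rfl⟩, e⟩ := Submodule.mem_sup.1 ih'
      rw [em_cons, ← e, mul_add]
      have hj := hL j (List.mem_cons_self ..)
      rw [Finset.mem_insert] at hj
      simp only [LinearMap.mulLeft_apply, ← mul_assoc]
      rcases hj with rfl | hj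
      · rw [eg_sq, zero_mul, add_zero]
        exact Submodule.mem_sup_right ⟨a, ha, rfl⟩
      · rw [eg_comm]
        refine add_mem (Submodule.mem_sup_left (eg_FT hj ha)) (Submodule.mem_sup_right ⟨-(eg j * b),
          neg_mem (eg_FT hj hb), ?_⟩)
        simp [mul_assoc]
  obtain ⟨a, ha, _, ⟨b, hb, rfl⟩, e⟩ := Submodule.mem_sup.1 (this hx)
  exact ⟨a, ha, b, hb, e.symm⟩

/-- Linear dependence. -/
def DepL {n l : ℕ} (α : Fin n → Aff l) (S : Finset (Fin n)) : Prop :=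
  ∃ c : Fin n → ℂ, (∃ j ∈ S, c j ≠ 0) ∧ ∑ j ∈ S, c j • (α j).2 = 0

def CZ {n l : ℕ} (α : Fin n → Aff l) (S : Finset (Fin n)) : Prop := ∃ u, ∀ j ∈ S, (α j).ev u = 0

/-- Generators of the Orlik-Solomon ideal. -/
inductive IdGen {n l : ℕ} (α : Fin n → Aff l) (T : Finset (Fin n)) : XA n → Prop
  | dep (L : List (Fin n)) (hT : ∀ j ∈ L, j ∈ T) (hz : CZ α L.toFinset) (hd : DepL α L.toFinset) :
      IdGen α T (bd (em L))
  | emp (L : List (Fin n)) (hT : ∀ j ∈ L, j ∈ T) (hz : ¬ CZ α L.toFinset) : IdGen α T (em L)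
  | mul (j : Fin n) (hj : j ∈ T) (x : XA n) (hx : IdGen α T x) : IdGen α T (eg j * x)

/-- The Orlik-Solomon ideal. -/
def OId {n l : ℕ} (α : Fin n → Aff l) (T : Finset (Fin n)) : Submodule ℂ (XA n) :=
  Submodule.span ℂ {x | IdGen α T x}

lemma OId_mul {n l : ℕ} {α : Fin n → Aff l} {T : Finset (Fin n)} {j : Fin n} (hj : j ∈ T) {x : XA n}
    (hx : x ∈ OId α T) : eg j * x ∈ OId α T := by
  have : (OId α T).map (LinearMap.mulLeft ℂ (eg j)) ≤ OId α T := by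
    rw [OId, Submodule.map_span_le]
    intro x hx
    exact Submodule.subset_span (IdGen.mul j hj x hx)
  exact this ⟨x, hx, rfl⟩

lemma OId_em {n l : ℕ} {α : Fin n → Aff l} {T : Finset (Fin n)} {L : List (Fin n)} (hL : ∀ j ∈ L, j ∈ T)
    {x : XA n} (hx : x ∈ OId α T) : em L * x ∈ OId α T := by
  induction L with
  | nil => simpa using hx
  | cons j L ih =>
    rw [em_cons, mul_assoc]
    exact OId_mul (hL j (List.mem_cons_self ..)) (ih fun j hj => hL j (List.mem_cons_of_mem _ hj))

lemma OId_mono {n l : ℕ} {α : Fin n → Aff l} {T T' : Finset (Fin n)} (h : T ⊆ T') : OId α T ≤ OId α T' := by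
  rw [OId, Submodule.span_le]
  intro x hx
  induction hx with
  | dep L hT hz hd => exact Submodule.subset_span (IdGen.dep L (fun j hj => h (hT j hj)) hz hd)
  | emp L hT hz => exact Submodule.subset_span (IdGen.emp L (fun j hj => h (hT j hj)) hz)
  | mul j hj x _ ih => exact OId_mul (h hj) ih

/-- right multiplication by monomials of a degree-one element of the ideal -/
lemma OId_right {n l : ℕ} {α : Fin n → Aff l} {T : Finset (Fin n)} {c : Fin n → ℂ}
    (h : ∑ j, c j • eg j ∈ OId α T) {x : XA n} (hx : x ∈ FT T) : (∑ j, c j • eg j) * x ∈ OId α T := by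
  have : FT T ≤ (OId α T).comap (LinearMap.mulLeft ℂ (∑ j, c j • eg j)) := by
    refine FT_le fun L hL => ?_
    show (∑ j, c j • eg j) * em L ∈ OId α T
    have : (∑ j, c j • eg j) * em L = (-1 : ℂ)^L.length • (em L * (∑ j, c j • eg j)) := by
      simp only [Finset.sum_mul, Finset.mul_sum, smul_mul_assoc, mul_smul_comm, em_swap, Finset.smul_sum]
      exact Finset.sum_congr rfl fun j _ => smul_comm _ _ _
    rw [this]
    exact Submodule.smul_mem _ _ (OId_em hL h)
  exact this hx

/-! ### the map to forms -/

lemma rep_aux {n l : ℕ} (α : Fin n → Aff l) (c : Fin n → ℂ) (z : Form l) :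
    ∑ i, c i • wl (α i) (∑ j, c j • wl (α j) z) = 0 := by
  set X := ∑ i, c i • wl (α i) (∑ j, c j • wl (α j) z) with hX
  have h : X = - X := by
    conv_lhs => rw [hX]
    simp only [map_sum, map_smul, Finset.smul_sum]
    rw [Finset.sum_comm]
    rw [hX]
    simp only [map_sum, map_smul, Finset.smul_sum, ← Finset.sum_neg_distrib]
    refine Finset.sum_congr rfl fun i _ => Finset.sum_congr rfl fun j _ => ?_
    rw [wl_comm, smul_neg, smul_neg, smul_comm]
  have h2 : (2 : ℂ) • X = 0 := by
    rw [two_smul]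
    nth_rewrite 1 [h]
    simp
  exact (smul_eq_zero.1 h2).resolve_left (by norm_num)

/-- The representation of the exterior algebra by wedging with logarithmic forms. -/
def rep {n l : ℕ} (α : Fin n → Aff l) : XA n →ₐ[ℂ] Module.End ℂ (Form l) :=
  ExteriorAlgebra.lift ℂ ⟨∑ j, (LinearMap.proj j : (Fin n → ℂ) →ₗ[ℂ] ℂ).smulRight (wl (α j)), by
    intro c
    refine LinearMap.ext fun z => ?_
    have h : ∀ w, ((∑ j, (LinearMap.proj j : (Fin n → ℂ) →ₗ[ℂ] ℂ).smulRight (wl (α j)) :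
        (Fin n → ℂ) →ₗ[ℂ] Module.End ℂ (Form l)) c) w = ∑ i, c i • wl (α i) w := by
      intro w
      simp [LinearMap.sum_apply]
    rw [Module.End.mul_apply, h, h]
    exact rep_aux α c z⟩

def psi {n l : ℕ} (α : Fin n → Aff l) : XA n →ₗ[ℂ] Form l :=
  (LinearMap.applyₗ (oneF l)) ∘ₗ (rep α).toLinearMap

lemma psi_def {n l : ℕ} (α : Fin n → Aff l) (x) : psi α x = rep α x (oneF l) := rfl

lemma psi_one {n l : ℕ} (α : Fin n → Aff l) : psi α 1 = oneF l := by rw [psi_def, map_one]; rfl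

lemma psi_eg {n l : ℕ} (α : Fin n → Aff l) (j : Fin n) (x : XA n) :
    psi α (eg j * x) = wl (α j) (psi α x) := by
  rw [psi_def, map_mul, psi_def]
  show rep α (eg j) _ = _
  congr 1
  rw [rep, eg, ExteriorAlgebra.lift_ι_apply]
  simp [LinearMap.sum_apply, Pi.single_apply]

lemma psi_FT {n l : ℕ} {α : Fin n → Aff l} {A : Set (Aff l)} {T : Finset (Fin n)} (h : ∀ j ∈ T, α j ∈ A)
    {x : XA n} (hx : x ∈ FT T) : psi α x ∈ Br A := by
  have : FT T ≤ (Br A).comap (psi α) := by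
    refine FT_le fun L hL => ?_
    show psi α (em L) ∈ Br A
    induction L with
    | nil => rw [em_nil, psi_one]; exact Br_one _
    | cons j L ih =>
      rw [em_cons, psi_eg]
      exact Br_wl (h j (hL j (List.mem_cons_self ..))) (ih fun j hj => hL j (List.mem_cons_of_mem _ hj))
  exact this hx

lemma Br_psi {n l : ℕ} {α : Fin n → Aff l} {A : Set (Aff l)} {T : Finset (Fin n)}
    (h : ∀ a ∈ A, ∃ j ∈ T, α j = a) {z : Form l} (hz : z ∈ Br A) : ∃ x ∈ FT T, psi α x = z := by
  have : Br A ≤ (FT T).map (psi α) := by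
    refine Br_le ⟨1, em_FT (L := []) (by simp), psi_one _⟩ ?_
    rintro a ha _ _ ⟨x, hx, rfl⟩
    obtain ⟨j, hj, rfl⟩ := h a ha
    exact ⟨eg j * x, eg_FT hj hx, psi_eg _ _ _⟩
  exact this hz

lemma psi_Pb {n a b : ℕ} {α : Fin n → Aff a} (t : Fin a → Aff b) {T : Finset (Fin n)}
    (h : ∀ j ∈ T, (α j).comp t ≠ 0) {x : XA n} (hx : x ∈ FT T) :
    Pb t (psi α x) = psi (fun j => (α j).comp t) x := by
  have : FT T ≤ LinearMap.eqLocus (Pb t ∘ₗ psi α) (psi (fun j => (α j).comp t)) := by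
    refine FT_le fun L hL => ?_
    show Pb t (psi α (em L)) = psi _ (em L)
    induction L with
    | nil => rw [em_nil, psi_one, psi_one, Pb_one]
    | cons j L ih =>
      have hL' := fun j hj => hL j (List.mem_cons_of_mem _ hj)
      rw [em_cons, psi_eg, psi_eg, ← ih hL', Pb_wl _ _ (h j (hL j (List.mem_cons_self ..)))]
      refine Om_reg (A := α '' (T : Set (Fin n))) ?_ (Br_le_Om _ (psi_FT (A := α '' (T : Set (Fin n))) (T := T) (fun j hj => Set.mem_image_of_mem _ hj) (em_FT hL')))
      rintro _ ⟨j, hj, rfl⟩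
      exact h j hj
  exact this hx

/-- contraction with the Euler field centred at `u` -/
def IU {l : ℕ} (u : Fin l → ℂ) (z : Form l) : Form l :=
  ∑ j, (affK (coordA j) - algebraMap ℂ _ (u j)) • II (Pi.single j 1) z

lemma IU_wl {l : ℕ} {u : Fin l → ℂ} {a : Aff l} (ha : a ≠ 0) (hu : a.ev u = 0) (z : Form l) :
    IU u (wl a z) = z - wl a (IU u z) := by
  have h1 : affK a = ∑ j, (a.2 (Pi.single j 1)) • (affK (coordA j) - algebraMap ℂ _ (u j)) := by
    have e : a = ∑ j, (a.2 (Pi.single j 1)) • (coordA j - ((u j, 0) : Aff l)) := by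
      apply Aff.ev_inj; intro w
      have : ∀ (s : Finset (Fin l)) (f : Fin l → Aff l), (∑ j ∈ s, f j).ev w = ∑ j ∈ s, (f j).ev w := by
        intro s f
        induction s using Finset.induction_on with
        | empty => simp
        | insert i s hi ih => rw [Finset.sum_insert hi, Finset.sum_insert hi, ev_add, ih]
      rw [this]
      simp only [ev_smul, ev_sub, ev_coordA]
      have e2 : a.ev w = a.2 (w - u) := by
        have : a.ev w = a.ev (u + (w - u)) := by congr 1; abel
        rw [this, ev_addv, hu, zero_add]
      have e3 : ∀ j, Aff.ev ((u j, 0) : Aff l) w = u j := fun j => by simp [Aff.ev]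
      simp only [e3]
      rw [e2]
      conv_lhs => rw [dual_eq_sum a.2]
      simp [LinearMap.sum_apply]
    conv_lhs => rw [e]
    rw [map_sum]
    refine Finset.sum_congr rfl fun j _ => ?_
    rw [map_smul, map_sub, affK_const]
  have h0 := affK_ne ha
  simp only [IU, wl_def, II_ksmul, II_EE, map_sum, EE_ksmul, Finset.smul_sum]
  have h2 : ∀ j, (affK (coordA j) - algebraMap ℂ (KK l) (u j)) • (affK a)⁻¹ •
      (a.2 (Pi.single j 1) • z - EE a.2 (II (Pi.single j 1) z)) =
      (affK a)⁻¹ • ((a.2 (Pi.single j 1) • (affK (coordA j) - algebraMap ℂ (KK l) (u j))) • z) -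
      (affK a)⁻¹ • (affK (coordA j) - algebraMap ℂ (KK l) (u j)) • EE a.2 (II (Pi.single j 1) z) := by
    intro j
    rw [smul_comm (affK (coordA j) - algebraMap ℂ (KK l) (u j)) (affK a)⁻¹]
    simp only [smul_sub]
    congr 2
    rw [smul_comm, ← smul_sub, smul_assoc]
  simp only [h2, Finset.sum_sub_distrib]
  rw [← Finset.smul_sum, ← Finset.sum_smul, ← h1, inv_smul_smul₀ h0]

lemma IU_one {l : ℕ} (u : Fin l → ℂ) : IU u (oneF l) = 0 := by simp [IU, II_one]

lemma psi_bd {n l : ℕ} {α : Fin n → Aff l} {u : Fin l → ℂ} (L : List (Fin n)) (h0 : ∀ j ∈ L, α j ≠ 0)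
    (hu : ∀ j ∈ L, (α j).ev u = 0) : psi α (bd (em L)) = IU u (psi α (em L)) := by
  induction L with
  | nil => rw [em_nil, bd_one, map_zero, psi_one, IU_one]
  | cons j L ih =>
    rw [em_cons, bd_eg, map_sub, psi_eg, psi_eg, ih (fun j hj => h0 j (List.mem_cons_of_mem _ hj))
      (fun j hj => hu j (List.mem_cons_of_mem _ hj)), IU_wl (h0 j (List.mem_cons_self ..))
      (hu j (List.mem_cons_self ..))]

end RV

end

noncomputable section
namespace RV

lemma em_perm {n : ℕ} {L L' : List (Fin n)} (h : L.Perm L') : ∃ ε : ℂ, (ε = 1 ∨ ε = -1) ∧ em L = ε • em L' := by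
  induction h with
  | nil => exact ⟨1, Or.inl rfl, by simp⟩
  | cons x _ ih =>
    obtain ⟨ε, h, e⟩ := ih
    exact ⟨ε, h, by rw [em_cons, e, em_cons, mul_smul_comm]⟩
  | swap x y l =>
    refine ⟨-1, Or.inr rfl, ?_⟩
    simp only [em_cons]
    rw [← mul_assoc, eg_comm y x, neg_mul, mul_assoc, neg_one_smul]
  | trans _ _ ih1 ih2 =>
    obtain ⟨ε, h, e⟩ := ih1
    obtain ⟨ε', h', e'⟩ := ih2
    refine ⟨ε * ε', ?_, by rw [e, e', smul_smul]⟩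
    rcases h with rfl | rfl <;> rcases h' with rfl | rfl <;> simp

lemma wl_psi_mem {n l : ℕ} (α : Fin n → Aff l) {j : Fin n} {L : List (Fin n)} (hj : j ∈ L) :
    wl (α j) (psi α (em L)) = 0 := by
  induction L with
  | nil => simp at hj
  | cons i L ih =>
    rw [em_cons, psi_eg]
    rcases List.mem_cons.1 hj with rfl | hj
    · exact wl_wl_self _ _
    · rw [wl_comm, ih hj, map_zero, neg_zero]

lemma EE_psi_mem {n l : ℕ} (α : Fin n → Aff l) {j : Fin n} {L : List (Fin n)} (h0 : α j ≠ 0) (hj : j ∈ L) :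
    EE (α j).2 (psi α (em L)) = 0 := by
  have := wl_psi_mem α hj
  rw [wl_def] at this
  have h := congrArg (affK (α j) • ·) this
  simpa [smul_inv_smul₀ (affK_ne h0)] using h

lemma psi_dep {n l : ℕ} {α : Fin n → Aff l} {L : List (Fin n)} (h0 : ∀ j ∈ L, α j ≠ 0)
    (h : DepL α L.toFinset) : psi α (em L) = 0 := by
  obtain ⟨c, ⟨j0, hj0, hc⟩, hs⟩ := h
  rw [List.mem_toFinset] at hj0
  obtain ⟨ε, -, e⟩ := em_perm (List.perm_cons_erase hj0)
  rw [e, map_smul, em_cons, psi_eg, wl_def]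
  suffices EE (α j0).2 (psi α (em (L.erase j0))) = 0 by rw [this, smul_zero, smul_zero]
  have h1 : EE (∑ j ∈ L.toFinset, c j • (α j).2) (psi α (em (L.erase j0))) = 0 := by rw [hs, EE_zero]
  rw [EE_sum, Finset.sum_eq_single j0] at h1
  · rw [EE_smul] at h1
    exact (smul_eq_zero.1 h1).resolve_left hc
  · intro j hj hne
    rw [List.mem_toFinset] at hj
    rw [EE_smul, EE_psi_mem α (h0 j hj) ((List.mem_erase_of_ne hne).2 hj), smul_zero]
  · intro h; exact absurd (List.mem_toFinset.2 hj0) h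

lemma dep_of_not_CZ {n l : ℕ} {α : Fin n → Aff l} {S : Finset (Fin n)} (h : ¬ CZ α S) : DepL α S := by
  let M : (Fin l → ℂ) →ₗ[ℂ] (S → ℂ) := LinearMap.pi fun j => (α j).2
  have hM : LinearMap.range M < ⊤ := by
    rw [lt_top_iff_ne_top]
    intro ht
    rw [LinearMap.range_eq_top] at ht
    obtain ⟨u, hu⟩ := ht fun j => -(α j).1
    refine h ⟨u, fun j hj => ?_⟩
    have := congrFun hu ⟨j, hj⟩
    have e : (α j).2 u = -(α j).1 := this
    simp [Aff.ev, e]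
  obtain ⟨f, hf, hle⟩ := Submodule.exists_le_ker_of_lt_top _ hM
  refine ⟨fun j => if hj : j ∈ S then f (Pi.single ⟨j, hj⟩ 1) else 0, ?_, ?_⟩
  · by_contra! hc
    apply hf
    refine LinearMap.pi_ext' fun j => LinearMap.ext_ring ?_
    have := hc j j.2
    simpa using this
  · refine LinearMap.ext fun u => ?_
    have h1 : f (M u) = 0 := hle ⟨u, rfl⟩
    have h2 : M u = ∑ j : S, ((α j).2 u) • (Pi.single j 1 : S → ℂ) := by
      ext i
      simp [M, Pi.single_apply]
    rw [h2, map_sum] at h1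
    rw [LinearMap.sum_apply, ← Finset.sum_coe_sort]
    rw [LinearMap.zero_apply, ← h1]
    refine Finset.sum_congr rfl fun j _ => ?_
    simp [mul_comm]

lemma psi_OId {n l : ℕ} {α : Fin n → Aff l} {T : Finset (Fin n)} (h0 : ∀ j ∈ T, α j ≠ 0) {x : XA n}
    (hx : x ∈ OId α T) : psi α x = 0 := by
  have : OId α T ≤ LinearMap.ker (psi α) := by
    rw [OId, Submodule.span_le]
    intro x hx
    show psi α x = 0
    induction hx with
    | dep L hT hz hd =>
      obtain ⟨u, hu⟩ := hz
      rw [psi_bd L (fun j hj => h0 j (hT j hj)) (u := u) (fun j hj => hu j (List.mem_toFinset.2 hj)),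
        psi_dep (fun j hj => h0 j (hT j hj)) hd]
      simp [IU]
    | emp L hT hz => exact psi_dep (fun j hj => h0 j (hT j hj)) (dep_of_not_CZ hz)
    | mul j hj x _ ih => rw [psi_eg, ih, map_zero]
  exact this hx

/-- the key lemma for adding a hyperplane -/
lemma eg_OId {n m : ℕ} (F : FD m) {α : Fin n → Aff (m+1)} {t : Fin n} {T : Finset (Fin n)} (ht : t ∉ T)
    (hx : F.x = α t) {x : XA n} (h : x ∈ OId (fun j => (α j).comp F.s) T) :
    eg t * x ∈ FT T ⊔ OId α (insert t T) := by
  have : OId (fun j => (α j).comp F.s) T ≤ (FT T ⊔ OId α (insert t T)).comap (LinearMap.mulLeft ℂ (eg t)) := by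
    rw [OId, Submodule.span_le]
    intro x hx'
    show eg t * x ∈ FT T ⊔ OId α (insert t T)
    induction hx' with
    | dep L hT hz hd =>
      have e : eg t * bd (em L) = em L - bd (em (t :: L)) := by
        rw [em_cons, bd_eg]; abel
      rw [e]
      refine sub_mem (Submodule.mem_sup_left (em_FT hT)) (Submodule.mem_sup_right (Submodule.subset_span
        (IdGen.dep (t :: L) (by
          intro j hj
          rcases List.mem_cons.1 hj with rfl | hj
          · exact Finset.mem_insert_self _ _
          · exact Finset.mem_insert_of_mem (hT j hj)) ?_ ?_)))
      · obtain ⟨u, hu⟩ := hz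
        refine ⟨evT F.s u, fun j hj => ?_⟩
        rw [List.toFinset_cons, Finset.mem_insert] at hj
        rcases hj with rfl | hj
        · rw [← hx, ← Aff.comp_ev, F.hxs, ev_zero]
        · rw [← Aff.comp_ev]; exact hu j hj
      · obtain ⟨c, ⟨j0, hj0, hc⟩, hs⟩ := hd
        have htL : t ∉ L.toFinset := fun h => ht (hT t (List.mem_toFinset.1 h))
        refine ⟨fun j => if j = t then -((∑ j ∈ L.toFinset, c j • (α j).2) F.v) else c j, ⟨j0, ?_, ?_⟩, ?_⟩
        · rw [List.toFinset_cons]; exact Finset.mem_insert_of_mem hj0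
        · have : j0 ≠ t := fun h => htL (h ▸ hj0)
          simpa [this] using hc
        · rw [List.toFinset_cons, Finset.sum_insert htL]
          beta_reduce
          rw [if_pos rfl]
          have e1 : ∑ j ∈ L.toFinset, (if j = t then -((∑ j ∈ L.toFinset, c j • (α j).2) F.v) else c j) • (α j).2
              = ∑ j ∈ L.toFinset, c j • (α j).2 := by
            refine Finset.sum_congr rfl fun j hj => ?_
            rw [if_neg]
            rintro rfl
            exact htL hj
          rw [e1]
          have e2 : ∀ j, (α j).2 = (((α j).comp F.s).2 ∘ₗ linT F.p) + ((α j).2 F.v) • (α t).2 := by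
            intro j
            have := congrArg Prod.snd (F.decomp (α j))
            rw [hx] at this
            exact this
          have e3 : ∑ j ∈ L.toFinset, c j • (α j).2 = ((∑ j ∈ L.toFinset, c j • ((α j).comp F.s).2) ∘ₗ linT F.p) +
              ((∑ j ∈ L.toFinset, c j • (α j).2) F.v) • (α t).2 := by
            refine LinearMap.ext fun w => ?_
            simp only [LinearMap.add_apply, LinearMap.comp_apply, LinearMap.sum_apply, LinearMap.smul_apply,
              smul_eq_mul, Finset.sum_mul, ← Finset.sum_add_distrib]
            refine Finset.sum_congr rfl fun j _ => ?_
            conv_lhs => rw [e2 j]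
            simp only [LinearMap.add_apply, LinearMap.comp_apply, LinearMap.smul_apply, smul_eq_mul]
            ring
          rw [hs, LinearMap.zero_comp, zero_add] at e3
          rw [neg_smul, ← e3]
          simp
    | emp L hT hz =>
      refine Submodule.mem_sup_right (Submodule.subset_span
        (IdGen.emp (t :: L) (by
          intro j hj
          rcases List.mem_cons.1 hj with rfl | hj
          · exact Finset.mem_insert_self _ _
          · exact Finset.mem_insert_of_mem (hT j hj)) ?_))
      rintro ⟨u, hu⟩
      refine hz ⟨evT F.p u, fun j hj => ?_⟩
      have h1 := F.hsp' u
      have h2 := hu t (by simp)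
      rw [hx, h2, zero_smul, add_zero] at h1
      rw [Aff.comp_ev, ← h1]
      exact hu j (by simpa using Or.inr (List.mem_toFinset.1 hj))
    | mul j hj x _ ih =>
      rw [← mul_assoc, eg_comm, neg_mul, mul_assoc]
      refine neg_mem ?_
      obtain ⟨a, ha, b, hb, e⟩ := Submodule.mem_sup.1 ih
      rw [← e, mul_add]
      exact add_mem (Submodule.mem_sup_left (eg_FT hj ha))
        (Submodule.mem_sup_right (OId_mul (Finset.mem_insert_of_mem hj) hb))
  exact this h

lemma oneF_ne (l : ℕ) : oneF l ≠ 0 := by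
  intro h
  have h1 := psi_one (n := 0) (l := l) (fun j => 0)
  have := congrArg (fun z : Form l => z 1) h
  simp [oneF] at this

lemma eg_eq_sum {n : ℕ} (t : Fin n) : (∑ j, (Pi.single t 1 : Fin n → ℂ) j • eg j) = eg t := by
  simp [Pi.single_apply]

/-- exactness of the Orlik-Solomon relations -/
lemma psi_inj {n : ℕ} (T : Finset (Fin n)) : ∀ (l : ℕ) (α : Fin n → Aff l), (∀ j ∈ T, α j ≠ 0) →
    ∀ x ∈ FT T, psi α x = 0 → x ∈ OId α T := by
  induction T using Finset.induction_on with
  | empty =>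
    intro l α _ x hx hp
    have : FT (∅ : Finset (Fin n)) ≤ Submodule.span ℂ {1} := by
      refine FT_le fun L hL => ?_
      cases L with
      | nil => exact Submodule.mem_span_singleton_self _
      | cons j L => exact absurd (hL j (List.mem_cons_self ..)) (Finset.notMem_empty _)
    obtain ⟨c, rfl⟩ := Submodule.mem_span_singleton.1 (this hx)
    rw [map_smul, psi_one] at hp
    rw [(smul_eq_zero.1 hp).resolve_right (oneF_ne l), zero_smul]
    exact zero_mem _
  | insert t T ht ih =>
    intro l α h0 x hx hp
    have h0' : ∀ j ∈ T, α j ≠ 0 := fun j hj => h0 j (Finset.mem_insert_of_mem hj)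
    have hsub : T ⊆ insert t T := Finset.subset_insert _ _
    obtain ⟨x', hx', x'', hx'', rfl⟩ := FT_insert hx
    rw [map_add, psi_eg] at hp
    by_cases hc : (α t).2 = 0
    · have e : α t = ((α t).1, 0) := Prod.ext rfl hc
      rw [e, wl_const, add_zero] at hp
      refine add_mem (OId_mono hsub (ih l α h0' x' hx' hp)) ?_
      have h1 : eg t ∈ OId α (insert t T) := by
        have : em [t] ∈ OId α (insert t T) := Submodule.subset_span (IdGen.emp [t] (by simp) (by
          rintro ⟨u, hu⟩
          have := hu t (by simp)
          rw [e] at this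
          simp [Aff.ev] at this
          exact h0 t (Finset.mem_insert_self _ _) (by rw [e, this]; rfl)))
        simpa using this
      rw [← eg_eq_sum] at h1 ⊢
      exact OId_right h1 (FT_mono hsub hx'')
    by_cases hpr : ∃ i ∈ T, ∃ c : ℂ, c ≠ 0 ∧ α t = c • α i
    · obtain ⟨i, hi, c, hc0, e⟩ := hpr
      have hit : i ≠ t := fun h => ht (h ▸ hi)
      have h1 : eg t - eg i ∈ OId α (insert t T) := by
        have : bd (em [i, t]) ∈ OId α (insert t T) := Submodule.subset_span (IdGen.dep [i, t] (by simp [hi]) ?_ ?_)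
        · rw [em_cons, em_cons, em_nil, bd_eg, bd_eg, bd_one, mul_zero, sub_zero, mul_one, mul_one] at this
          exact this
        · obtain ⟨v, hv⟩ : ∃ v, (α t).2 v ≠ 0 := by
            by_contra! h'
            exact hc (LinearMap.ext h')
          have hz : (α t).ev ((-(α t).1 / (α t).2 v) • v) = 0 := by
            simp [Aff.ev, hv]
          refine ⟨(-(α t).1 / (α t).2 v) • v, fun j hj => ?_⟩
          generalize (-(α t).1 / (α t).2 v) • v = w at hz ⊢
          rcases (by simpa using hj : j = i ∨ j = t) with rfl | rfl
          · rw [e, ev_smul] at hz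
            exact (mul_eq_zero.1 hz).resolve_left hc0
          · exact hz
        · refine ⟨fun j => if j = t then 1 else -c, ⟨t, by simp, by simp⟩, ?_⟩
          have : [i, t].toFinset = {i, t} := by simp
          rw [this, Finset.sum_pair hit]
          beta_reduce
          rw [if_neg hit, if_pos rfl, e]
          show -c • (α i).2 + (1:ℂ) • (c • (α i).2) = 0
          simp
      have h2 : x' + eg i * x'' ∈ OId α T := by
        refine ih l α h0' _ (add_mem hx' (eg_FT hi hx'')) ?_
        rw [e, wl_smul_aff c hc0] at hp
        rw [map_add, psi_eg, hp]
      have h3 : (eg t - eg i) * x'' ∈ OId α (insert t T) := by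
        have e3 : (∑ j, (Pi.single t 1 - Pi.single i 1 : Fin n → ℂ) j • eg j) = eg t - eg i := by
          simp [Pi.single_apply, sub_smul, Finset.sum_sub_distrib]
        rw [← e3] at h1 ⊢
        exact OId_right h1 (FT_mono hsub hx'')
      have e4 : x' + eg t * x'' = (x' + eg i * x'') + (eg t - eg i) * x'' := by rw [sub_mul]; abel
      rw [e4]
      exact add_mem (OId_mono hsub h2) h3
    · cases l with
      | zero => exact absurd (Subsingleton.elim _ _) hc
      | succ m =>
        obtain ⟨F, hF⟩ := FD.exists_of_x (α t) hc
        have hne : ∀ j ∈ T, (α j).comp F.s ≠ 0 := by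
          intro j hj hz
          have := F.decomp (α j)
          rw [hz, hF] at this
          have z0 : (0 : Aff m).comp F.p = 0 := by
            apply Aff.ev_inj; intro u; rw [Aff.comp_ev, ev_zero, ev_zero]
          rw [z0, zero_add] at this
          have hc1 : (α j).2 F.v ≠ 0 := by
            intro h
            rw [h, zero_smul] at this
            exact h0' j hj this
          refine hpr ⟨j, hj, ((α j).2 F.v)⁻¹, inv_ne_zero hc1, ?_⟩
          conv_rhs => rw [this]
          rw [smul_smul]
          rw [← this, inv_mul_cancel₀ hc1, one_smul]
        have hreg : ∀ y ∈ FT T, RegF F.s (psi α y) := by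
          intro y hy
          refine Om_reg (A := α '' (T : Set (Fin n))) ?_ (Br_le_Om _ (psi_FT (T := T)
            (fun j hj => Set.mem_image_of_mem _ hj) hy))
          rintro _ ⟨j, hj, rfl⟩
          exact hne j hj
        rw [← hF] at hp
        have h1 := F.res_zero (hreg _ hx') (hreg _ hx'') hp
        rw [psi_Pb F.s hne hx''] at h1
        have h2 := ih m _ hne x'' hx'' h1
        obtain ⟨f, hf, g, hg, e⟩ := Submodule.mem_sup.1 (eg_OId F ht hF h2)
        rw [← e, ← add_assoc]
        refine add_mem (OId_mono hsub (ih _ α h0' _ (add_mem hx' hf) ?_)) hg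
        rw [map_add]
        rw [hF, ← psi_eg, ← e, map_add, psi_OId h0 hg, add_zero] at hp
        exact hp

/-- Brieskorn forms that are regular along a hyperplane. -/
lemma Br_of_Om {m : ℕ} (F : FD m) {A : Set (Aff (m+1))} (hfin : A.Finite) (hA : ∀ f ∈ A, f.comp F.s ≠ 0)
    {z : Form (m+1)} (hz : z ∈ Br (insert F.x A)) (hzO : z ∈ Om A) : z ∈ Br A := by
  obtain ⟨n, f, hf⟩ : ∃ (n : ℕ) (f : Fin n → Aff (m+1)), Set.range f = A := by
    have := hfin.fintype
    refine ⟨Fintype.card A, fun i => ((Fintype.equivFin A).symm i : Aff (m+1)), ?_⟩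
    ext a
    constructor
    · rintro ⟨i, rfl⟩; exact Subtype.prop _
    · intro ha; exact ⟨Fintype.equivFin A ⟨a, ha⟩, by simp⟩
  let α : Fin (n+1) → Aff (m+1) := Fin.cons F.x f
  let T : Finset (Fin (n+1)) := Finset.univ.erase 0
  have hT : ∀ j ∈ T, α j ∈ A := by
    intro j hj
    obtain ⟨i, rfl⟩ := Fin.exists_succ_eq.2 (Finset.ne_of_mem_erase hj)
    rw [← hf]; exact ⟨i, by simp [α]⟩
  have h0 : (0 : Fin (n+1)) ∉ T := by simp [T]
  have hne : ∀ j ∈ T, (α j).comp F.s ≠ 0 := fun j hj => hA _ (hT j hj)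
  obtain ⟨x, hx, hxz⟩ := Br_psi (T := insert 0 T) (α := α) (A := insert F.x A) (by
    rintro a (rfl | ha)
    · exact ⟨0, Finset.mem_insert_self _ _, rfl⟩
    · rw [← hf] at ha
      obtain ⟨i, rfl⟩ := ha
      exact ⟨i.succ, by simp [T], by simp [α]⟩) hz
  obtain ⟨x', hx', x'', hx'', rfl⟩ := FT_insert hx
  have hOm : ∀ y ∈ FT T, psi α y ∈ Om A := fun y hy => Br_le_Om _ (psi_FT hT hy)
  have hp : (psi α x' - z) + wl F.x (psi α x'') = 0 := by
    rw [← hxz, map_add, psi_eg]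
    show psi α x' - (psi α x' + wl F.x (psi α x'')) + _ = 0
    abel
  have h1 := F.res_zero (Om_reg hA (sub_mem (hOm _ hx') hzO)) (Om_reg hA (hOm _ hx'')) hp
  rw [psi_Pb F.s hne hx''] at h1
  have h2 := psi_inj T m _ hne x'' hx'' h1
  obtain ⟨a, ha, g, hg, e⟩ := Submodule.mem_sup.1 (eg_OId (α := α) F h0 rfl h2)
  have h3 : psi α g = 0 := by
    refine psi_OId ?_ hg
    intro j hj
    rcases Finset.mem_insert.1 hj with rfl | hj
    · exact F.x_ne
    · intro h
      apply hne j hj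
      rw [h]
      apply Aff.ev_inj; intro u; rw [Aff.comp_ev, ev_zero, ev_zero]
  rw [← hxz, ← e, ← add_assoc, map_add, h3, add_zero]
  exact psi_FT hT (add_mem hx' ha)

end RV

end

noncomputable section
namespace RV

/-- all eigenvalues lie in `G` -/
def EigIn {κ : Type} [Fintype κ] (G : Set ℂ) (M : Matrix κ κ ℂ) : Prop :=
  ∀ (μ : ℂ) (x : κ → ℂ), x ≠ 0 → M.mulVec x = μ • x → μ ∈ G

lemma EigIn.isUnit {κ : Type} [Fintype κ] {G : Set ℂ} {M : Matrix κ κ ℂ} (h : EigIn G M) {μ : ℂ} (hμ : μ ∉ G) :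
    IsUnit (M - μ • (1 : Matrix κ κ ℂ)) := by
  rw [Matrix.isUnit_iff_isUnit_det, isUnit_iff_ne_zero]
  intro h0
  obtain ⟨v, hv, e⟩ := Matrix.exists_mulVec_eq_zero_iff.2 h0
  refine hμ (h μ v hv ?_)
  rw [Matrix.sub_mulVec, Matrix.smul_mulVec, Matrix.one_mulVec, sub_eq_zero] at e
  exact e

def PU {ι κ : Type} [Fintype ι] {l : ℕ} (α : ι → Aff l) (P : ι → Matrix κ κ ℂ) (u : Fin l → ℂ) : Matrix κ κ ℂ :=
  ∑ i with (α i).ev u = 0, P i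

def PV {ι κ : Type} [Fintype ι] {l : ℕ} (α : ι → Aff l) (P : ι → Matrix κ κ ℂ) (v : Fin l → ℂ) : Matrix κ κ ℂ :=
  ∑ i with (α i).2 v ≠ 0, P i

structure Spc {ι κ : Type} [Fintype ι] [Fintype κ] {l : ℕ} (G : Set ℂ) (α : ι → Aff l) (P : ι → Matrix κ κ ℂ) :
    Prop where
  hu : ∀ u, EigIn G (PU α P u)
  hv : ∀ v, EigIn G (PV α P v)

structure GoodG (G : Set ℂ) : Prop where
  zero : (0 : ℂ) ∈ G
  int : ∀ k : ℤ, (k : ℂ) ∈ G → k = 0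

def ClaimFor {ι κ : Type} [Fintype ι] [Fintype κ] {l : ℕ} (A : Set (Aff l)) (α : ι → Aff l)
    (P : ι → Matrix κ κ ℂ) : Prop :=
  ∀ y ∈ pv (Om A), nab α P y ∈ pv (Br A) → ∃ y' ∈ pv (Om A), y - nab α P y' ∈ pv (Br A)

def Claim (G : Set ℂ) (l : ℕ) : Prop :=
  ∀ (A : Set (Aff l)), A.Finite → (0 : Aff l) ∉ A → ∀ (ι κ : Type) [Fintype ι] [Fintype κ]
    (α : ι → Aff l) (P : ι → Matrix κ κ ℂ), (∀ i, α i ∈ A) → Flat α P → Spc G α P → ClaimFor A α P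

lemma Spc.comp {ι κ : Type} [Fintype ι] [Fintype κ] {a b : ℕ} {G : Set ℂ} {α : ι → Aff a}
    {P : ι → Matrix κ κ ℂ} (h : Spc G α P) (t : Fin a → Aff b) : Spc G (fun i => (α i).comp t) P where
  hu u := by
    have : PU (fun i => (α i).comp t) P u = PU α P (evT t u) := by simp [PU, Aff.comp_ev]
    rw [this]; exact h.hu _
  hv v := by
    have : PV (fun i => (α i).comp t) P v = PV α P (linT t v) := by
      unfold PV
      refine Finset.sum_congr ?_ (fun _ _ => rfl)
      ext i
      rw [Finset.mem_filter, Finset.mem_filter]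
      exact Iff.rfl
    rw [this]; exact h.hv _

lemma comp_zero {a b : ℕ} (t : Fin a → Aff b) : (0 : Aff a).comp t = 0 := by
  apply Aff.ev_inj; intro u; rw [Aff.comp_ev, ev_zero, ev_zero]

lemma aa_RegF {ι κ : Type} [Fintype ι] [Fintype κ] {a b : ℕ} {t : Fin a → Aff b} {α : ι → Aff a}
    {P : ι → Matrix κ κ ℂ} (h : ∀ i, (α i).comp t ≠ 0) {z : VF κ a} (hz : ∀ k, RegF t (z k)) :
    ∀ k, RegF t (aa α P z k) := by
  let M : Submodule ℂ (Form a) :=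
    { carrier := {z | RegF t z}
      add_mem' := fun h1 h2 => h1.add h2
      zero_mem' := fun x => zero_mem (regSub t)
      smul_mem' := fun c z hz x => Subalgebra.smul_mem _ (hz x) c }
  have : aa α P z ∈ pv M := aa_mem α P (fun i z hz => RegF.wl hz (h i)) (mem_pv.2 hz)
  exact mem_pv.1 this

lemma Flat.comp_s {ι κ : Type} [Fintype ι] [Fintype κ] {m : ℕ} (F : FD m) {α : ι → Aff (m+1)}
    {P : ι → Matrix κ κ ℂ} (h : Flat α P) (hα : ∀ i, (α i).comp F.s ≠ 0) : Flat (fun i => (α i).comp F.s) P := by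
  intro z
  have hz : z = cw (Pb F.s) (cw (Pb F.p) z) := by ext1 k; simp [F.Pb_s_p]
  have hr : ∀ k, RegF F.s (cw (Pb F.p) z k) := fun k => F.Pb_p_reg _
  rw [hz, ← aa_Pb α P F.s hα hr, ← aa_Pb α P F.s hα (aa_RegF hα hr), h, map_zero]

lemma Br_insert {l : ℕ} {a : Aff l} {A : Set (Aff l)} {z : Form l} (hz : z ∈ Br (insert a A)) :
    ∃ z1 ∈ Br A, ∃ z2 ∈ Br A, z = z1 + wl a z2 := by
  have : Br (insert a A) ≤ Br A ⊔ (Br A).map (wl a) := by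
    refine Br_le (Submodule.mem_sup_left (Br_one _)) ?_
    rintro b hb z - hz
    obtain ⟨z1, h1, _, ⟨z2, h2, rfl⟩, rfl⟩ := Submodule.mem_sup.1 hz
    rw [map_add]
    rcases hb with rfl | hb
    · rw [wl_wl_self, add_zero]
      exact Submodule.mem_sup_right ⟨_, h1, rfl⟩
    · rw [wl_comm b a]
      exact add_mem (Submodule.mem_sup_left (Br_wl hb h1)) (neg_mem (Submodule.mem_sup_right ⟨_, Br_wl hb h2, rfl⟩))
  obtain ⟨z1, h1, _, ⟨z2, h2, rfl⟩, rfl⟩ := Submodule.mem_sup.1 (this hz)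
  exact ⟨z1, h1, z2, h2, rfl⟩

lemma FD.wl_of_Pb {m : ℕ} (F : FD m) {A : Set (Aff (m+1))} (hA : ∀ f ∈ A, f.comp F.s ≠ 0) {z : Form (m+1)}
    (hz : z ∈ Om A) (h : Pb F.s z = 0) : wl F.x z ∈ Om A := by
  obtain ⟨z1, h1, z2, h2, rfl⟩ := F.ker_Om hA hz h
  rw [map_add, wl_ksmul, wl_def, wl_def, EE_EE_self, smul_zero, add_zero, smul_inv_smul₀ (affK_ne F.x_ne)]
  exact Om_EE _ h1

/-- If `f` is not proportional to `F.x` then it restricts to a nonzero form. -/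
lemma FD.comp_s_ne {m : ℕ} (F : FD m) {f : Aff (m+1)} (hf : f ≠ 0)
    (h : ∀ c : ℂ, c ≠ 0 → F.x ≠ c • f) : f.comp F.s ≠ 0 := by
  intro hz
  have := F.decomp f
  rw [hz, comp_zero, zero_add] at this
  have hc1 : f.2 F.v ≠ 0 := by
    intro h
    rw [h, zero_smul] at this
    exact hf this
  refine h (f.2 F.v)⁻¹ (inv_ne_zero hc1) ?_
  generalize f.2 F.v = c at this hc1
  rw [this, smul_smul, inv_mul_cancel₀ hc1, one_smul]

lemma ClaimFor.congr {ι κ : Type} [Fintype ι] [Fintype κ] {l : ℕ} {A B : Set (Aff l)} {α : ι → Aff l}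
    {P : ι → Matrix κ κ ℂ} (h : ClaimFor A α P) (h1 : Sub' A B) (h2 : Sub' B A) : ClaimFor B α P := by
  have e1 : Om A = Om B := le_antisymm (Om_sub' h1) (Om_sub' h2)
  have e2 : Br A = Br B := le_antisymm (Br_sub' h1) (Br_sub' h2)
  unfold ClaimFor at *
  rw [← e1, ← e2]; exact h

/-- vector version of choice -/
lemma pv_choose {κ : Type} {l l' : ℕ} {M : Submodule ℂ (Form l)} {Q : κ → Form l → Prop} {R : Form l' → Prop}
    {z : VF κ l'} (hz : ∀ k, R (z k)) (h : ∀ k, R (z k) → ∃ x ∈ M, Q k x) :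
    ∃ x ∈ (pv M : Submodule ℂ (VF κ l)), ∀ k, Q k (x k) := by
  choose x hx hq using fun k => h k (hz k)
  exact ⟨x, mem_pv.2 hx, hq⟩

lemma isUnit_sub {κ : Type} [Fintype κ] {k : ℕ} (hk : 1 ≤ k) : IsUnit ((0 : Matrix κ κ ℂ) - (k : ℂ) • 1) := by
  have : (k : ℂ) ≠ 0 := by exact_mod_cast (by omega : k ≠ 0)
  rw [zero_sub, ← neg_smul, Matrix.isUnit_iff_isUnit_det, Matrix.det_smul, Matrix.det_one, mul_one,
    isUnit_iff_ne_zero]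
  exact pow_ne_zero _ (neg_ne_zero.2 this)

/-- Deletion. -/
lemma deletion {G : Set ℂ} {ι κ : Type} [Fintype ι] [Fintype κ] {m : ℕ} (hm : Claim G m) {A : Set (Aff (m+1))}
    (hfin : A.Finite) (h0 : (0 : Aff (m+1)) ∉ A) {H : Aff (m+1)} {α : ι → Aff (m+1)}
    {P : ι → Matrix κ κ ℂ} (hα : ∀ i, α i ∈ A) (hflat : Flat α P) (hs : Spc G α P)
    (hc : ClaimFor (insert H A) α P) : ClaimFor A α P := by
  by_cases htriv : H.2 = 0 ∨ ∃ c : ℂ, c ≠ 0 ∧ ∃ b ∈ A, H = c • b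
  · refine hc.congr ?_ ?_
    · rintro a (rfl | ha)
      · exact htriv
      · exact Or.inr ⟨1, one_ne_zero, a, ha, (one_smul _ _).symm⟩
    · intro a ha
      exact Or.inr ⟨1, one_ne_zero, a, Or.inr ha, (one_smul _ _).symm⟩
  push Not at htriv
  obtain ⟨hH, htriv⟩ := htriv
  obtain ⟨F, rfl⟩ := FD.exists_of_x H hH
  have hA : ∀ f ∈ A, f.comp F.s ≠ 0 := fun f hf =>
    F.comp_s_ne (fun h => h0 (h ▸ hf)) (fun c hc => htriv c hc f hf)
  have hαs : ∀ i, (α i).comp F.s ≠ 0 := fun i => hA _ (hα i)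
  have hsub : A ⊆ insert F.x A := Set.subset_insert _ _
  intro y hy hny
  obtain ⟨z, hz, hyz⟩ := hc y (pv_mono (Om_mono hsub) hy) (pv_mono (Br_mono hsub) hny)
  set b := y - nab α P z with hb
  have hnz : nab α P z = y - b := by rw [hb]; abel
  obtain ⟨t, ht, hzt⟩ := FD.LR (F := F) hA hα 0 (nab α P) (by
      intro z
      have : mm (0 : Matrix κ κ ℂ) z = 0 := by ext1 k; simp [mm_apply]
      rw [this, map_zero, add_zero]) (nab_nab α P hflat) (fun k hk => isUnit_sub hk)
      (pv (Om A)) (pv (Om (insert F.x A))) le_rfl (fun g hg => ⟨g, hg, fun _ => rfl⟩)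
      (by
        intro k δ hδ
        rw [mem_pv] at *
        intro i
        refine Om_ksmul ?_ (Om_mono hsub (hδ i))
        rw [← inv_pow]
        exact pow_mem (inv_mem (Set.mem_insert _ _)) k) hz (by
        rw [hnz]
        exact sub_mem (pv_mono FD.Om_le_YY0 hy) (pv_mono FD.Br_le_YY0 hyz))
  rw [mem_pv] at hzt
  choose β hβ γ hγ hzβ using fun k => FD.mem_YY0.1 (hzt k)
  have e1 : z = nab α P t + (β + cw (wl F.x) γ) := by
    rw [← sub_eq_iff_eq_add']; ext1 k; exact hzβ k
  have hβ' : β ∈ pv (Om A) := mem_pv.2 hβ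
  have hγ' : γ ∈ pv (Om A) := mem_pv.2 hγ
  rw [mem_pv] at hyz
  choose b1 hb1 b2 hb2 hbb using fun k => Br_insert (hyz k)
  have hγr : ∀ k, RegF F.s (γ k) := fun k => Om_reg hA (hγ k)
  have hres : cw (Pb F.s) (nab α P γ) = cw (Pb F.s) b2 := by
    have e2 : (nab α P β - y + b1) + cw (wl F.x) (b2 - nab α P γ) = 0 := by
      have e3 : nab α P z = nab α P β - cw (wl F.x) (nab α P γ) := by
        rw [e1, map_add, nab_nab α P hflat, zero_add, map_add, nab_wl]; abel
      have e4 : b = b1 + cw (wl F.x) b2 := by ext1 k; exact hbb k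
      rw [hnz, e4] at e3
      rw [map_sub, ← sub_eq_zero.2 e3.symm]; abel
    ext1 k
    have h1 : nab α P β k ∈ Om A := mem_pv.1 (nab_Om α P hα hβ') k
    have h2 : nab α P γ k ∈ Om A := mem_pv.1 (nab_Om α P hα hγ') k
    have := F.res_zero (Om_reg hA (add_mem (sub_mem h1 (mem_pv.1 hy k)) (Br_le_Om _ (hb1 k))))
      (Om_reg hA (sub_mem (Br_le_Om _ (hb2 k)) h2)) (congrFun e2 k)
    rw [map_sub, sub_eq_zero] at this
    exact this.symm
  let B : Set (Aff m) := (fun f => f.comp F.s) '' A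
  have hAB : ∀ f ∈ A, f.comp F.s ∈ B := fun f hf => ⟨f, hf, rfl⟩
  have hBA : ∀ b ∈ B, ∃ a ∈ A, a.comp F.s = b ∧ b ≠ 0 := by
    rintro _ ⟨a, ha, rfl⟩
    exact ⟨a, ha, rfl, hA a ha⟩
  obtain ⟨t2, ht2, hb3⟩ := hm B (hfin.image _) (by rintro ⟨a, ha, e⟩; exact hA a ha e) ι κ
    (fun i => (α i).comp F.s) P (fun i => hAB _ (hα i)) (hflat.comp_s F hαs) (hs.comp F.s)
    (cw (Pb F.s) γ) (pv_cw (fun z hz => Pb_Om hA hAB hz) hγ') (by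
      rw [← nab_Pb α P F.s hαs hγr, hres]
      exact pv_cw (fun z hz => Pb_Br hA hAB hz) (mem_pv.2 hb2))
  rw [mem_pv] at ht2 hb3
  choose t1 ht1 et1 using fun k => FD.lift_Om (F := F) hBA hA (ht2 k)
  choose b4 hb4 eb4 using fun k => FD.lift_Br (F := F) hBA hA (hb3 k)
  have ht1' : t1 ∈ pv (Om A) := mem_pv.2 ht1
  have hb4' : b4 ∈ pv (Br A) := mem_pv.2 hb4
  have hker : ∀ k, Pb F.s ((γ - nab α P t1 - b4) k) = 0 := by
    intro k
    have h1 := congrFun (nab_Pb α P F.s hαs (z := t1) (fun k => Om_reg hA (ht1 k))) k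
    have h2 : cw (Pb F.s) t1 = t2 := by ext1 k; exact et1 k
    rw [h2] at h1
    have h3 := eb4 k
    simp only [Pi.sub_apply, map_sub, cw_apply] at h1 h3 ⊢
    rw [h3, h1]; abel
  have hmem : γ - nab α P t1 - b4 ∈ pv (Om A) :=
    sub_mem (sub_mem hγ' (nab_Om α P hα ht1')) (pv_mono (Br_le_Om A) hb4')
  have hw : cw (wl F.x) (γ - nab α P t1 - b4) ∈ pv (Om A) :=
    mem_pv.2 fun k => F.wl_of_Pb hA (mem_pv.1 hmem k) (hker k)
  set ω := β + cw (wl F.x) (γ - nab α P t1 - b4) with hω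
  have hωO : ω ∈ pv (Om A) := add_mem hβ' hw
  have e5 : nab α P z = nab α P ω + nab α P (cw (wl F.x) b4) := by
    have : z = nab α P t + (ω + cw (wl F.x) b4 - nab α P (cw (wl F.x) t1)) := by
      rw [e1, hω, nab_wl, map_sub, map_sub]; abel
    rw [this, map_add, map_sub, map_add, nab_nab α P hflat, nab_nab α P hflat]; abel
  refine ⟨ω, hωO, ?_⟩
  have e6 : y - nab α P ω = b + nab α P (cw (wl F.x) b4) := by
    rw [hb, e5]; abel
  rw [mem_pv]
  intro k
  refine Br_of_Om F hfin hA ?_ (mem_pv.1 (sub_mem hy (nab_Om α P hα hωO)) k)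
  rw [e6]
  refine add_mem (hyz k) (mem_pv.1 (nab_Br (A := insert F.x A) α P (fun i => hsub (hα i)) ?_) k)
  exact mem_pv.2 fun k => Br_wl (Set.mem_insert _ _) (Br_mono hsub (hb4 k))

/-- Multi-deletion. -/
lemma deletions {G : Set ℂ} {ι κ : Type} [Fintype ι] [Fintype κ] {m : ℕ} (hm : Claim G m) {A : Set (Aff (m+1))}
    (hfin : A.Finite) (h0 : (0 : Aff (m+1)) ∉ A) (S : Finset (Aff (m+1))) (hS : (0 : Aff (m+1)) ∉ S)
    {α : ι → Aff (m+1)} {P : ι → Matrix κ κ ℂ} (hα : ∀ i, α i ∈ A) (hflat : Flat α P) (hs : Spc G α P)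
    (hc : ClaimFor (A ∪ ↑S) α P) : ClaimFor A α P := by
  induction S using Finset.induction_on with
  | empty => simpa using hc
  | insert a S ha ih =>
    refine ih (fun h => hS (Finset.mem_insert_of_mem h)) ?_
    refine deletion hm (A := A ∪ ↑S) (H := a) (hfin.union S.finite_toSet) ?_ (fun i => Or.inl (hα i)) hflat hs ?_
    · rintro (h | h)
      · exact h0 h
      · exact hS (Finset.mem_insert_of_mem h)
    · have : insert a (A ∪ (S : Set (Aff (m+1)))) = A ∪ ↑(insert a S) := by
        rw [Finset.coe_insert, Set.union_insert]
      rw [this]; exact hc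

end RV

end

noncomputable section
namespace RV

lemma exists_generic {l : ℕ} {S : Set (Aff l)} (hS : S.Finite) (h0 : ∀ f ∈ S, f ≠ 0) :
    ∃ u, ∀ f ∈ S, f.ev u ≠ 0 := by
  have hne : ∏ f ∈ hS.toFinset, affP l f ≠ 0 := by
    rw [Finset.prod_ne_zero_iff]
    intro f hf h
    refine h0 f (hS.mem_toFinset.1 hf) (Aff.ev_inj fun u => ?_)
    rw [← affP_eval, h]; simp
  obtain ⟨u, hu⟩ : ∃ u, MvPolynomial.eval u (∏ f ∈ hS.toFinset, affP l f) ≠ 0 := by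
    by_contra! h
    exact hne (MvPolynomial.funext (fun u => by rw [h u, map_zero]))
  refine ⟨u, fun f hf h => hu ?_⟩
  rw [map_prod]
  exact Finset.prod_eq_zero (hS.mem_toFinset.2 hf) (by rw [affP_eval, h])

lemma comp_add' {a b : ℕ} (f g : Aff a) (t : Fin a → Aff b) : (f + g).comp t = f.comp t + g.comp t := by
  apply Aff.ev_inj; intro u; simp only [Aff.comp_ev, ev_add]
lemma comp_sub' {a b : ℕ} (f g : Aff a) (t : Fin a → Aff b) : (f - g).comp t = f.comp t - g.comp t := by
  apply Aff.ev_inj; intro u; simp only [Aff.comp_ev, ev_sub]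

/-- A family of sections of a linear projection. -/
structure Fib (m : ℕ) (ι : Type) [Fintype ι] where
  F : FD m
  α : ι → Aff (m+1)
  inj : Function.Injective α
  hv : ∀ i, (α i).2 F.v = 1

namespace Fib
variable {m : ℕ} {ι : Type} [Fintype ι] (X : Fib m ι)

def ps (i : ι) : Aff m := (X.α i).comp X.F.s

def Gd (i : ι) : FD m := (X.F.change (X.α i) (X.hv i)).choose
lemma Gd_p (i : ι) : (X.Gd i).p = X.F.p := (X.F.change (X.α i) (X.hv i)).choose_spec.1
lemma Gd_v (i : ι) : (X.Gd i).v = X.F.v := (X.F.change (X.α i) (X.hv i)).choose_spec.2.1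
lemma Gd_x (i : ι) : (X.Gd i).x = X.α i := (X.F.change (X.α i) (X.hv i)).choose_spec.2.2

def b (i j : ι) : Aff m := X.ps i - X.ps j

lemma α_eq (i : ι) : X.α i = (X.ps i).comp X.F.p + X.F.x := by
  have := X.F.decomp (X.α i)
  rw [X.hv, one_smul] at this
  exact this

lemma α_sub (i j : ι) : X.α i = (X.b i j).comp X.F.p + X.α j := by
  rw [X.α_eq i, X.α_eq j, b, comp_sub']; abel

lemma b_ne {i j : ι} (h : i ≠ j) : X.b i j ≠ 0 := by
  intro h0
  apply h
  apply X.inj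
  rw [X.α_sub i j, h0, comp_zero, zero_add]

lemma α_s (i j : ι) : (X.α i).comp (X.Gd j).s = X.b i j := by
  rw [X.α_sub i j, comp_add', ← X.Gd_x j, (X.Gd j).hxs, add_zero, ← X.Gd_p j, (X.Gd j).comp_p_s]

lemma p_s (f : Aff m) (j : ι) : (f.comp X.F.p).comp (X.Gd j).s = f := by
  rw [← X.Gd_p j, (X.Gd j).comp_p_s]

def B : Set (Aff m) := {f | ∃ i j, i ≠ j ∧ f = X.b i j}

lemma b_mem {i j : ι} (h : i ≠ j) : X.b i j ∈ X.B := ⟨i, j, h, rfl⟩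

lemma B_fin : X.B.Finite := by
  refine (Set.finite_range (fun q : ι × ι => X.b q.1 q.2)).subset ?_
  rintro _ ⟨i, j, -, rfl⟩
  exact ⟨(i, j), rfl⟩

lemma B_ne {f : Aff m} (hf : f ∈ X.B) : f ≠ 0 := by
  obtain ⟨i, j, h, rfl⟩ := hf
  exact X.b_ne h

def pB : Set (Aff (m+1)) := (fun f : Aff m => f.comp X.F.p) '' X.B

lemma pB_mem {f : Aff m} (hf : f ∈ X.B) : f.comp X.F.p ∈ X.pB := ⟨f, hf, rfl⟩

/-- the hyperplanes indexed by `T` together with the vertical ones -/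
def AT (T : Set ι) : Set (Aff (m+1)) := X.α '' T ∪ X.pB

lemma AT_mono {T T' : Set ι} (h : T ⊆ T') : X.AT T ⊆ X.AT T' := Set.union_subset_union_left _ (Set.image_mono h)

lemma α_mem {T : Set ι} {i : ι} (h : i ∈ T) : X.α i ∈ X.AT T := Or.inl ⟨i, h, rfl⟩
lemma p_mem {T : Set ι} {f : Aff m} (hf : f ∈ X.B) : f.comp X.F.p ∈ X.AT T := Or.inr (X.pB_mem hf)

lemma AT_insert (T : Set ι) (j : ι) : X.AT (insert j T) = insert (X.Gd j).x (X.AT T) := by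
  rw [AT, AT, X.Gd_x, Set.image_insert_eq, Set.insert_union]

lemma AT_ne {T : Set ι} {j : ι} (hj : j ∉ T) : ∀ f ∈ X.AT T, f.comp (X.Gd j).s ≠ 0 := by
  rintro _ (⟨i, hi, rfl⟩ | ⟨f, hf, rfl⟩)
  · rw [X.α_s]; exact X.b_ne (fun h => hj (h ▸ hi))
  · show (f.comp X.F.p).comp _ ≠ 0
    rw [X.p_s]; exact X.B_ne hf

lemma AT_B {T : Set ι} {j : ι} (hj : j ∉ T) : ∀ f ∈ X.AT T, f.comp (X.Gd j).s ∈ X.B := by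
  rintro _ (⟨i, hi, rfl⟩ | ⟨f, hf, rfl⟩)
  · rw [X.α_s]; exact X.b_mem (fun h => hj (h ▸ hi))
  · show (f.comp X.F.p).comp _ ∈ _
    rw [X.p_s]; exact hf

lemma B_AT {T : Set ι} {z : Form m} (hz : z ∈ Om X.B) : Pb X.F.p z ∈ Om (X.AT T) :=
  Pb_Om (fun _ hf => X.F.comp_p_ne (X.B_ne hf)) (fun _ hf => X.p_mem hf) hz

lemma BrB_AT {T : Set ι} {z : Form m} (hz : z ∈ Br X.B) : Pb X.F.p z ∈ Br (X.AT T) :=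
  Pb_Br (fun _ hf => X.F.comp_p_ne (X.B_ne hf)) (fun _ hf => X.p_mem hf) hz

lemma Pb_s_p (z : Form m) (j : ι) : Pb (X.Gd j).s (Pb X.F.p z) = z := by
  rw [← X.Gd_p j, (X.Gd j).Pb_s_p]

lemma Pb_p_reg (z : Form m) (j : ι) : RegF (X.Gd j).s (Pb X.F.p z) := by
  rw [← X.Gd_p j]; exact (X.Gd j).Pb_p_reg z

/-- elimination of all the finite poles -/
lemma Om_inter {z : Form (m+1)} (hz : z ∈ Om (X.AT Set.univ)) (h : ∀ j, z ∈ Om (X.AT {j}ᶜ)) : z ∈ Om X.pB := by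
  have key : ∀ T : Finset ι, z ∈ Om (X.AT (T : Set ι)) → z ∈ Om X.pB := by
    intro T
    induction T using Finset.induction_on with
    | empty => intro h; simpa [AT] using h
    | insert t T ht ih =>
      intro hz
      rw [Finset.coe_insert, AT_insert] at hz
      exact ih ((X.Gd t).Om_of_reg (X.AT_ne (by simpa using ht)) hz (Om_reg (X.AT_ne (by simp)) (h t)))
  exact key Finset.univ (by simpa using hz)

section conn
variable {κ : Type} [Fintype κ] (P : ι → Matrix κ κ ℂ)

lemma nab_YY (i : ι) {z : VF κ (m+1)} (hz : z ∈ pv ((X.Gd i).YY (X.AT {i}ᶜ) 0)) :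
    nab X.α P z ∈ pv ((X.Gd i).YY (X.AT {i}ᶜ) 0) := by
  refine nab_mem X.α P (fun z hz => FD.dd_YY0 hz) (fun j z hz => ?_) hz
  by_cases hij : j = i
  · subst hij
    have := FD.wlx_YY0 hz
    rwa [X.Gd_x] at this
  · exact FD.wl_YY0 (X.α_mem (by simpa using hij)) hz

lemma univ_eq (j : ι) : X.AT Set.univ = insert (X.Gd j).x (X.AT {j}ᶜ) := by
  rw [← X.AT_insert]; congr 1; ext i; simp; exact Classical.em _

lemma EigP {G : Set ℂ} (hs : Spc G X.α P) (j : ι) : EigIn G (P j) := by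
  obtain ⟨u, hu⟩ := exists_generic X.B_fin (fun f hf => X.B_ne hf)
  have := hs.hu (evT (X.Gd j).s u)
  have e : PU X.α P (evT (X.Gd j).s u) = P j := by
    have : ∀ i, (X.α i).ev (evT (X.Gd j).s u) = 0 ↔ i = j := by
      intro i
      rw [← Aff.comp_ev, X.α_s]
      constructor
      · intro h
        by_contra hne
        exact hu _ (X.b_mem hne) h
      · rintro rfl; simp [b]
    have e2 : (Finset.univ.filter fun i => (X.α i).ev (evT (X.Gd j).s u) = 0) = {j} := by
      ext i; rw [Finset.mem_filter, this]; simp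
    unfold PU
    rw [e2, Finset.sum_singleton]
  rwa [e] at this

lemma nab_split (j : ι) (z : VF κ (m+1)) : nab X.α P z =
    nab (fun i : {i // i ≠ j} => X.α i) (fun i => P i) z + cw (wl (X.Gd j).x) (mm (P j) z) := by
  rw [nab_apply, nab_apply, aa_apply, aa_apply, Fintype.sum_eq_add_sum_subtype_ne _ j, X.Gd_x]
  abel

/-- step (i): logarithmic poles along the sections -/
lemma step_i {G : Set ℂ} (hG : GoodG G) (hflat : Flat X.α P) (hs : Spc G X.α P) {y : VF κ (m+1)}
    (hy : y ∈ pv (Om (X.AT Set.univ))) (hny : nab X.α P y ∈ pv (Br (X.AT Set.univ))) (J : Finset ι) :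
    ∃ y' ∈ pv (Om (X.AT Set.univ)), ∀ j ∈ J, y - nab X.α P y' ∈ pv ((X.Gd j).YY (X.AT {j}ᶜ) 0) := by
  induction J using Finset.induction_on with
  | empty => exact ⟨0, zero_mem _, by simp⟩
  | insert j J hj ih =>
    obtain ⟨y', hy', h⟩ := ih
    have hα : ∀ i, X.α i ∈ X.AT Set.univ := fun i => X.α_mem (Set.mem_univ _)
    have hjc : j ∉ ({j}ᶜ : Set ι) := by simp
    have hBr : Br (X.AT Set.univ) ≤ (X.Gd j).YY (X.AT {j}ᶜ) 0 := by
      rw [X.univ_eq j]; exact FD.Br_le_YY0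
    have hE : ∀ (k : ℕ) (z : Form m), z ∈ Om X.B →
        (affK (X.Gd j).x ^ k)⁻¹ • Pb X.F.p z ∈ Om (X.AT {j}) := by
      intro k z hz
      refine Om_ksmul ?_ (X.B_AT hz)
      rw [← inv_pow, X.Gd_x]
      exact pow_mem (inv_mem (X.α_mem (Set.mem_singleton j))) k
    obtain ⟨t, ht, h1⟩ := FD.LR (F := X.Gd j) (A := X.AT {j}ᶜ) (X.AT_ne hjc)
      (α := fun i : {i // i ≠ j} => X.α i) (P := fun i => P i) (fun i => X.α_mem i.2) (P j) (nab X.α P)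
      (X.nab_split P j) (nab_nab X.α P hflat)
      (fun k hk => (X.EigP P hs j).isUnit (fun h => by have := hG.int k (by simpa using h); omega))
      ((pv (Om X.B)).map (cw (Pb X.F.p))) (pv (Om (X.AT {j})))
      (by
        rintro _ ⟨z, hz, rfl⟩
        exact pv_cw (fun z hz => X.B_AT hz) hz)
      (by
        intro g hg
        refine ⟨cw (Pb X.F.p) (cw (Pb (X.Gd j).s) g),
          ⟨_, pv_cw (fun z hz => Pb_Om (X.AT_ne hjc) (X.AT_B hjc) hz) hg, rfl⟩, fun k => ?_⟩
        exact X.Pb_s_p _ j)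
      (by
        rintro k _ ⟨δ, hδ, rfl⟩
        rw [mem_pv]
        intro i
        exact hE k _ (mem_pv.1 hδ i))
      (y := y - nab X.α P y')
      (by rw [← X.univ_eq]; exact sub_mem hy (nab_Om _ _ hα hy'))
      (by rw [map_sub, nab_nab _ _ hflat, sub_zero]; exact pv_mono hBr hny)
    refine ⟨y' + t, add_mem hy' (pv_mono (Om_mono (X.AT_mono (Set.subset_univ _))) ht), ?_⟩
    intro i hi
    rw [map_add, ← sub_sub]
    rcases Finset.mem_insert.1 hi with rfl | hi
    · exact h1
    · have hij : i ≠ j := fun h => hj (h ▸ hi)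
      refine sub_mem (h i hi) (X.nab_YY P i (pv_mono ((Om_mono (X.AT_mono ?_)).trans FD.Om_le_YY0) ht))
      rw [Set.singleton_subset_iff]
      exact fun h => hij h.symm

/-- step (i), conclusion -/
lemma step_i' {G : Set ℂ} (hG : GoodG G) (hflat : Flat X.α P) (hs : Spc G X.α P) {y : VF κ (m+1)}
    (hy : y ∈ pv (Om (X.AT Set.univ))) (hny : nab X.α P y ∈ pv (Br (X.AT Set.univ))) :
    ∃ y' ∈ pv (Om (X.AT Set.univ)), ∃ y0 ∈ (pv (Om X.pB) : Submodule ℂ (VF κ (m+1))),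
    ∃ r : ι → VF κ m, (∀ i, r i ∈ pv (Om X.B)) ∧
    y - nab X.α P y' = y0 + ∑ i, cw (wl (X.α i) ∘ₗ Pb X.F.p) (r i) := by
  obtain ⟨y', hy', h⟩ := X.step_i P hG hflat hs hy hny Finset.univ
  simp only [Finset.mem_univ, true_imp_iff, mem_pv] at h
  choose β hβ γ hγ e using fun j k => FD.mem_YY0.1 (h j k)
  have hjc : ∀ j, j ∉ ({j}ᶜ : Set ι) := by simp
  set r : ι → VF κ m := fun j => cw (Pb (X.Gd j).s) (γ j) with hr
  have hrB : ∀ i, r i ∈ pv (Om X.B) := fun i =>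
    pv_cw (fun z hz => Pb_Om (X.AT_ne (hjc i)) (X.AT_B (hjc i)) hz) (mem_pv.2 (hγ i))
  refine ⟨y', hy', y - nab X.α P y' - ∑ i, cw (wl (X.α i) ∘ₗ Pb X.F.p) (r i), ?_, r, hrB, by abel⟩
  rw [mem_pv]
  intro k
  have e0 : (y - nab X.α P y' - ∑ i, cw (wl (X.α i) ∘ₗ Pb X.F.p) (r i)) k =
      (y - nab X.α P y') k - ∑ i, wl (X.α i) (Pb X.F.p (r i k)) := by
    simp [Finset.sum_apply]
  rw [e0]
  have hterm : ∀ {T : Set ι} (i : ι), i ∈ T → wl (X.α i) (Pb X.F.p (r i k)) ∈ Om (X.AT T) :=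
    fun i hi => Om_wl (X.α_mem hi) (X.B_AT (mem_pv.1 (hrB i) k))
  refine X.Om_inter ?_ ?_
  · exact sub_mem (mem_pv.1 (sub_mem hy (nab_Om _ _ (fun i => X.α_mem (Set.mem_univ _)) hy')) k)
      (Submodule.sum_mem _ fun i _ => hterm i (Set.mem_univ _))
  · intro j
    rw [e j k, Fintype.sum_eq_add_sum_subtype_ne _ j]
    have e1 : β j k + wl (X.Gd j).x (γ j k) - (wl (X.α j) (Pb X.F.p (r j k)) +
        ∑ i : {i // i ≠ j}, wl (X.α i) (Pb X.F.p (r i k))) = β j k +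
        wl (X.Gd j).x (γ j k - Pb X.F.p (r j k)) - ∑ i : {i // i ≠ j}, wl (X.α i) (Pb X.F.p (r i k)) := by
      rw [map_sub, X.Gd_x]; abel
    rw [e1]
    refine sub_mem (add_mem (hβ j k) ((X.Gd j).wl_of_Pb (X.AT_ne (hjc j)) (sub_mem (hγ j k)
      (X.B_AT (mem_pv.1 (hrB j) k))) ?_)) (Submodule.sum_mem _ fun i _ => hterm i.1 i.2)
    rw [map_sub, X.Pb_s_p]
    simp [hr]

end conn
end Fib
end RV

end

noncomputable section
namespace RV

lemma RegF.sum {a b : ℕ} {t : Fin a → Aff b} {ι : Type*} (s : Finset ι) {z : ι → Form a}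
    (h : ∀ i ∈ s, RegF t (z i)) : RegF t (∑ i ∈ s, z i) := by
  intro x
  rw [LinearMap.sum_apply]
  exact Subalgebra.sum_mem _ fun i hi => h i hi x

namespace Fib
variable {m : ℕ} {ι : Type} [Fintype ι] (X : Fib m ι)

/-- uniqueness of the polar parts -/
lemma res_uniq {z : Form (m+1)} (hz : ∀ j, RegF (X.Gd j).s z) (r : ι → Form m)
    (h : z + ∑ i, wl (X.α i) (Pb X.F.p (r i)) = 0) : (∀ i, r i = 0) ∧ z = 0 := by
  have h1 : ∀ i, r i = 0 := by
    intro j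
    rw [Fintype.sum_eq_add_sum_subtype_ne _ j] at h
    have := (X.Gd j).res_zero (A := z + ∑ i : {i // i ≠ j}, wl (X.α i) (Pb X.F.p (r i)))
      (B := Pb X.F.p (r j)) ((hz j).add (RegF.sum _ fun i _ => (X.Pb_p_reg _ j).wl
        (by rw [X.α_s]; exact X.b_ne i.2))) (X.Pb_p_reg _ j) (by rw [X.Gd_x, ← h]; abel)
    rwa [X.Pb_s_p] at this
  refine ⟨h1, ?_⟩
  simpa [h1] using h

/-- forms with logarithmic poles and coefficients from `M` -/
def X0 (M : Submodule ℂ (Form m)) : Submodule ℂ (Form (m+1)) where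
  carrier := {z | ∃ β ∈ M, ∃ r : ι → Form m, (∀ i, r i ∈ M) ∧
    z = Pb X.F.p β + ∑ i, wl (X.α i) (Pb X.F.p (r i))}
  zero_mem' := ⟨0, zero_mem _, 0, fun _ => zero_mem _, by simp⟩
  add_mem' := by
    rintro _ _ ⟨β, hβ, r, hr, rfl⟩ ⟨β', hβ', r', hr', rfl⟩
    refine ⟨β + β', add_mem hβ hβ', r + r', fun i => add_mem (hr i) (hr' i), ?_⟩
    simp only [Pi.add_apply, map_add, Finset.sum_add_distrib]; abel
  smul_mem' := by
    rintro c _ ⟨β, hβ, r, hr, rfl⟩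
    refine ⟨c • β, M.smul_mem _ hβ, c • r, fun i => M.smul_mem _ (hr i), ?_⟩
    simp only [Pi.smul_apply, map_smul, smul_add, Finset.smul_sum]

lemma mem_X0 {M : Submodule ℂ (Form m)} {z : Form (m+1)} : z ∈ X.X0 M ↔ ∃ β ∈ M, ∃ r : ι → Form m,
    (∀ i, r i ∈ M) ∧ z = Pb X.F.p β + ∑ i, wl (X.α i) (Pb X.F.p (r i)) := Iff.rfl

lemma p_X0 {M : Submodule ℂ (Form m)} {β : Form m} (h : β ∈ M) : Pb X.F.p β ∈ X.X0 M :=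
  ⟨β, h, 0, fun _ => zero_mem _, by simp⟩

lemma wp_X0 {M : Submodule ℂ (Form m)} {β : Form m} (h : β ∈ M) (i : ι) :
    wl (X.α i) (Pb X.F.p β) ∈ X.X0 M := by
  refine ⟨0, zero_mem _, Pi.single i β, fun j => ?_, ?_⟩
  · by_cases hj : j = i
    · subst hj; simpa using h
    · rw [Pi.single_eq_of_ne hj]; exact zero_mem _
  · rw [map_zero, zero_add, Finset.sum_eq_single i]
    · simp
    · intro j _ hj; rw [Pi.single_eq_of_ne hj]; simp
    · simp

lemma X0_mono {M N : Submodule ℂ (Form m)} (h : M ≤ N) : X.X0 M ≤ X.X0 N := by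
  rintro _ ⟨β, hβ, r, hr, rfl⟩
  exact ⟨β, h hβ, r, fun i => h (hr i), rfl⟩

lemma dd_p (z : Form m) : dd (Pb X.F.p z) = Pb X.F.p (dd z) := dd_Pb _ (X.F.p_regF z)

lemma dd_X0 {M : Submodule ℂ (Form m)} (hM : ∀ z ∈ M, dd z ∈ M) {z} (h : z ∈ X.X0 M) : dd z ∈ X.X0 M := by
  obtain ⟨β, hβ, r, hr, rfl⟩ := h
  rw [map_add, map_sum, X.dd_p]
  refine add_mem (X.p_X0 (hM _ hβ)) (Submodule.sum_mem _ fun i _ => ?_)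
  rw [dd_wl, X.dd_p]
  exact neg_mem (X.wp_X0 (hM _ (hr i)) i)

lemma wl_p {i j : ι} (z : Form m) :
    wl ((X.b i j).comp X.F.p) (Pb X.F.p z) = Pb X.F.p (wl (X.b i j) z) := by
  by_cases h : i = j
  · subst h
    have : X.b i i = (0, 0) := sub_self _
    have h2 : ((0:ℂ), (0 : Module.Dual ℂ (Fin m → ℂ))) = (0 : Aff m) := rfl
    rw [this, wl_const, map_zero, h2, comp_zero]
    exact wl_const 0 _
  · rw [Pb_wl _ (X.F.p_regF z) (X.F.comp_p_ne (X.b_ne h))]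

lemma arnold {l : ℕ} {a b c : Aff l} (ha : a ≠ 0) (hc : c ≠ 0) (h : a = b + c) (z : Form l) :
    wl a (wl c z) = wl b (wl c z) - wl b (wl a z) := by
  by_cases hb : b = 0
  · subst hb
    have : a = c := by rw [h, zero_add]
    have h0 : ∀ z : Form l, wl (0 : Aff l) z = 0 := fun z => wl_const 0 z
    rw [this, wl_wl_self, h0]; simp
  have ka := affK_ne ha
  have kb := affK_ne hb
  have kc := affK_ne hc
  have e : affK a = affK b + affK c := by rw [h, map_add]
  have e2 : a.2 = b.2 + c.2 := by rw [h]; rfl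
  have hcb : EE c.2 (EE b.2 z) = - EE b.2 (EE c.2 z) := EE_comm _ _ _
  simp only [wl_def, EE_ksmul, e2, EE_add, map_add, EE_EE_self, add_zero, zero_add, smul_smul]
  rw [← sub_smul]
  congr 1
  rw [e] at ka
  rw [e]
  field_simp
  ring

lemma arn (i j : ι) (z : Form m) : wl (X.α i) (wl (X.α j) (Pb X.F.p z)) =
    - wl (X.α j) (Pb X.F.p (wl (X.b i j) z)) + wl (X.α i) (Pb X.F.p (wl (X.b i j) z)) := by
  have hne : ∀ i, X.α i ≠ 0 := by
    intro i h; have := X.hv i; rw [h] at this; simp at this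
  rw [arnold (hne i) (hne j) (X.α_sub i j), wl_comm, wl_comm _ (X.α i), X.wl_p]
  abel

lemma wl_X0 {M : Submodule ℂ (Form m)} (hM : ∀ i j, ∀ z ∈ M, wl (X.b i j) z ∈ M) {z} (h : z ∈ X.X0 M)
    (i : ι) : wl (X.α i) z ∈ X.X0 M := by
  obtain ⟨β, hβ, r, hr, rfl⟩ := h
  rw [map_add, map_sum]
  refine add_mem (X.wp_X0 hβ i) (Submodule.sum_mem _ fun j _ => ?_)
  rw [X.arn]
  exact add_mem (neg_mem (X.wp_X0 (hM _ _ _ (hr j)) _)) (X.wp_X0 (hM _ _ _ (hr j)) _)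

lemma wlb_Om {i j : ι} {z : Form m} (hz : z ∈ Om X.B) : wl (X.b i j) z ∈ Om X.B := by
  by_cases h : i = j
  · subst h
    have : X.b i i = (0, 0) := sub_self _
    rw [this, wl_const]; exact zero_mem _
  · exact Om_wl (X.b_mem h) hz

lemma wlb_Br {i j : ι} {z : Form m} (hz : z ∈ Br X.B) : wl (X.b i j) z ∈ Br X.B := by
  by_cases h : i = j
  · subst h
    have : X.b i i = (0, 0) := sub_self _
    rw [this, wl_const]; exact zero_mem _
  · exact Br_wl (X.b_mem h) hz

lemma Br_X0 : Br (X.AT Set.univ) = X.X0 (Br X.B) := by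
  apply le_antisymm
  · refine Br_le ?_ ?_
    · rw [← Pb_one X.F.p]; exact X.p_X0 (Br_one _)
    · rintro _ (⟨i, hi, rfl⟩ | ⟨f, hf, rfl⟩) z _ hz
      · exact X.wl_X0 (fun i j z hz => X.wlb_Br hz) hz i
      · obtain ⟨β, hβ, r, hr, rfl⟩ := hz
        show wl (f.comp X.F.p) _ ∈ _
        have e : ∀ z, wl (f.comp X.F.p) (Pb X.F.p z) = Pb X.F.p (wl f z) := fun z =>
          (Pb_wl _ (X.F.p_regF z) (X.F.comp_p_ne (X.B_ne hf))).symm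
        rw [map_add, map_sum, e]
        refine add_mem (X.p_X0 (Br_wl hf hβ)) (Submodule.sum_mem _ fun i _ => ?_)
        rw [wl_comm, e]
        exact neg_mem (X.wp_X0 (Br_wl hf (hr i)) i)
  · rintro _ ⟨β, hβ, r, hr, rfl⟩
    exact add_mem (X.BrB_AT hβ) (Submodule.sum_mem _ fun i _ => Br_wl (X.α_mem (Set.mem_univ _)) (X.BrB_AT (hr i)))

/-! ### polynomial growth along the fibres -/

def g1 (k : ℕ) : Form m →ₗ[ℂ] Form (m+1) where
  toFun z := affK X.F.x ^ k • Pb X.F.p z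
  map_add' a b := by rw [map_add, smul_add]
  map_smul' c a := by rw [map_smul, smul_comm]; rfl
def g2 (k : ℕ) : Form m →ₗ[ℂ] Form (m+1) := EE X.F.x.2 ∘ₗ X.g1 k

lemma g1_def (k z) : X.g1 k z = affK X.F.x ^ k • Pb X.F.p z := rfl
lemma g2_def (k z) : X.g2 k z = EE X.F.x.2 (X.g1 k z) := rfl
lemma g1_zero (z) : X.g1 0 z = Pb X.F.p z := by rw [g1_def, pow_zero, one_smul]
lemma g1_succ (k z) : X.g1 (k+1) z = affK X.F.x • X.g1 k z := by rw [g1_def, g1_def, smul_smul, pow_succ']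

lemma dd_g1 (k z) : dd (X.g1 k z) = (k : ℂ) • X.g2 (k-1) z + X.g1 k (dd z) := by
  induction k with
  | zero => simp [g1_zero, dd_p]
  | succ k ih =>
    rw [g1_succ, dd_aff_smul, ih, X.g1_succ k (dd z), ← g2_def, Nat.add_sub_cancel, smul_add]
    have : affK X.F.x • ((k:ℂ) • X.g2 (k-1) z) = (k : ℂ) • X.g2 k z := by
      cases k with
      | zero => simp
      | succ k => rw [Nat.add_sub_cancel, smul_comm, g2_def, g2_def, g1_succ, EE_ksmul]
    rw [this]; push_cast; rw [add_smul, one_smul]; abel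

lemma dd_g2 (k z) : dd (X.g2 k z) = - X.g2 k (dd z) := by
  rw [g2_def, dd_EE, dd_g1, map_add, map_smul, g2_def, EE_EE_self, smul_zero, zero_add, g2_def]

lemma II_g1 (k z) : II X.F.v (X.g1 k z) = 0 := by rw [g1_def, II_ksmul, X.F.II_Pb_p, smul_zero]
lemma II_g2 (k z) : II X.F.v (X.g2 k z) = X.g1 k z := by
  rw [g2_def, II_EE, X.F.hxv, II_g1]; simp

/-- Lie derivative along the fibre -/
def Lv : Form (m+1) →ₗ[ℂ] Form (m+1) := dd ∘ₗ II X.F.v + II X.F.v ∘ₗ dd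
lemma Lv_apply (z) : X.Lv z = dd (II X.F.v z) + II X.F.v (dd z) := rfl

lemma Lv_g1 (k z) : X.Lv (X.g1 k z) = (k : ℂ) • X.g1 (k-1) z := by
  rw [Lv_apply, II_g1, dd_g1, map_add, map_smul, II_g2, II_g1]; simp
lemma Lv_g2 (k z) : X.Lv (X.g2 k z) = (k : ℂ) • X.g2 (k-1) z := by
  rw [Lv_apply, II_g2, dd_g2, dd_g1, map_neg, II_g2]; abel

lemma Lvk (k i : ℕ) : ∃ c : ℂ, c ≠ 0 ∧ ∀ z, (X.Lv ^ k) (X.g1 (k+i) z) = c • X.g1 i z ∧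
    (X.Lv ^ k) (X.g2 (k+i) z) = c • X.g2 i z := by
  induction k with
  | zero => exact ⟨1, one_ne_zero, by simp⟩
  | succ k ih =>
    obtain ⟨c, hc, h⟩ := ih
    refine ⟨((k+1+i : ℕ) : ℂ) * c, mul_ne_zero (by exact_mod_cast (by omega)) hc, fun z => ?_⟩
    rw [pow_succ, Module.End.mul_apply, Module.End.mul_apply, Lv_g1, Lv_g2, map_smul, map_smul,
      show k+1+i-1 = k+i by omega, (h z).1, (h z).2, smul_smul, smul_smul]
    exact ⟨rfl, rfl⟩

/-- filtration by the order of growth -/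
def XX : ℕ → Submodule ℂ (Form (m+1))
  | 0 => X.X0 (Om X.B)
  | k+1 => XX k ⊔ ((Om X.B).map (X.g1 (k+1)) ⊔ (Om X.B).map (X.g2 k))

lemma XX_le (k) : X.XX k ≤ X.XX (k+1) := le_sup_left
lemma XX_mono : Monotone X.XX := monotone_nat_of_le_succ X.XX_le
lemma mem_XX {k z} : z ∈ X.XX (k+1) ↔ ∃ x ∈ X.XX k, ∃ β ∈ Om X.B, ∃ γ ∈ Om X.B,
    z = x + (X.g1 (k+1) β + X.g2 k γ) := by
  rw [XX, Submodule.mem_sup]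
  constructor
  · rintro ⟨x, hx, y, hy, rfl⟩
    obtain ⟨_, ⟨β, hβ, rfl⟩, _, ⟨γ, hγ, rfl⟩, rfl⟩ := Submodule.mem_sup.1 hy
    exact ⟨x, hx, β, hβ, γ, hγ, rfl⟩
  · rintro ⟨x, hx, β, hβ, γ, hγ, rfl⟩
    exact ⟨x, hx, _, Submodule.add_mem_sup ⟨β, hβ, rfl⟩ ⟨γ, hγ, rfl⟩, rfl⟩

lemma g1_XX {k z} (hz : z ∈ Om X.B) : X.g1 k z ∈ X.XX k := by
  cases k with
  | zero => rw [g1_zero]; exact X.p_X0 hz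
  | succ k => exact X.mem_XX.2 ⟨0, zero_mem _, z, hz, 0, zero_mem _, by simp⟩
lemma g2_XX {k z} (hz : z ∈ Om X.B) : X.g2 k z ∈ X.XX (k+1) :=
  X.mem_XX.2 ⟨0, zero_mem _, 0, zero_mem _, z, hz, by simp⟩

lemma affK_x (i : ι) : affK X.F.x = affK (X.α i) - pb X.F.p (affK (X.ps i)) := by
  rw [pb_affK, X.α_eq i, map_add]; abel
lemma x2 (i : ι) : X.F.x.2 = (X.α i).2 - (X.ps i).2 ∘ₗ linT X.F.p := by
  have : (X.α i).2 = (X.ps i).2 ∘ₗ linT X.F.p + X.F.x.2 := by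
    conv_lhs => rw [X.α_eq i]
    rfl
  rw [this]; abel

lemma EE_g1 (θ) (k z) : EE (θ ∘ₗ linT X.F.p) (X.g1 k z) = X.g1 k (EE θ z) := by
  rw [g1_def, EE_ksmul, ← Pb_EE]; rfl

lemma α_ne (i : ι) : X.α i ≠ 0 := by
  intro h; have := X.hv i; rw [h] at this; simp at this

lemma wl_g1 (i k z) : wl (X.α i) (X.g1 (k+1) z) =
    X.g2 k z + X.g1 k (EE (X.ps i).2 z) - wl (X.α i) (X.g1 k (affK (X.ps i) • z)) := by
  have h1 : X.g1 k (affK (X.ps i) • z) = pb X.F.p (affK (X.ps i)) • X.g1 k z := by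
    rw [g1_def, Pb_ksmul _ (X.F.p_reg _) (X.F.p_regF _), smul_comm, g1_def]
  have h2 : affK (X.α i) • wl (X.α i) (X.g1 k z) = X.g2 k z + X.g1 k (EE (X.ps i).2 z) := by
    rw [wl_def, smul_smul, mul_inv_cancel₀ (affK_ne (X.α_ne i)), one_smul, g2_def, ← EE_g1, ← EE_add]
    congr 2
    rw [X.x2 i]; abel
  rw [g1_succ, h1, wl_ksmul, wl_ksmul, ← h2, X.affK_x i]
  exact LinearMap.ext fun x => sub_mul _ _ _

lemma wl_g2 (i k z) : wl (X.α i) (X.g2 k z) = - wl (X.α i) (X.g1 k (EE (X.ps i).2 z)) := by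
  have h : X.g2 k z = EE (X.α i).2 (X.g1 k z) - X.g1 k (EE (X.ps i).2 z) := by
    rw [g2_def, X.x2 i, ← EE_g1, eq_sub_iff_add_eq, ← EE_add]; congr 2; abel
  rw [h, map_sub, wl_EE, wl_def, EE_ksmul, EE_EE_self]; simp

lemma wlg1_XX (i k) {z} (hz : z ∈ Om X.B) : wl (X.α i) (X.g1 k z) ∈ X.XX k := by
  induction k generalizing z with
  | zero => rw [g1_zero]; exact X.wp_X0 hz i
  | succ k ih =>
    rw [wl_g1]
    exact sub_mem (add_mem (X.g2_XX hz) (X.XX_le _ (X.g1_XX (Om_EE _ hz))))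
      (X.XX_le _ (ih (Om_ksmul (affK_mem _ _) hz)))

lemma wlg1_XX' (i k) {z} (hz : z ∈ Om X.B) : wl (X.α i) (X.g1 (k+1) z) - X.g2 k z ∈ X.XX k := by
  rw [wl_g1]
  have := sub_mem (X.g1_XX (k := k) (Om_EE (X.ps i).2 hz)) (X.wlg1_XX i k (Om_ksmul (affK_mem _ (X.ps i)) hz))
  convert this using 1; abel

lemma wlg2_XX (i k) {z} (hz : z ∈ Om X.B) : wl (X.α i) (X.g2 k z) ∈ X.XX k := by
  rw [wl_g2]; exact neg_mem (X.wlg1_XX i k (Om_EE _ hz))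

lemma wl_XX (i k) {z} (hz : z ∈ X.XX k) : wl (X.α i) z ∈ X.XX k := by
  induction k generalizing z with
  | zero => exact X.wl_X0 (fun i j z hz => X.wlb_Om hz) hz i
  | succ k ih =>
    obtain ⟨x, hx, β, hβ, γ, hγ, rfl⟩ := X.mem_XX.1 hz
    rw [map_add, map_add]
    exact add_mem (X.XX_le _ (ih hx)) (add_mem (X.wlg1_XX i _ hβ) (X.XX_le _ (X.wlg2_XX i k hγ)))

lemma dd_XX (k) {z} (hz : z ∈ X.XX k) : dd z ∈ X.XX k := by
  induction k generalizing z with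
  | zero => exact X.dd_X0 (fun z hz => Om_dd hz) hz
  | succ k ih =>
    obtain ⟨x, hx, β, hβ, γ, hγ, rfl⟩ := X.mem_XX.1 hz
    rw [map_add, map_add, dd_g1, dd_g2]
    exact add_mem (X.XX_le _ (ih hx)) (add_mem (add_mem (Submodule.smul_mem _ _ (X.g2_XX hβ))
      (X.g1_XX (Om_dd hβ))) (neg_mem (X.g2_XX (Om_dd hγ))))

lemma reg_g1 (j k z) : RegF (X.Gd j).s (X.g1 k z) :=
  (X.Pb_p_reg z j).ksmul (pow_mem (affK_reg _ _) _)
lemma reg_g2 (j k z) : RegF (X.Gd j).s (X.g2 k z) := (X.reg_g1 j k z).EE _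

lemma XX_split (k) {x} (hx : x ∈ X.XX k) : ∃ (x' : Form (m+1)) (r : ι → Form m), x = x' + ∑ i, wl (X.α i) (Pb X.F.p (r i)) ∧
    (∀ j, RegF (X.Gd j).s x') ∧ ∃ b, (X.Lv ^ k) x' = Pb X.F.p b := by
  induction k generalizing x with
  | zero =>
    obtain ⟨β, hβ, r, hr, rfl⟩ := hx
    exact ⟨_, r, rfl, fun j => X.Pb_p_reg _ j, β, rfl⟩
  | succ k ih =>
    obtain ⟨x, hx1, β, hβ, γ, hγ, rfl⟩ := X.mem_XX.1 hx
    obtain ⟨x', r, rfl, hr, b, hb⟩ := ih hx1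
    refine ⟨x' + (X.g1 (k+1) β + X.g2 k γ), r, by abel, fun j => (hr j).add ((X.reg_g1 _ _ _).add (X.reg_g2 _ _ _)), ?_⟩
    obtain ⟨c, hc, h⟩ := X.Lvk k 0
    obtain ⟨c', hc', h'⟩ := X.Lvk (k+1) 0
    refine ⟨c' • β, ?_⟩
    have e1 : (X.Lv ^ (k+1)) x' = 0 := by
      rw [pow_succ', Module.End.mul_apply, hb, ← g1_zero, Lv_g1]; simp
    have e2 : (X.Lv ^ (k+1)) (X.g2 k γ) = 0 := by
      have := (h γ).2
      rw [add_zero] at this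
      rw [pow_succ', Module.End.mul_apply, this, map_smul, Lv_g2]; simp
    have e3 := (h' β).1
    rw [add_zero] at e3
    rw [map_add, map_add, e1, e2, e3, g1_zero, map_smul]; abel

/-- uniqueness of the leading coefficients -/
lemma lead {k} {x} (hx : x ∈ X.XX k) {b c : Form m} (h : X.g1 (k+1) b + X.g2 k c + x = 0) : b = 0 ∧ c = 0 := by
  obtain ⟨x', r, rfl, hr, b', hb'⟩ := X.XX_split k hx
  rw [← add_assoc] at h
  have h0 := (X.res_uniq (fun j => ((X.reg_g1 j _ _).add (X.reg_g2 j _ _)).add (hr j)) r h).2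
  obtain ⟨c0, hc0, h1⟩ := X.Lvk k 0
  obtain ⟨c1, hc1, h2⟩ := X.Lvk k 1
  have h3 := congrArg (X.Lv ^ k) h0
  have h4 := (h1 c).2
  rw [add_zero] at h4
  rw [map_add, map_add, (h2 b).1, h4, hb', map_zero] at h3
  have h5 := congrArg X.Lv h3
  rw [map_add, map_add, map_smul, map_smul, Lv_g1, Lv_g2, ← g1_zero, Lv_g1] at h5
  simp only [Nat.cast_zero, zero_smul, smul_zero, add_zero, Nat.cast_one, one_smul, Nat.sub_self, map_zero] at h5
  rw [g1_zero, ← map_smul] at h5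
  have hb : b = 0 := by
    have := X.F.Pb_p_inj (h5.trans (map_zero _).symm)
    exact (smul_eq_zero.1 this).resolve_left hc1
  refine ⟨hb, ?_⟩
  have h6 := congrArg (II X.F.v) h3
  rw [hb, map_zero, smul_zero, zero_add, map_add, map_smul, II_g2, ← g1_zero, II_g1, add_zero, map_zero,
    g1_zero, ← map_smul] at h6
  have := X.F.Pb_p_inj (h6.trans (map_zero _).symm)
  exact (smul_eq_zero.1 this).resolve_left hc0

end Fib
end RV

end

noncomputable section
namespace RV
namespace Fib
variable {m : ℕ} {ι : Type} [Fintype ι] (X : Fib m ι)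

def ph : KK m →+* KK (m+1) where
  toFun := pb X.F.p
  map_one' := pb_one _
  map_mul' x y := pb_mul _ (X.F.p_reg x) (X.F.p_reg y)
  map_zero' := map_zero _
  map_add' x y := map_add _ x y

lemma ph_apply (x) : X.ph x = pb X.F.p x := rfl

lemma RA_poly {x} (hx : x ∈ RA X.pB) : ∃ c : Polynomial (KK m), (∀ j, c.coeff j ∈ RA X.B) ∧
    c.eval₂ X.ph (affK X.F.x) = x := by
  have hC : ∀ a ∈ RA X.B, ∀ j, (Polynomial.C a).coeff j ∈ RA X.B := by
    intro a ha j
    rw [Polynomial.coeff_C]; split_ifs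
    · exact ha
    · exact zero_mem _
  have hadd : ∀ c d : Polynomial (KK m), (∀ j, c.coeff j ∈ RA X.B) → (∀ j, d.coeff j ∈ RA X.B) →
      ∀ j, (c + d).coeff j ∈ RA X.B := fun c d hc hd j => by
    rw [Polynomial.coeff_add]; exact add_mem (hc j) (hd j)
  have hmul : ∀ c d : Polynomial (KK m), (∀ j, c.coeff j ∈ RA X.B) → (∀ j, d.coeff j ∈ RA X.B) →
      ∀ j, (c * d).coeff j ∈ RA X.B := fun c d hc hd j => by
    rw [Polynomial.coeff_mul]; exact Subalgebra.sum_mem _ fun p _ => mul_mem (hc _) (hd _)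
  induction hx using RA_induction with
  | h1 f =>
    refine ⟨Polynomial.C (affK (f.comp X.F.s)) + Polynomial.C (algebraMap ℂ _ (f.2 X.F.v)) * Polynomial.X,
      hadd _ _ (hC _ (affK_mem _ _)) (hmul _ _ (hC _ (Subalgebra.algebraMap_mem _ _)) ?_), ?_⟩
    · intro j
      rw [Polynomial.coeff_X]; split_ifs
      · exact one_mem _
      · exact zero_mem _
    · rw [Polynomial.eval₂_add, Polynomial.eval₂_mul, Polynomial.eval₂_C, Polynomial.eval₂_C, Polynomial.eval₂_X,
        ph_apply, ph_apply, pb_algebraMap, pb_affK]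
      conv_rhs => rw [X.F.decomp f, map_add, map_smul, Algebra.smul_def]
  | h2 a ha =>
    obtain ⟨f, hf, rfl⟩ := ha
    refine ⟨Polynomial.C (affK f)⁻¹, hC _ (inv_mem hf), ?_⟩
    rw [Polynomial.eval₂_C, map_inv₀, ph_apply, pb_affK]
  | hc c => exact ⟨Polynomial.C (algebraMap ℂ _ c), hC _ (Subalgebra.algebraMap_mem _ _), by
      rw [Polynomial.eval₂_C, ph_apply, pb_algebraMap]⟩
  | hadd x y _ _ hx hy =>
    obtain ⟨c, hc, rfl⟩ := hx
    obtain ⟨d, hd, rfl⟩ := hy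
    exact ⟨c + d, hadd _ _ hc hd, Polynomial.eval₂_add _ _⟩
  | hmul x y _ _ hx hy =>
    obtain ⟨c, hc, rfl⟩ := hx
    obtain ⟨d, hd, rfl⟩ := hy
    exact ⟨c * d, hmul _ _ hc hd, Polynomial.eval₂_mul _ _⟩

lemma Om_poly0 {w} (hw : w ∈ Om X.pB) (h0 : II X.F.v w = 0) : ∃ (N : ℕ) (η : ℕ → Form m),
    (∀ j, η j ∈ Om X.B) ∧ w = ∑ j ∈ Finset.range N, X.g1 j (η j) := by
  have e : ∀ x, w (ExteriorAlgebra.map (linT X.F.s) (ExteriorAlgebra.map (linT X.F.p) x)) = w x := by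
    intro x
    obtain ⟨y, hy⟩ := X.F.map_sub_mem x
    have := congrArg (fun z : Form (m+1) => z y) h0
    have h1 : w (ExteriorAlgebra.ι ℂ X.F.v * y) = 0 := this
    rw [← hy, map_sub, sub_eq_zero, ← ExteriorAlgebra.map_comp_map] at h1
    exact h1
  let bs := (Pi.basisFun ℂ (Fin m)).ExteriorAlgebra
  choose c hc hce using fun S => X.RA_poly (mem_Om.1 hw (ExteriorAlgebra.map (linT X.F.s) (bs S)))
  let N := Finset.univ.sup fun S => (c S).natDegree + 1
  let η : ℕ → Form m := fun j => bs.constr ℂ fun S => (c S).coeff j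
  have hη : ∀ j S, η j (bs S) = (c S).coeff j := fun j S => bs.constr_basis _ _ _
  refine ⟨N, η, fun j => mem_Om.2 fun x => ?_, ?_⟩
  · induction bs.mem_span x using Submodule.span_induction with
    | mem x h => obtain ⟨S, rfl⟩ := h; rw [hη]; exact hc S j
    | zero => rw [map_zero]; exact zero_mem _
    | add x y _ _ hx hy => rw [map_add]; exact add_mem hx hy
    | smul a x _ hx => rw [map_smul]; exact Subalgebra.smul_mem _ hx a
  · have key : w ∘ₗ (ExteriorAlgebra.map (linT X.F.s)).toLinearMap =
        ∑ j ∈ Finset.range N, (affK X.F.x ^ j) • (pb X.F.p ∘ₗ η j) := by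
      refine bs.ext fun S => ?_
      rw [LinearMap.sum_apply]
      show w (ExteriorAlgebra.map (linT X.F.s) (bs S)) = ∑ j ∈ Finset.range N, (affK X.F.x ^ j) * (pb X.F.p (η j (bs S)))
      rw [← hce S, Polynomial.eval₂_eq_sum_range' (n := N)]
      · refine Finset.sum_congr rfl fun j _ => ?_
        rw [hη, mul_comm]; rfl
      · exact Nat.lt_of_succ_le (Finset.le_sup (f := fun S => (c S).natDegree + 1) (Finset.mem_univ S))
    refine LinearMap.ext fun x => ?_
    rw [← e x]
    have := congrArg (fun z => z (ExteriorAlgebra.map (linT X.F.p) x)) key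
    refine this.trans ?_
    simp only [LinearMap.sum_apply]
    rfl

lemma Om_poly {z} (hz : z ∈ Om X.pB) : ∃ k, z ∈ X.XX k := by
  have h1 : II X.F.v z ∈ Om X.pB := Om_II _ hz
  have h11 : II X.F.v (II X.F.v z) = 0 := by
    refine LinearMap.ext fun x => ?_
    show z (ExteriorAlgebra.ι ℂ X.F.v * (ExteriorAlgebra.ι ℂ X.F.v * x)) = 0
    rw [← mul_assoc, ExteriorAlgebra.ι_sq_zero, zero_mul, map_zero]
  obtain ⟨N, η, hη, e⟩ := X.Om_poly0 h1 h11
  obtain ⟨N', η', hη', e'⟩ := X.Om_poly0 (w := z - EE X.F.x.2 (II X.F.v z)) (sub_mem hz (Om_EE _ h1))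
    (by rw [map_sub, II_EE, X.F.hxv, h11, map_zero, sub_zero, one_smul, sub_self])
  have e2 : z = EE X.F.x.2 (II X.F.v z) + (z - EE X.F.x.2 (II X.F.v z)) := by abel
  refine ⟨N + N', ?_⟩
  rw [e2, e', e, map_sum]
  refine add_mem (Submodule.sum_mem _ fun j hj => ?_) (Submodule.sum_mem _ fun j hj => ?_)
  · exact X.XX_mono (by have := Finset.mem_range.1 hj; omega) (X.g2_XX (hη j))
  · exact X.XX_mono (by have := Finset.mem_range.1 hj; omega) (X.g1_XX (hη' j))

section conn
variable {κ : Type} [Fintype κ] (P : ι → Matrix κ κ ℂ)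

lemma nab_g1 (k : ℕ) {β : VF κ m} (hβ : β ∈ pv (Om X.B)) :
    nab X.α P (cw (X.g1 (k+1)) β) - (cw (X.g1 (k+1)) (cw dd β) +
      cw (X.g2 k) (mm (∑ i, P i + ((k+1 : ℕ) : ℂ) • 1) β)) ∈ pv (X.XX k) := by
  have e : nab X.α P (cw (X.g1 (k+1)) β) - (cw (X.g1 (k+1)) (cw dd β) +
      cw (X.g2 k) (mm (∑ i, P i + ((k+1 : ℕ) : ℂ) • 1) β)) =
      ∑ i, cw (wl (X.α i) ∘ₗ X.g1 (k+1) - X.g2 k) (mm (P i) β) := by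
    have e1 : cw dd (cw (X.g1 (k+1)) β) = cw (X.g1 (k+1)) (cw dd β) + ((k+1 : ℕ) : ℂ) • cw (X.g2 k) β := by
      funext a
      show dd (X.g1 (k+1) (β a)) = _
      rw [dd_g1]; exact add_comm _ _
    have e2 : ∀ i, cw (wl (X.α i)) (mm (P i) (cw (X.g1 (k+1)) β)) =
        cw (wl (X.α i) ∘ₗ X.g1 (k+1) - X.g2 k) (mm (P i) β) + cw (X.g2 k) (mm (P i) β) := by
      intro i
      rw [mm_cw]
      funext a
      simp [cw_apply]
    rw [nab_apply, aa_apply, e1, Finset.sum_congr rfl fun i _ => e2 i, Finset.sum_add_distrib, mm_add, mm_sum,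
      mm_smul, mm_one, map_add, map_sum, map_smul]
    abel
  rw [e]
  refine Submodule.sum_mem _ fun i _ => pv_cw (fun z hz => X.wlg1_XX' i k hz) (pv_mm _ hβ)

lemma nab_g2 (k : ℕ) {γ : VF κ m} (hγ : γ ∈ pv (Om X.B)) :
    nab X.α P (cw (X.g2 k) γ) + cw (X.g2 k) (cw dd γ) ∈ pv (X.XX k) := by
  have e1 : cw dd (cw (X.g2 k) γ) = - cw (X.g2 k) (cw dd γ) := by
    funext a
    show dd (X.g2 k (γ a)) = _
    rw [dd_g2]; rfl
  rw [nab_apply, aa_apply, e1, neg_add_eq_sub, sub_add_cancel]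
  refine Submodule.sum_mem _ fun i _ => ?_
  rw [mm_cw]
  have := pv_cw (κ := κ) (f := wl (X.α i) ∘ₗ X.g2 k) (fun z hz => X.wlg2_XX i k hz) (pv_mm (P i) hγ)
  exact this

lemma nab_XX (k : ℕ) {z : VF κ (m+1)} (hz : z ∈ pv (X.XX k)) : nab X.α P z ∈ pv (X.XX k) :=
  nab_mem X.α P (fun z hz => X.dd_XX k hz) (fun j z hz => X.wl_XX j k hz) hz

lemma PV_eq : PV X.α P X.F.v = ∑ i, P i := by
  unfold PV
  rw [Finset.filter_true_of_mem]
  intro i _; rw [X.hv]; exact one_ne_zero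

lemma step_ii {G : Set ℂ} (hG : GoodG G) (hflat : Flat X.α P) (hs : Spc G X.α P) (k : ℕ) {y : VF κ (m+1)}
    (hy : y ∈ pv (X.XX k)) (hny : nab X.α P y ∈ pv (X.XX 0)) :
    ∃ y' ∈ pv (Om (X.AT Set.univ)), y - nab X.α P y' ∈ pv (X.XX 0) := by
  induction k generalizing y with
  | zero => exact ⟨0, zero_mem _, by simpa using hy⟩
  | succ k ih =>
    have hy' := fun a => X.mem_XX.1 (mem_pv.1 hy a)
    choose x hx β hβ γ hγ e using hy'
    have hx' : (x : VF κ (m+1)) ∈ pv (X.XX k) := mem_pv.2 hx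
    have hβ' : (β : VF κ m) ∈ pv (Om X.B) := mem_pv.2 hβ
    have hγ' : (γ : VF κ m) ∈ pv (Om X.B) := mem_pv.2 hγ
    have e' : y = x + (cw (X.g1 (k+1)) β + cw (X.g2 k) γ) := funext e
    set M : Matrix κ κ ℂ := ∑ i, P i + ((k+1 : ℕ) : ℂ) • 1 with hM
    have hMu : IsUnit M := by
      have h1 := (hs.hv X.F.v).isUnit (μ := -((k+1 : ℕ) : ℂ)) (fun h => by
        have := hG.int (-((k+1 : ℕ) : ℤ)) (by push_cast at h ⊢; exact h)
        omega)
      rwa [X.PV_eq, neg_smul, sub_neg_eq_add] at h1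
    obtain ⟨⟨M, N, hMN, hNM⟩, hu⟩ := hMu
    change M = _ at hu
    have h1 := X.nab_g1 P k hβ'
    have h2 := X.nab_g2 P k hγ'
    have h3 := X.nab_XX P k hx'
    have h4 : nab X.α P y ∈ pv (X.XX k) := pv_mono (X.XX_mono (Nat.zero_le k)) hny
    rw [e', map_add, map_add] at h4
    rw [← hM] at h1
    have h5 : cw (X.g1 (k+1)) (cw dd β) + cw (X.g2 k) (mm M β - cw dd γ) ∈ pv (X.XX k) := by
      have := sub_mem (sub_mem h4 h3) (add_mem h1 h2)
      rw [map_sub, hu]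
      convert this using 1
      abel
    have h6 : mm M β - cw dd γ = 0 := by
      funext a
      have := mem_pv.1 h5 a
      exact (X.lead (neg_mem this) (b := dd (β a)) (c := (mm M β - cw dd γ) a) (add_neg_cancel _)).2
    rw [sub_eq_zero] at h6
    set δ : VF κ m := mm N γ with hδ
    have hδm : δ ∈ pv (Om X.B) := pv_mm _ hγ'
    have h7 : mm M δ = γ := by rw [hδ, ← mm_mul, hMN, mm_one]
    have h8 : cw dd δ = β := by
      rw [hδ, ← mm_cw, ← h6, ← mm_mul, hNM, mm_one]
    have h9 := X.nab_g1 P k hδm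
    rw [← hM, ← hu, h7, h8] at h9
    have hg : cw (X.g1 (k+1)) δ ∈ pv (Om (X.AT Set.univ)) :=
      pv_cw (fun z hz => Om_ksmul (pow_mem (affK_mem _ _) _) (X.B_AT hz)) hδm
    obtain ⟨t, ht, h10⟩ := ih (y := y - nab X.α P (cw (X.g1 (k+1)) δ)) (by
      have := sub_mem hx' h9
      rw [e']
      convert this using 1; abel) (by rw [map_sub, nab_nab _ _ hflat, sub_zero]; exact hny)
    refine ⟨cw (X.g1 (k+1)) δ + t, add_mem hg ht, ?_⟩
    rwa [map_add, ← sub_sub]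

lemma step_ii' {G : Set ℂ} (hG : GoodG G) (hflat : Flat X.α P) (hs : Spc G X.α P) {y : VF κ (m+1)}
    (hy : y ∈ pv (Om (X.AT Set.univ))) (hny : nab X.α P y ∈ pv (Br (X.AT Set.univ))) :
    ∃ y' ∈ pv (Om (X.AT Set.univ)), y - nab X.α P y' ∈ pv (X.X0 (Om X.B)) := by
  obtain ⟨y', hy', y0, hy0, r, hr, e⟩ := X.step_i' P hG hflat hs hy hny
  choose k hk using fun a => X.Om_poly (mem_pv.1 hy0 a)
  have h0 : y0 ∈ pv (X.XX (Finset.univ.sup k)) :=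
    mem_pv.2 fun a => X.XX_mono (Finset.le_sup (Finset.mem_univ a)) (hk a)
  have h1 : y - nab X.α P y' ∈ pv (X.XX (Finset.univ.sup k)) := by
    rw [e]
    refine add_mem h0 (Submodule.sum_mem _ fun i _ => pv_cw (fun z hz => X.XX_mono (Nat.zero_le _) (X.wp_X0 hz i)) (hr i))
  obtain ⟨t, ht, h2⟩ := X.step_ii P hG hflat hs _ h1 (by
    rw [map_sub, nab_nab _ _ hflat, sub_zero]
    refine pv_mono ?_ hny
    rw [X.Br_X0]; exact X.X0_mono (Br_le_Om _))
  refine ⟨y' + t, add_mem hy' ht, ?_⟩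
  rwa [map_add, ← sub_sub]

end conn
end Fib
end RV

end

noncomputable section
namespace RV

section lin
variable {ι W τ : Type} [Fintype ι] [AddCommGroup W] [Module ℂ W]

lemma sum_antisymm (s : Finset ι) (a : ι → ι → W) : ∑ i ∈ s, ∑ c ∈ s, (a i c - a c i) = 0 := by
  simp only [Finset.sum_sub_distrib]
  rw [Finset.sum_comm, sub_self]

lemma sum_pairs (G : ι → ι → W) (hG : ∀ i, G i i = 0) (i : ι) :
    ∑ q : {q : ι × ι // q.1 ≠ q.2}, (if i = q.1.1 then G q.1.1 q.1.2 else 0) = ∑ c, G i c := by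
  rw [← Finset.sum_subtype (Finset.univ.filter fun q : ι × ι => q.1 ≠ q.2) (by simp)
    (fun q : ι × ι => if i = q.1 then G q.1 q.2 else 0), Finset.sum_filter, Fintype.sum_prod_type,
    Finset.sum_eq_single i]
  · refine Finset.sum_congr rfl fun c _ => ?_
    by_cases h : i = c
    · subst h; simp [hG]
    · simp [h]
  · intro j _ hj
    refine Finset.sum_eq_zero fun c _ => ?_
    rw [if_neg (Ne.symm hj), ite_self]
  · simp

lemma eig_class1 (P : ι → W →ₗ[ℂ] W) (f : ι → τ) (x : ι → W) {μ : ℂ} (hx : ∃ j, x j ≠ 0)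
    (h : ∀ i, ∑ c with f c = f i, (P c (x i) - P i (x c)) = μ • x i) :
    μ = 0 ∨ ∃ j, x j ≠ 0 ∧ ∑ c with f c = f j, P c (x j) = μ • x j := by
  by_cases hμ : μ = 0
  · exact Or.inl hμ
  right
  have hσ : ∀ j, ∑ c with f c = f j, x c = 0 := by
    intro j
    have h1 : ∑ i with f i = f j, ∑ c with f c = f j, (P c (x i) - P i (x c)) =
        ∑ i with f i = f j, μ • x i := by
      refine Finset.sum_congr rfl fun i hi => ?_
      rw [Finset.mem_filter] at hi
      rw [← h i, hi.2]
    have h2 := sum_antisymm (Finset.univ.filter fun i => f i = f j) (fun i c => P c (x i))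
    rw [h2, ← Finset.smul_sum] at h1
    exact (smul_eq_zero.1 h1.symm).resolve_left hμ
  obtain ⟨j, hj⟩ := hx
  refine ⟨j, hj, ?_⟩
  rw [← h j, Finset.sum_sub_distrib, ← map_sum, hσ, map_zero, sub_zero]

lemma eig_class2 (P : ι → W →ₗ[ℂ] W) (f : ι → τ) (x : ι → W) {μ : ℂ} (hx : ∃ j, x j ≠ 0)
    (h : ∀ i, ∑ c with f c ≠ f i, (P c (x i) - P i (x c)) = μ • x i) :
    μ = 0 ∨ (∃ s, s ≠ 0 ∧ ∑ c, P c s = μ • s) ∨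
      ∃ j, x j ≠ 0 ∧ ∑ c with f c ≠ f j, P c (x j) = μ • x j := by
  by_cases hμ : μ = 0
  · exact Or.inl hμ
  right
  have hτ : ∑ c, x c = 0 := by
    have h2 := sum_antisymm (Finset.univ : Finset ι) (fun i c => if f c ≠ f i then P c (x i) else 0)
    have h1 : ∑ i, ∑ c, ((fun i c => if f c ≠ f i then P c (x i) else 0) i c -
        (fun i c => if f c ≠ f i then P c (x i) else 0) c i) = ∑ i, μ • x i := by
      refine Finset.sum_congr rfl fun i _ => ?_
      rw [← h i, Finset.sum_filter]
      refine Finset.sum_congr rfl fun c _ => ?_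
      by_cases hc : f c = f i
      · simp [hc]
      · have hc' : f i ≠ f c := Ne.symm hc
        simp [hc, hc']
    rw [h2, ← Finset.smul_sum] at h1
    exact (smul_eq_zero.1 h1.symm).resolve_left hμ
  have hsplit : ∀ j, ∀ g : ι → W, ∑ c with f c = f j, g c + ∑ c with f c ≠ f j, g c = ∑ c, g c :=
    fun j g => Finset.sum_filter_add_sum_filter_not _ _ _
  have hN : ∀ j, ∑ c with f c ≠ f j, x c = - ∑ c with f c = f j, x c := by
    intro j
    rw [eq_neg_iff_add_eq_zero, add_comm, hsplit, hτ]
  by_cases hs : ∃ j, ∑ c with f c = f j, x c ≠ 0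
  · left
    obtain ⟨j, hj⟩ := hs
    refine ⟨_, hj, ?_⟩
    have h1 : ∑ i with f i = f j, ∑ c with f c ≠ f j, (P c (x i) - P i (x c)) =
        ∑ i with f i = f j, μ • x i := by
      refine Finset.sum_congr rfl fun i hi => ?_
      rw [Finset.mem_filter] at hi
      rw [← h i, hi.2]
    rw [Finset.smul_sum, ← h1]
    simp only [Finset.sum_sub_distrib]
    rw [Finset.sum_comm]
    simp only [← map_sum, hN, map_neg]
    rw [Finset.sum_neg_distrib, sub_neg_eq_add, add_comm, hsplit]
  · push Not at hs
    right
    obtain ⟨j, hj⟩ := hx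
    refine ⟨j, hj, ?_⟩
    rw [← h j, Finset.sum_sub_distrib, ← map_sum, hN, hs, neg_zero, map_zero, sub_zero]

end lin

namespace Fib
variable {m : ℕ} {ι : Type} [Fintype ι] (X : Fib m ι)
section conn
variable {κ : Type} [Fintype κ] (P : ι → Matrix κ κ ℂ)

/-- the base weights -/
def PP (q : {q : ι × ι // q.1 ≠ q.2}) : Matrix (ι × κ) (ι × κ) ℂ := fun x y =>
  if x.1 = q.1.1 then (if y.1 = q.1.1 then P q.1.2 x.2 y.2 else 0) - (if y.1 = q.1.2 then P q.1.1 x.2 y.2 else 0)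
  else 0

def ba (q : {q : ι × ι // q.1 ≠ q.2}) : Aff m := X.b q.1.1 q.1.2

lemma PP_sum {W : Type} [AddCommGroup W] [Module ℂ W] (q) (z : ι × κ → W) (i : ι) (k : κ) :
    ∑ y, PP P q (i, k) y • z y = if i = q.1.1 then
      (∑ c, P q.1.2 k c • z (q.1.1, c)) - ∑ c, P q.1.1 k c • z (q.1.2, c) else 0 := by
  unfold PP
  split_ifs with h
  · simp only [sub_smul, Finset.sum_sub_distrib, ite_smul, zero_smul, Fintype.sum_prod_type]
    congr 1 <;> (rw [Finset.sum_comm]; simp)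
  · simp [h]

def sl (i : ι) {l : ℕ} (z : VF (ι × κ) l) : VF κ l := fun k => z (i, k)

lemma aa_PP (z : VF (ι × κ) m) (i : ι) (k : κ) : aa X.ba (PP P) z (i, k) =
    ∑ c, wl (X.b i c) (mm (P c) (sl i z) k - mm (P i) (sl c z) k) := by
  rw [← sum_pairs (fun i c => wl (X.b i c) (mm (P c) (sl i z) k - mm (P i) (sl c z) k))
    (fun i => by rw [sub_self, map_zero]) i, aa_apply, Finset.sum_apply]
  refine Finset.sum_congr rfl fun q _ => ?_
  rw [cw_apply, mm_apply]
  refine (congrArg (wl (X.ba q)) (PP_sum P q z i k)).trans ?_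
  by_cases h : i = q.1.1
  · rw [if_pos h, if_pos h]; rfl
  · rw [if_neg h, if_neg h, map_zero]

def TT : VF (ι × κ) m →ₗ[ℂ] VF κ (m+1) where
  toFun z := fun k => ∑ i, wl (X.α i) (Pb X.F.p (z (i, k)))
  map_add' z w := by
    funext k
    simp only [Pi.add_apply, map_add, Finset.sum_add_distrib]
  map_smul' c z := by
    funext k
    simp only [Pi.smul_apply, map_smul, Finset.smul_sum, RingHom.id_apply]

lemma TT_apply (z : VF (ι × κ) m) (k : κ) : X.TT z k = ∑ i, wl (X.α i) (Pb X.F.p (z (i, k))) := rfl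

lemma TT_uniq {β : VF κ m} {z : VF (ι × κ) m} (h : cw (Pb X.F.p) β + X.TT z = 0) : β = 0 ∧ z = 0 := by
  have := fun k => X.res_uniq (z := Pb X.F.p (β k)) (fun j => X.Pb_p_reg _ j) (fun i => z (i, k)) (congrFun h k)
  refine ⟨funext fun k => X.F.Pb_p_inj ?_, funext fun q => (this q.2).1 q.1⟩
  rw [(this k).2]; exact (map_zero _).symm

lemma wl_b_symm (i j : ι) (z : Form m) : wl (X.b j i) z = wl (X.b i j) z := by
  have : X.b j i = (-1 : ℂ) • X.b i j := by rw [neg_one_smul, b, b, neg_sub]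
  rw [this, wl_smul_aff _ (by norm_num)]

lemma aa_TT (z : VF (ι × κ) m) : aa X.α P (X.TT z) = - X.TT (aa X.ba (PP P) z) := by
  funext k
  rw [aa_apply, Finset.sum_apply]
  have e1 : ∀ i, cw (wl (X.α i)) (mm (P i) (X.TT z)) k = ∑ j,
      (- wl (X.α j) (Pb X.F.p (wl (X.b i j) (mm (P i) (sl j z) k))) +
        wl (X.α i) (Pb X.F.p (wl (X.b i j) (mm (P i) (sl j z) k)))) := by
    intro i
    have : mm (P i) (X.TT z) k = ∑ j, wl (X.α j) (Pb X.F.p (mm (P i) (sl j z) k)) := by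
      simp only [mm_apply, TT_apply, Finset.smul_sum, map_sum, map_smul]
      rw [Finset.sum_comm]; rfl
    rw [cw_apply, this, map_sum]
    exact Finset.sum_congr rfl fun j _ => X.arn i j _
  simp only [e1]
  rw [Pi.neg_apply, TT_apply]
  simp only [aa_PP, map_sum, map_sub, Finset.sum_add_distrib, Finset.sum_sub_distrib, Finset.sum_neg_distrib]
  have e2 : (∑ i, ∑ j, wl (X.α j) (Pb X.F.p (wl (X.b i j) (mm (P i) (sl j z) k)))) =
      ∑ i, ∑ j, wl (X.α i) (Pb X.F.p (wl (X.b i j) (mm (P j) (sl i z) k))) := by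
    rw [Finset.sum_comm]
    refine Finset.sum_congr rfl fun i _ => Finset.sum_congr rfl fun j _ => ?_
    rw [X.wl_b_symm]
  rw [e2]
  abel

lemma nab_TT (z : VF (ι × κ) m) : nab X.α P (X.TT z) = - X.TT (nab X.ba (PP P) z) := by
  rw [nab_apply, nab_apply, aa_TT, map_add, neg_add]
  congr 1
  funext k
  rw [cw_apply, TT_apply, map_sum, Pi.neg_apply, TT_apply, ← Finset.sum_neg_distrib]
  refine Finset.sum_congr rfl fun i _ => ?_
  rw [dd_wl, X.dd_p]; rfl

def QQ (β : VF κ m) : VF (ι × κ) m := fun q => mm (P q.1) β q.2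

lemma nab_p (β : VF κ m) : nab X.α P (cw (Pb X.F.p) β) = cw (Pb X.F.p) (cw dd β) + X.TT (QQ P β) := by
  rw [nab_apply, aa_apply]
  congr 1
  · funext k; exact X.dd_p _
  · funext k
    rw [Finset.sum_apply]
    refine Finset.sum_congr rfl fun i _ => ?_
    rw [mm_cw]; rfl

lemma flat_PP (hflat : Flat X.α P) : Flat X.ba (PP P) := by
  intro z
  have h := hflat (X.TT z)
  rw [aa_TT, map_neg, aa_TT, neg_neg] at h
  exact (X.TT_uniq (β := 0) (by rw [h, map_zero, zero_add])).2

lemma spc_PP {G : Set ℂ} (hG : GoodG G) (hs : Spc G X.α P) : Spc G X.ba (PP P) := by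
  have hmv : ∀ (s : ι → ι → Prop) (x : ι × κ → ℂ) (i : ι), (∑ c with s i c,
      ((P c).mulVecLin (fun k => x (i, k)) - (P i).mulVecLin (fun k => x (c, k)))) = fun k =>
      ((∑ q : {q : ι × ι // q.1 ≠ q.2} with s q.1.1 q.1.2, PP P q).mulVec x) (i, k) := by
    intro s x i
    funext k
    rw [Finset.sum_apply, Finset.sum_filter, ← sum_pairs (fun i c => if s i c then
      ((P c).mulVecLin (fun k => x (i, k)) - (P i).mulVecLin (fun k => x (c, k))) k else 0)
      (fun i => by simp), Matrix.sum_mulVec, Finset.sum_apply, Finset.sum_filter]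
    refine Finset.sum_congr rfl fun q _ => ?_
    have : (PP P q).mulVec x (i, k) = ∑ y, PP P q (i, k) y • x y := rfl
    rw [this, PP_sum]
    by_cases h1 : i = q.1.1 <;> by_cases h2 : s q.1.1 q.1.2 <;> simp [h1, h2, Matrix.mulVec, dotProduct]
  have hsum : ∀ (s : Finset ι) (x : κ → ℂ), ∑ c ∈ s, (P c).mulVecLin x = (∑ c ∈ s, P c).mulVec x := by
    intro s x; rw [Matrix.sum_mulVec]; rfl
  have hx0 : ∀ x : ι × κ → ℂ, x ≠ 0 → ∃ j, (fun k => x (j, k)) ≠ 0 := by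
    intro x hx
    by_contra! h
    exact hx (funext fun q => congrFun (h q.1) q.2)
  constructor
  · intro u μ x hx he
    have h1 : ∀ i c, (X.b i c).ev u = 0 ↔ (X.ps c).ev u = (X.ps i).ev u := by
      intro i c; rw [b, ev_sub, sub_eq_zero, eq_comm]
    have := eig_class1 (fun c => (P c).mulVecLin) (fun i => (X.ps i).ev u) (fun i k => x (i, k)) (μ := μ) (hx0 x hx)
      (fun i => by
        simp only [← h1]
        rw [hmv (fun i c => (X.b i c).ev u = 0) x i]
        funext k
        exact congrFun he (i, k))
    rcases this with rfl | ⟨j, hj, h⟩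
    · exact hG.zero
    · rw [hsum] at h
      refine hs.hu (evT (X.Gd j).s u) μ _ hj ?_
      convert h using 2
      unfold PU
      refine Finset.sum_congr ?_ fun _ _ => rfl
      ext c
      rw [Finset.mem_filter, Finset.mem_filter, ← Aff.comp_ev, X.α_s, b, ev_sub, sub_eq_zero]
  · intro v μ x hx he
    have h1 : ∀ i c, (X.b i c).2 v ≠ 0 ↔ (X.ps c).2 v ≠ (X.ps i).2 v := by
      intro i c
      have : (X.b i c).2 v = (X.ps i).2 v - (X.ps c).2 v := rfl
      rw [this, sub_ne_zero, ne_comm]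
    have := eig_class2 (fun c => (P c).mulVecLin) (fun i => (X.ps i).2 v) (fun i k => x (i, k)) (μ := μ) (hx0 x hx)
      (fun i => by
        simp only [← h1]
        refine Eq.trans ?_ ((hmv (fun i c => (X.b i c).2 v ≠ 0) x i).trans ?_)
        · exact Finset.sum_congr (by ext; simp) fun _ _ => rfl
        · funext k
          refine Eq.trans ?_ (congrFun he (i, k))
          unfold PV
          exact congrFun (congrArg (fun M => Matrix.mulVec M x) (Finset.sum_congr (by congr!) fun _ _ => rfl)) _)
    rcases this with rfl | ⟨s, hs0, h⟩ | ⟨j, hj, h⟩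
    · exact hG.zero
    · rw [hsum] at h
      refine hs.hv X.F.v μ s hs0 ?_
      rw [X.PV_eq, h]
    · rw [hsum] at h
      refine hs.hv (linT (X.Gd j).s v) μ _ hj ?_
      convert h using 2
      unfold PV
      refine Finset.sum_congr ?_ fun _ _ => rfl
      ext c
      rw [Finset.mem_filter, Finset.mem_filter]
      have : (X.α c).2 (linT (X.Gd j).s v) = (X.b c j).2 v := by rw [← X.α_s]; rfl
      rw [this, h1, ne_comm]

lemma step_iii {G : Set ℂ} (hG : GoodG G) (hm : Claim G m) (hflat : Flat X.α P) (hs : Spc G X.α P) {y : VF κ (m+1)}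
    (hy : y ∈ pv (X.X0 (Om X.B))) (hny : nab X.α P y ∈ pv (Br (X.AT Set.univ))) :
    ∃ y' ∈ pv (Om (X.AT Set.univ)), y - nab X.α P y' ∈ pv (Br (X.AT Set.univ)) := by
  rw [X.Br_X0] at hny ⊢
  have hB0 : (0 : Aff m) ∉ X.B := fun h => X.B_ne h rfl
  choose β hβ r hr e using fun k => X.mem_X0.1 (mem_pv.1 hy k)
  choose β0 hβ0 r0 hr0 e0 using fun k => X.mem_X0.1 (mem_pv.1 hny k)
  set γ : VF (ι × κ) m := fun q => r q.2 q.1 with hγ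
  set γ0 : VF (ι × κ) m := fun q => r0 q.2 q.1 with hγ0
  have hγm : γ ∈ pv (Om X.B) := mem_pv.2 fun q => hr q.2 q.1
  have hγ0m : γ0 ∈ pv (Br X.B) := mem_pv.2 fun q => hr0 q.2 q.1
  have e' : y = cw (Pb X.F.p) β + X.TT γ := funext e
  have e0' : nab X.α P y = cw (Pb X.F.p) β0 + X.TT γ0 := funext e0
  have e1 : nab X.α P y = cw (Pb X.F.p) (cw dd β) + X.TT (QQ P β - nab X.ba (PP P) γ) := by
    rw [e', map_add, nab_p, nab_TT, map_sub]; abel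
  obtain ⟨u1, u2⟩ := X.TT_uniq (β := cw dd β - β0) (z := QQ P β - nab X.ba (PP P) γ - γ0) (by
    rw [map_sub, map_sub _ _ γ0]
    have := e1.symm.trans e0'
    rw [← sub_eq_zero] at this
    rw [← this]; abel)
  rw [sub_eq_zero] at u1 u2
  have hQ : ∀ (M : Submodule ℂ (Form m)) (β : VF κ m), β ∈ pv M → QQ P β ∈ pv M := fun M β h =>
    mem_pv.2 fun q => mem_pv.1 (pv_mm (P q.1) h) q.2
  have n0 : ∀ z : VF κ m, nab (fun i : Empty => i.elim) (fun i : Empty => i.elim) z = cw dd z := by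
    intro z; rw [nab_apply, aa_apply]; simp
  obtain ⟨β', hβ', hβ1⟩ := hm X.B X.B_fin hB0 Empty κ (fun i => i.elim) (fun i => i.elim) (fun i => i.elim)
    (fun z => by simp [aa_apply])
    ⟨fun u μ x hx h => by
      have : μ • x = 0 := by rw [← h]; simp [PU]
      rw [(smul_eq_zero.1 this).resolve_right hx]; exact hG.zero,
     fun u μ x hx h => by
      have : μ • x = 0 := by rw [← h]; simp [PV]
      rw [(smul_eq_zero.1 this).resolve_right hx]; exact hG.zero⟩ β (mem_pv.2 hβ)
    (by rw [n0, u1]; exact mem_pv.2 hβ0)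
  rw [n0] at hβ1
  have hQs : QQ P (β - cw dd β') = QQ P β - QQ P (cw dd β') := by
    funext q; simp only [QQ, map_sub]; rfl
  have hQd : nab X.ba (PP P) (QQ P β') - QQ P (cw dd β') = 0 := by
    have h := nab_nab X.α P hflat (cw (Pb X.F.p) β')
    rw [nab_p, map_add, nab_p, nab_TT, cw_dd_dd, map_zero, zero_add] at h
    have := (X.TT_uniq (β := 0) (z := nab X.ba (PP P) (QQ P β') - QQ P (cw dd β')) (by
      rw [map_zero, map_sub, zero_add, ← neg_eq_zero, ← h]; abel)).2
    exact this
  obtain ⟨γ'', hγ'', hγ1⟩ := hm X.B X.B_fin hB0 _ _ X.ba (PP P) (fun q => X.b_mem q.2) (X.flat_PP P hflat)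
    (X.spc_PP P hG hs) (γ - QQ P β') (sub_mem hγm (hQ _ _ hβ')) (by
      have : nab X.ba (PP P) (γ - QQ P β') = QQ P (β - cw dd β') - γ0 := by
        rw [hQs, ← u2, map_sub, sub_eq_zero.1 hQd]; abel
      rw [this]
      exact sub_mem (hQ _ _ hβ1) hγ0m)
  refine ⟨cw (Pb X.F.p) β' - X.TT γ'', sub_mem (pv_cw (fun z hz => X.B_AT hz) hβ') ?_, ?_⟩
  · exact mem_pv.2 fun k => Submodule.sum_mem _ fun i _ => Om_wl (X.α_mem (Set.mem_univ _)) (X.B_AT (mem_pv.1 hγ'' _))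
  · have : y - nab X.α P (cw (Pb X.F.p) β' - X.TT γ'') = cw (Pb X.F.p) (β - cw dd β') +
        X.TT (γ - QQ P β' - nab X.ba (PP P) γ'') := by
      rw [map_sub, nab_p, nab_TT, e', map_sub, map_sub, map_sub]; abel
    rw [this]
    exact mem_pv.2 fun k => X.mem_X0.2 ⟨_, mem_pv.1 hβ1 k, _, fun i => mem_pv.1 hγ1 (i, k), rfl⟩

/-- The claim for the completed fibre arrangement. -/
lemma core {G : Set ℂ} (hG : GoodG G) (hm : Claim G m) (hflat : Flat X.α P) (hs : Spc G X.α P) :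
    ClaimFor (X.AT Set.univ) X.α P := by
  intro y hy hny
  obtain ⟨y1, hy1, h1⟩ := X.step_ii' P hG hflat hs hy hny
  obtain ⟨y2, hy2, h2⟩ := X.step_iii P hG hm hflat hs h1 (by rw [map_sub, nab_nab _ _ hflat, sub_zero]; exact hny)
  exact ⟨y1 + y2, add_mem hy1 hy2, by rwa [map_add, ← sub_sub]⟩

lemma core' {G : Set ℂ} (hG : GoodG G) (hm : Claim G m) (hflat : Flat X.α P) (hs : Spc G X.α P) :
    ClaimFor (Set.range X.α) X.α P := by
  have hfin : X.pB.Finite := X.B_fin.image _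
  refine deletions hm (Set.finite_range _) (fun ⟨i, hi⟩ => X.α_ne i hi) hfin.toFinset ?_ (fun i => ⟨i, rfl⟩) hflat hs ?_
  · rw [Set.Finite.mem_toFinset]
    rintro ⟨f, hf, h⟩
    exact X.F.comp_p_ne (X.B_ne hf) h
  · rw [Set.Finite.coe_toFinset, ← Set.image_univ]
    exact X.core P hG hm hflat hs

end conn
end Fib
end RV

end

noncomputable section
namespace RV

lemma claim_zero (G : Set ℂ) : Claim G 0 := by
  intro A _ _ ι κ _ _ α P _ _ _ y hy _
  have h2 : ∀ f : Aff 0, f = (f.1, 0) := fun f => Prod.ext rfl (LinearMap.ext fun v => by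
    rw [Subsingleton.elim v 0, map_zero, map_zero])
  have hR : RA A ≤ (⊥ : Subalgebra ℂ (KK 0)) := by
    refine RA_le (fun f => ?_) fun a _ => ?_
    · rw [h2 f, affK_const]; exact Subalgebra.algebraMap_mem _ _
    · rw [h2 a, affK_const, ← map_inv₀]; exact Subalgebra.algebraMap_mem _ _
  have hx : ∀ x : XA 0, ∃ c : ℂ, x = algebraMap ℂ (XA 0) c := by
    intro x
    induction x using ExteriorAlgebra.induction with
    | algebraMap r => exact ⟨r, rfl⟩
    | ι v => exact ⟨0, by rw [Subsingleton.elim v 0, map_zero, map_zero]⟩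
    | mul a b ha hb =>
      obtain ⟨c, rfl⟩ := ha
      obtain ⟨d, rfl⟩ := hb
      exact ⟨c * d, (map_mul _ _ _).symm⟩
    | add a b ha hb =>
      obtain ⟨c, rfl⟩ := ha
      obtain ⟨d, rfl⟩ := hb
      exact ⟨c + d, (map_add _ _ _).symm⟩
  refine ⟨0, zero_mem _, ?_⟩
  rw [map_zero, sub_zero]
  refine mem_pv.2 fun k => ?_
  obtain ⟨c, hc⟩ := Algebra.mem_bot.1 (hR (mem_Om.1 (mem_pv.1 hy k) 1))
  have : y k = c • oneF 0 := by
    refine LinearMap.ext fun x => ?_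
    obtain ⟨d, rfl⟩ := hx x
    rw [Algebra.algebraMap_eq_smul_one, map_smul, map_smul, ← hc, LinearMap.smul_apply]
    simp [oneF, Algebra.smul_def]
  rw [this]
  exact Submodule.smul_mem _ _ (Br_one A)

section norm
variable {l : ℕ} {ι κ : Type} [Fintype ι] [Fintype κ] (α : ι → Aff l) (P : ι → Matrix κ κ ℂ)

lemma norm_transfer {M : Type} [AddCommGroup M] (nrm : Aff l → Aff l) (I : Finset (Aff l))
    (hI : ∀ j, (α j).2 ≠ 0 → nrm (α j) ∈ I) (g : Aff l → Matrix κ κ ℂ →+ M)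
    (h0 : ∀ j N, (α j).2 = 0 → g (α j) N = 0) (h1 : ∀ j N, (α j).2 ≠ 0 → g (nrm (α j)) N = g (α j) N) :
    ∑ i : I, g i (∑ j with (α j).2 ≠ 0 ∧ nrm (α j) = i, P j) = ∑ j, g (α j) (P j) := by
  simp only [map_sum, Finset.sum_filter]
  rw [Finset.sum_comm]
  refine Finset.sum_congr rfl fun j _ => ?_
  by_cases hc : (α j).2 = 0
  · rw [h0 j _ hc]
    simp [hc]
  · rw [Finset.sum_eq_single ⟨nrm (α j), hI j hc⟩]
    · rw [if_pos ⟨hc, rfl⟩, h1 j _ hc]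
    · intro b _ hb
      rw [if_neg (fun h => hb (Subtype.ext h.2.symm)), map_zero]
    · simp

end norm

lemma claim_succ {G : Set ℂ} (hG : GoodG G) {m : ℕ} (hm : Claim G m) : Claim G (m+1) := by
  intro A hA h0 ι κ _ _ α P hα hflat hs
  obtain ⟨v, hv⟩ := exists_generic (S := insert (coordA 0) ((fun a : Aff (m+1) => ((0, a.2) : Aff (m+1))) ''
      {a ∈ A | a.2 ≠ 0})) (((hA.subset (Set.sep_subset _ _)).image _).insert _) (by
    rintro f (rfl | ⟨a, ⟨_, ha⟩, rfl⟩)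
    · intro h
      have := congrArg (fun f => Aff.ev f (fun _ => 1)) h
      simp at this
    · intro h
      exact ha (congrArg Prod.snd h))
  have hv0 : v ≠ 0 := by
    rintro rfl
    exact hv _ (Set.mem_insert _ _) (by simp)
  have hva : ∀ a ∈ A, a.2 ≠ 0 → a.2 v ≠ 0 := by
    intro a ha h2
    have := hv (0, a.2) (Set.mem_insert_of_mem _ ⟨a, ⟨ha, h2⟩, rfl⟩)
    simpa [Aff.ev] using this
  obtain ⟨F, hF⟩ := FD.exists_base v hv0
  set nrm : Aff (m+1) → Aff (m+1) := fun a => (a.2 v)⁻¹ • a with hnrm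
  set I : Finset (Aff (m+1)) := (hA.toFinset.filter (fun a => a.2 ≠ 0)).image nrm with hI
  have hIm : ∀ i, i ∈ I ↔ ∃ a ∈ A, a.2 ≠ 0 ∧ nrm a = i := by
    intro i
    rw [hI]; simp [and_assoc]
  have hIj : ∀ j, (α j).2 ≠ 0 → nrm (α j) ∈ I := fun j hj => (hIm _).2 ⟨_, hα j, hj, rfl⟩
  let X : Fib m I := ⟨F, fun i => i, Subtype.val_injective, fun i => by
    obtain ⟨a, ha, h2, h⟩ := (hIm _).1 i.2
    rw [← h, hF]
    exact inv_mul_cancel₀ (hva a ha h2)⟩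
  set P' : I → Matrix κ κ ℂ := fun i => ∑ j with (α j).2 ≠ 0 ∧ nrm (α j) = i, P j with hP'
  have hconst : ∀ a : Aff (m+1), a.2 = 0 → a = (a.1, 0) := fun a h => Prod.ext rfl h
  have haa : ∀ z, aa X.α P' z = aa α P z := by
    intro z
    rw [aa_apply, aa_apply]
    exact norm_transfer α P nrm I hIj (fun a => AddMonoidHom.mk' (fun N => cw (wl a) (mm N z))
      (fun N N' => by rw [mm_add, map_add])) (fun j N h => by
        funext k
        show wl (α j) _ = 0
        rw [hconst _ h, wl_const]) (fun j N h => by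
        funext k
        show wl (nrm (α j)) _ = wl (α j) _
        exact wl_smul_aff _ (inv_ne_zero (hva _ (hα j) h)) _ _)
  have hnab : ∀ z, nab X.α P' z = nab α P z := by
    intro z
    rw [nab_apply, nab_apply, haa]
  have hflat' : Flat X.α P' := by
    intro z; rw [haa, haa]; exact hflat z
  have gen : ∀ s : Aff (m+1) → Prop, (∀ j, (α j).2 = 0 → ¬ s (α j)) →
      (∀ j, (α j).2 ≠ 0 → (s (nrm (α j)) ↔ s (α j))) →
      ∑ i with s (X.α i), P' i = ∑ j with s (α j), P j := by
    intro s h0 h1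
    rw [Finset.sum_filter, Finset.sum_filter]
    have := norm_transfer α P nrm I hIj (fun a => AddMonoidHom.mk' (fun N => if s a then N else 0)
      (fun N N' => by split_ifs <;> simp)) (fun j N h => if_neg (h0 j h)) (fun j N h => by
        show (if s (nrm (α j)) then N else 0) = if s (α j) then N else 0
        simp only [h1 j h])
    exact this
  have hs' : Spc G X.α P' := by
    constructor
    · intro u
      have : PU X.α P' u = PU α P u := by
        unfold PU
        refine gen (fun a => a.ev u = 0) (fun j h e => ?_) (fun j h => ?_)
        · apply h0
          have h1 := hconst _ h
          rw [h1] at e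
          have e' : (α j).1 = 0 := by simpa [Aff.ev] using e
          have := hα j
          rw [h1, e'] at this
          exact this
        · show (((α j).2 v)⁻¹ • (α j)).ev u = 0 ↔ (α j).ev u = 0
          rw [ev_smul, mul_eq_zero, or_iff_right (inv_ne_zero (hva _ (hα j) h))]
      rw [this]; exact hs.hu u
    · intro u
      have : PV X.α P' u = PV α P u := by
        unfold PV
        refine Eq.trans ?_ ((gen (fun a => a.2 u ≠ 0) (fun j h e => ?_) (fun j h => ?_)).trans ?_)
        · exact Finset.sum_congr (by congr!) fun _ _ => rfl
        · rw [h] at e; exact e rfl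
        · show ((α j).2 v)⁻¹ * (α j).2 u ≠ 0 ↔ _
          rw [mul_ne_zero_iff, and_iff_right (inv_ne_zero (hva _ (hα j) h))]
        · exact Finset.sum_congr (by congr!) fun _ _ => rfl
      rw [this]; exact hs.hv u
  have hc := X.core' P' hG hm hflat' hs'
  have hc2 : ClaimFor A X.α P' := by
    refine hc.congr ?_ ?_
    · rintro a ⟨i, rfl⟩
      right
      obtain ⟨a, ha, h2, h⟩ := (hIm _).1 i.2
      exact ⟨(a.2 v)⁻¹, inv_ne_zero (hva a ha h2), a, ha, h.symm⟩
    · intro a ha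
      by_cases h2 : a.2 = 0
      · exact Or.inl h2
      · right
        refine ⟨a.2 v, hva a ha h2, nrm a, ⟨⟨nrm a, (hIm _).2 ⟨a, ha, h2, rfl⟩⟩, rfl⟩, ?_⟩
        rw [hnrm, smul_inv_smul₀ (hva a ha h2)]
  intro y hy hny
  rw [← hnab] at hny
  obtain ⟨y', h1, h2⟩ := hc2 y hy hny
  exact ⟨y', h1, by rwa [← hnab]⟩

theorem claim_all {G : Set ℂ} (hG : GoodG G) (l : ℕ) : Claim G l := by
  induction l with
  | zero => exact claim_zero G
  | succ m ih => exact claim_succ hG ih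

end RV

end

noncomputable section
namespace RV

section mono
variable {n : ℕ}

/-- The ordered monomial of a set. -/
def eS (S : Finset (Fin n)) : XA n := em (S.sort (· ≤ ·))

lemma eS_empty : eS (∅ : Finset (Fin n)) = 1 := by simp [eS]

lemma eS_insert {a : Fin n} {S : Finset (Fin n)} (h : ∀ x ∈ S, a < x) : eS (insert a S) = eg a * eS S := by
  rw [eS, Finset.sort_insert _ (fun b hb => (h b hb).le) (fun ha => lt_irrefl _ (h a ha)), em_cons, eS]

lemma posIn_zero {a : Fin n} {S : Finset (Fin n)} (h : ∀ x ∈ S, a < x) : posIn a S = 0 := by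
  rw [posIn, Finset.card_eq_zero, Finset.filter_eq_empty_iff]
  exact fun x hx => (h x hx).not_gt

lemma posIn_insert {a j : Fin n} {S : Finset (Fin n)} (h : a < j) (ha : a ∉ S) :
    posIn j (insert a S) = posIn j S + 1 := by
  rw [posIn, posIn, Finset.filter_insert, if_pos h, Finset.card_insert_of_notMem (by simp [ha])]

lemma posIn_insert' {a j : Fin n} {S : Finset (Fin n)} (h : ¬ a < j) :
    posIn j (insert a S) = posIn j S := by
  rw [posIn, posIn, Finset.filter_insert, if_neg h]

lemma eg_eS (j : Fin n) (S : Finset (Fin n)) :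
    eg j * eS S = if j ∈ S then 0 else (-1 : ℂ) ^ posIn j S • eS (insert j S) := by
  induction S using Finset.induction_on_min with
  | empty => simp [posIn, eS]
  | insert a S h ih =>
    have haS : a ∉ S := fun ha => lt_irrefl _ (h a ha)
    rcases lt_trichotomy j a with hj | rfl | hj
    · have h' : ∀ x ∈ insert a S, j < x := by
        intro x hx
        rcases Finset.mem_insert.1 hx with rfl | hx
        · exact hj
        · exact hj.trans (h x hx)
      rw [if_neg (fun hm => lt_irrefl _ (h' j hm)), posIn_zero h', pow_zero, one_smul, eS_insert h']
    · rw [eS_insert h, ← mul_assoc, eg_sq, zero_mul, if_pos (Finset.mem_insert_self _ _)]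
    · rw [eS_insert h, ← mul_assoc, eg_comm, neg_mul, mul_assoc, ih]
      by_cases hS : j ∈ S
      · rw [if_pos hS, if_pos (Finset.mem_insert_of_mem hS), mul_zero, neg_zero]
      · have hS' : j ∉ insert a S := by
          rw [Finset.mem_insert, not_or]; exact ⟨hj.ne', hS⟩
        rw [if_neg hS, if_neg hS', mul_smul_comm, ← eS_insert, Finset.insert_comm, posIn_insert hj haS, pow_succ]
        · simp
        · intro x hx
          rcases Finset.mem_insert.1 hx with rfl | hx
          · exact hj
          · exact h x hx

lemma XA_ind {N : Submodule ℂ (XA n)} (h1 : 1 ∈ N) (h2 : ∀ j, ∀ x ∈ N, eg j * x ∈ N) (x : XA n) : x ∈ N := by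
  have : FT (Finset.univ : Finset (Fin n)) ≤ N := FT_le fun L _ => by
    induction L with
    | nil => exact h1
    | cons j L ih => exact h2 j _ (ih (by simp))
  exact this (FT_univ x)

lemma XA_ext {M : Type} [AddCommGroup M] [Module ℂ M] {f g : XA n →ₗ[ℂ] M} (h1 : f 1 = g 1)
    (h2 : ∀ j x, f x = g x → f (eg j * x) = g (eg j * x)) (x : XA n) : f x = g x :=
  XA_ind (N := LinearMap.eqLocus f g) h1 (fun j x hx => h2 j x hx) x

@[irreducible] def eB : Module.Basis (Finset (Fin n)) ℂ (XA n) :=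
  basisOfTopLeSpanOfCardEqFinrank eS (by
    intro x _
    refine XA_ind (N := Submodule.span ℂ (Set.range eS)) ?_ ?_ x
    · exact Submodule.subset_span ⟨∅, eS_empty⟩
    · intro j x hx
      have : Submodule.span ℂ (Set.range eS) ≤ (Submodule.span ℂ (Set.range (eS (n := n)))).comap
          (LinearMap.mulLeft ℂ (eg j)) := by
        rw [Submodule.span_le]
        rintro _ ⟨S, rfl⟩
        show eg j * eS S ∈ Submodule.span ℂ (Set.range (eS (n := n)))
        rw [eg_eS]
        split_ifs
        · exact zero_mem _
        · exact Submodule.smul_mem _ _ (Submodule.subset_span ⟨_, rfl⟩)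
      exact this hx) (by
    rw [Module.finrank_eq_card_basis (Pi.basisFun ℂ (Fin n)).ExteriorAlgebra])

lemma eB_apply (S : Finset (Fin n)) : eB S = eS S := by simp [eB]

/-- graded projections -/
@[irreducible] def pr (q : ℕ) : XA n →ₗ[ℂ] XA n := eB.constr ℂ (fun S => if S.card = q then eS S else 0)

lemma pr_eS (q : ℕ) (S : Finset (Fin n)) : pr q (eS S) = if S.card = q then eS S else 0 := by
  rw [pr, ← eB_apply, Module.Basis.constr_basis, eB_apply]

lemma eS_ext {M : Type} [AddCommGroup M] [Module ℂ M] {f g : XA n →ₗ[ℂ] M} (h : ∀ S, f (eS S) = g (eS S))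
    (x : XA n) : f x = g x := by
  have : f = g := eB.ext fun S => by rw [eB_apply]; exact h S
  rw [this]

lemma pr_one_zero : pr 0 (1 : XA n) = 1 := by rw [← eS_empty, pr_eS]; simp

lemma pr_one_succ (q : ℕ) : pr (q+1) (1 : XA n) = 0 := by rw [← eS_empty, pr_eS]; simp

lemma pr_eg_succ (q : ℕ) (j : Fin n) (x : XA n) : pr (q+1) (eg j * x) = eg j * pr q x := by
  refine eS_ext (f := pr (q+1) ∘ₗ LinearMap.mulLeft ℂ (eg j)) (g := LinearMap.mulLeft ℂ (eg j) ∘ₗ pr q) (fun S => ?_) x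
  show pr (q+1) (eg j * eS S) = eg j * pr q (eS S)
  rw [pr_eS, eg_eS]
  by_cases hj : j ∈ S
  · rw [if_pos hj, map_zero]
    split_ifs
    · rw [eg_eS, if_pos hj]
    · rw [mul_zero]
  · rw [if_neg hj, map_smul, pr_eS, Finset.card_insert_of_notMem hj]
    by_cases hc : S.card = q
    · rw [if_pos hc, if_pos (by rw [hc]), eg_eS, if_neg hj]
    · rw [if_neg hc, if_neg (by omega), smul_zero, mul_zero]

lemma pr_eg_zero (j : Fin n) (x : XA n) : pr 0 (eg j * x) = 0 := by
  refine eS_ext (f := pr 0 ∘ₗ LinearMap.mulLeft ℂ (eg j)) (g := 0) (fun S => ?_) x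
  show pr 0 (eg j * eS S) = 0
  rw [eg_eS]
  split_ifs with hj
  · rw [map_zero]
  · rw [map_smul, pr_eS, Finset.card_insert_of_notMem hj, if_neg (by omega), smul_zero]

lemma pr_em (q : ℕ) (L : List (Fin n)) : pr q (em L) = if L.length = q then em L else 0 := by
  induction L generalizing q with
  | nil =>
    cases q with
    | zero => simp [pr_one_zero]
    | succ q => simp [pr_one_succ]
  | cons j L ih =>
    cases q with
    | zero => rw [em_cons, pr_eg_zero]; simp
    | succ q =>
      rw [em_cons, pr_eg_succ, ih]
      simp

lemma ctr_eg (θ : Module.Dual ℂ (Fin n → ℂ)) (j : Fin n) (x : XA n) :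
    ctr θ (eg j * x) = θ (Pi.single j 1) • x - eg j * ctr θ x :=
  CliffordAlgebra.contractLeft_ι_mul (Q := (0 : QuadraticForm ℂ (Fin n → ℂ))) θ (Pi.single j 1) x

lemma ctr_one (θ : Module.Dual ℂ (Fin n → ℂ)) : ctr θ (1 : XA n) = 0 :=
  CliffordAlgebra.contractLeft_one (Q := (0 : QuadraticForm ℂ (Fin n → ℂ))) (d := θ)

lemma ctr_pr_zero (θ : Module.Dual ℂ (Fin n → ℂ)) (x : XA n) : ctr θ (pr 0 x) = 0 := by
  refine XA_ext (f := ctr θ ∘ₗ pr 0) (g := 0) ?_ (fun j x _ => ?_) x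
  · show ctr θ (pr 0 1) = 0
    rw [pr_one_zero, ctr_one]
  · show ctr θ (pr 0 (eg j * x)) = 0
    rw [pr_eg_zero, map_zero]

lemma pr_ctr (θ : Module.Dual ℂ (Fin n → ℂ)) (q : ℕ) (x : XA n) : pr q (ctr θ x) = ctr θ (pr (q+1) x) := by
  have : ∀ q, pr q (ctr θ x) = ctr θ (pr (q+1) x) := by
    suffices h : x ∈ ⨅ q, LinearMap.eqLocus (pr q ∘ₗ ctr θ) (ctr θ ∘ₗ pr (q+1)) from
      fun q => (Submodule.mem_iInf _).1 h q
    refine XA_ind ?_ ?_ x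
    · rw [Submodule.mem_iInf]
      intro q
      show pr q (ctr θ 1) = ctr θ (pr (q+1) 1)
      rw [pr_one_succ, ctr_one, map_zero, map_zero]
    · intro j x hx
      rw [Submodule.mem_iInf] at hx ⊢
      intro q
      show pr q (ctr θ (eg j * x)) = ctr θ (pr (q+1) (eg j * x))
      rw [pr_eg_succ, ctr_eg, ctr_eg, map_sub, map_smul]
      congr 1
      cases q with
      | zero => rw [pr_eg_zero, ctr_pr_zero, mul_zero]
      | succ q =>
        rw [pr_eg_succ]
        congr 1
        exact hx q
  exact this q

lemma pr_bd (q : ℕ) (x : XA n) : pr q (bd x) = bd (pr (q+1) x) := pr_ctr _ q x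

lemma pr_pr (q : ℕ) (x : XA n) : pr q (pr q x) = pr q x := by
  refine eS_ext (f := pr q ∘ₗ pr q) (g := pr q) (fun S => ?_) x
  show pr q (pr q (eS S)) = _
  by_cases h : S.card = q
  · rw [pr_eS, if_pos h, pr_eS, if_pos h]
  · rw [pr_eS, if_neg h, map_zero]

lemma em_dup {L : List (Fin n)} (h : ¬ L.Nodup) : em L = 0 := by
  induction L with
  | nil => simp at h
  | cons j L ih =>
    rw [List.nodup_cons, not_and_or, not_not] at h
    rw [em_cons]
    rcases h with h | h
    · obtain ⟨s, t, rfl⟩ := List.append_of_mem h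
      obtain ⟨ε, _, e⟩ := em_perm (List.perm_middle : (s ++ j :: t).Perm (j :: (s ++ t)))
      rw [e, em_cons, mul_smul_comm, ← mul_assoc, eg_sq, zero_mul, smul_zero]
    · rw [ih h, mul_zero]

lemma em_eS (L : List (Fin n)) : ∃ ε : ℂ, em L = ε • eS L.toFinset := by
  by_cases h : L.Nodup
  · obtain ⟨ε, _, e⟩ := em_perm (L := L) (L' := L.toFinset.sort (· ≤ ·))
      ((List.toFinset_toList h).symm.trans (Finset.sort_perm_toList _ _).symm)
    exact ⟨ε, e⟩
  · exact ⟨0, by rw [em_dup h, zero_smul]⟩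

lemma bd_eS (S : Finset (Fin n)) : bd (eS S) = ∑ j ∈ S, (-1 : ℂ) ^ posIn j (S.erase j) • eS (S.erase j) := by
  induction S using Finset.induction_on_min with
  | empty => rw [eS_empty, bd_one, Finset.sum_empty]
  | insert a S h ih =>
    have haS : a ∉ S := fun ha => lt_irrefl _ (h a ha)
    rw [eS_insert h, bd_eg, ih, Finset.sum_insert haS, Finset.erase_insert haS, posIn_zero h, pow_zero, one_smul,
      sub_eq_add_neg, Finset.mul_sum, ← Finset.sum_neg_distrib]
    congr 1
    refine Finset.sum_congr rfl fun j hj => ?_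
    have hja := h j hj
    have ha' : a ∉ S.erase j := fun h => haS (Finset.mem_of_mem_erase h)
    rw [Finset.erase_insert_of_ne hja.ne, posIn_insert hja ha', eS_insert (fun x hx => h x (Finset.mem_of_mem_erase hx)),
      mul_smul_comm, pow_succ]
    simp

lemma eS_mul (U T : Finset (Fin n)) : eS U * eS T =
    if Disjoint U T then ((shuffleSign U T : ℤ) : ℂ) • eS (U ∪ T) else 0 := by
  induction U using Finset.induction_on_min with
  | empty => simp [eS_empty, shuffleSign]
  | insert a U h ih =>
    have haU : a ∉ U := fun ha => lt_irrefl _ (h a ha)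
    rw [eS_insert h, mul_assoc, ih]
    simp only [Finset.disjoint_insert_left]
    by_cases hd : Disjoint U T
    · rw [if_pos hd, mul_smul_comm, eg_eS]
      by_cases haT : a ∈ T
      · rw [if_pos (Finset.mem_union_right _ haT), smul_zero, if_neg (fun h => h.1 haT)]
      · rw [if_neg (by simp [haU, haT]), if_pos ⟨haT, hd⟩, smul_smul, Finset.insert_union]
        congr 1
        have h1 : posIn a (U ∪ T) = (T.filter (· < a)).card := by
          rw [posIn]
          congr 1
          ext x
          simp only [Finset.mem_filter, Finset.mem_union]
          constructor
          · rintro ⟨hx | hx, hlt⟩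
            · exact absurd hlt (h x hx).not_gt
            · exact ⟨hx, hlt⟩
          · rintro ⟨hx, hlt⟩
            exact ⟨Or.inr hx, hlt⟩
        have h2 : (((insert a U) ×ˢ T).filter fun p => p.2 < p.1).card =
            ((U ×ˢ T).filter fun p => p.2 < p.1).card + (T.filter (· < a)).card := by
          have : ((insert a U) ×ˢ T).filter (fun p => p.2 < p.1) =
              ((U ×ˢ T).filter fun p => p.2 < p.1) ∪ ((T.filter (· < a)).image fun t => (a, t)) := by
            ext ⟨x, y⟩
            simp only [Finset.mem_filter, Finset.mem_union, Finset.mem_product, Finset.mem_insert, Finset.mem_image,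
              Prod.mk.injEq]
            constructor
            · rintro ⟨⟨rfl | hx, hy⟩, hlt⟩
              · exact Or.inr ⟨y, ⟨hy, hlt⟩, rfl, rfl⟩
              · exact Or.inl ⟨⟨hx, hy⟩, hlt⟩
            · rintro (⟨⟨hx, hy⟩, hlt⟩ | ⟨_, ⟨hy, hlt⟩, rfl, rfl⟩)
              · exact ⟨⟨Or.inr hx, hy⟩, hlt⟩
              · exact ⟨⟨Or.inl rfl, hy⟩, hlt⟩
          rw [this, Finset.card_union_of_disjoint, Finset.card_image_of_injective]
          · intro x y hxy
            exact (Prod.mk.inj hxy).2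
          · rw [Finset.disjoint_left]
            rintro ⟨x, y⟩ hx hy
            simp only [Finset.mem_filter, Finset.mem_product, Finset.mem_image, Prod.mk.injEq] at hx hy
            obtain ⟨_, _, rfl, _⟩ := hy
            exact haU hx.1.1
        rw [h1, shuffleSign, shuffleSign, h2, pow_add]
        push_cast
        rfl
    · rw [if_neg hd, mul_zero, if_neg (fun h => hd h.2)]

/-- from coordinates to the exterior algebra -/
def Ph (q : ℕ) : ExtDeg n q ℂ →ₗ[ℂ] XA n := ∑ V, (LinearMap.proj V).smulRight (eS V.1)

lemma Ph_apply (q : ℕ) (f : ExtDeg n q ℂ) : Ph q f = ∑ V, f V • eS V.1 := by simp [Ph]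

lemma Ph_inj {q : ℕ} {f : ExtDeg n q ℂ} (h : Ph q f = 0) : f = 0 := by
  have h1 : LinearIndependent ℂ (fun V : {S : Finset (Fin n) // S.card = q} => eS V.1) := by
    have := (eB (n := n)).linearIndependent.comp (fun V : {S : Finset (Fin n) // S.card = q} => V.1)
      Subtype.val_injective
    convert this using 1
    funext V
    exact (eB_apply _).symm
  rw [Ph_apply] at h
  exact funext (Fintype.linearIndependent_iff.1 h1 f h)

lemma pr_Ph (q : ℕ) (f : ExtDeg n q ℂ) : pr q (Ph q f) = Ph q f := by
  rw [Ph_apply, map_sum]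
  refine Finset.sum_congr rfl fun V _ => ?_
  rw [map_smul, pr_eS, if_pos V.2]

lemma Ph_single (q : ℕ) (V : {S : Finset (Fin n) // S.card = q}) : Ph q (Pi.single V 1) = eS V.1 := by
  rw [Ph_apply, Finset.sum_eq_single V]
  · simp
  · intro W _ hW
    rw [Pi.single_eq_of_ne hW, zero_smul]
  · simp

lemma Ph_basisVec (q : ℕ) (V : {S : Finset (Fin n) // S.card = q}) : Ph q (osBasisVec V) = eS V.1 := by
  rw [← Ph_single]
  congr 1
  funext W
  simp [osBasisVec, Pi.single_apply]

lemma Ph_wedge (q : ℕ) (j : Fin n) (f : ExtDeg n q ℂ) : Ph (q+1) (wedgeGen ℂ q j f) = eg j * Ph q f := by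
  have : Ph (q+1) ∘ₗ wedgeGen ℂ q j = LinearMap.mulLeft ℂ (eg j) ∘ₗ Ph q := by
    refine LinearMap.pi_ext' fun V => LinearMap.ext_ring ?_
    show Ph (q+1) (wedgeGen ℂ q j (Pi.single V 1)) = eg j * Ph q (Pi.single V 1)
    rw [Ph_single, eg_eS, Ph_apply]
    have hw : ∀ W : {S : Finset (Fin n) // S.card = q+1}, wedgeGen ℂ q j (Pi.single V 1) W =
        if j ∈ W.1 ∧ W.1.erase j = V.1 then (-1 : ℂ) ^ posIn j V.1 else 0 := by
      intro W
      show (if h : j ∈ W.1 then _ else _) = _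
      by_cases h : j ∈ W.1
      · rw [dif_pos h]
        by_cases h' : W.1.erase j = V.1
        · rw [if_pos ⟨h, h'⟩]
          have : (⟨W.1.erase j, by simp [Finset.card_erase_of_mem h, W.2]⟩ : {S : Finset (Fin n) // S.card = q}) = V :=
            Subtype.ext h'
          rw [this, Pi.single_eq_same, mul_one, h']
        · rw [if_neg (fun hh => h' hh.2), Pi.single_eq_of_ne, mul_zero]
          exact fun hh => h' (congrArg Subtype.val hh)
      · rw [dif_neg h, if_neg (fun hh => h hh.1)]
    simp only [hw]
    split_ifs with hj
    · refine Finset.sum_eq_zero fun W _ => ?_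
      rw [if_neg, zero_smul]
      rintro ⟨_, h⟩
      rw [← h] at hj
      simp at hj
    · rw [Finset.sum_eq_single ⟨insert j V.1, by rw [Finset.card_insert_of_notMem hj, V.2]⟩]
      · rw [if_pos ⟨Finset.mem_insert_self _ _, Finset.erase_insert hj⟩]
      · intro W _ hW
        rw [if_neg, zero_smul]
        rintro ⟨h1, h2⟩
        apply hW
        apply Subtype.ext
        show W.1 = insert j V.1
        rw [← h2, Finset.insert_erase h1]
      · simp
  exact LinearMap.congr_fun this f

lemma Ph_dLam (lam : Fin n → ℂ) (q : ℕ) (f : ExtDeg n q ℂ) :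
    Ph (q+1) (dLam lam q f) = (∑ j, lam j • eg j) * Ph q f := by
  simp only [dLam, LinearMap.sum_apply, LinearMap.smul_apply, map_sum, map_smul, Ph_wedge, Finset.sum_mul, smul_mul_assoc]

lemma Ph_surj (q : ℕ) (x : XA n) : ∃ f, Ph q f = pr q x := by
  have : ∀ q, pr q x ∈ LinearMap.range (Ph (n := n) q) := by
    suffices h : x ∈ ⨅ q, (LinearMap.range (Ph (n := n) q)).comap (pr q) from
      fun q => (Submodule.mem_iInf _).1 h q
    refine XA_ind ?_ ?_ x
    · rw [Submodule.mem_iInf]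
      intro q
      rw [Submodule.mem_comap]
      cases q with
      | zero => exact ⟨Pi.single ⟨∅, rfl⟩ 1, by rw [pr_one_zero, Ph_single, eS_empty]⟩
      | succ q => rw [pr_one_succ]; exact zero_mem _
    · intro j x hx
      rw [Submodule.mem_iInf] at hx ⊢
      intro q
      rw [Submodule.mem_comap]
      cases q with
      | zero => rw [pr_eg_zero]; exact zero_mem _
      | succ q =>
        obtain ⟨f, hf⟩ := hx q
        exact ⟨wedgeGen ℂ q j f, by rw [Ph_wedge, hf, pr_eg_succ]⟩
  exact this q

lemma Ph_osGen (S U : Finset (Fin n)) (q : ℕ) : Ph q (osGen S U q) = pr q (eS U * bd (eS S)) := by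
  rw [bd_eS, Finset.mul_sum, map_sum, Ph_apply]
  simp only [osGen, Finset.sum_smul]
  rw [Finset.sum_comm]
  refine Finset.sum_congr rfl fun j _ => ?_
  rw [mul_smul_comm, eS_mul, map_smul]
  by_cases hd : Disjoint U (S.erase j)
  · rw [if_pos hd, map_smul, pr_eS]
    by_cases hc : (U ∪ S.erase j).card = q
    · rw [if_pos hc, Finset.sum_eq_single ⟨_, hc⟩]
      · rw [if_pos ⟨hd, rfl⟩, mul_smul]
      · intro V _ hV
        rw [if_neg, zero_smul]
        rintro ⟨_, h⟩
        exact hV (Subtype.ext h)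
      · simp
    · rw [if_neg hc, smul_zero, smul_zero]
      refine Finset.sum_eq_zero fun V _ => ?_
      rw [if_neg, zero_smul]
      rintro ⟨_, h⟩
      exact hc (h ▸ V.2)
  · rw [if_neg hd, map_zero, smul_zero]
    refine Finset.sum_eq_zero fun V _ => ?_
    rw [if_neg (fun h => hd h.1), zero_smul]

end mono
end RV

end

noncomputable section
namespace RV

section ker
variable {n l : ℕ} {α : Fin n → Aff l}

lemma OId_pr (q : ℕ) {x : XA n} (hx : x ∈ OId α Finset.univ) : pr q x ∈ OId α Finset.univ := by
  have : OId α Finset.univ ≤ ⨅ q, (OId α Finset.univ).comap (pr q) := by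
    conv_lhs => rw [OId]
    rw [Submodule.span_le]
    intro x hx
    show x ∈ ⨅ q, (OId α Finset.univ).comap (pr q)
    rw [Submodule.mem_iInf]
    induction hx with
    | dep L hT hz hd =>
      intro q
      rw [Submodule.mem_comap, pr_bd, pr_em]
      split_ifs
      · exact Submodule.subset_span (IdGen.dep L hT hz hd)
      · rw [map_zero]; exact zero_mem _
    | emp L hT hz =>
      intro q
      rw [Submodule.mem_comap, pr_em]
      split_ifs
      · exact Submodule.subset_span (IdGen.emp L hT hz)
      · exact zero_mem _
    | mul j hj x _ ih =>
      intro q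
      rw [Submodule.mem_comap]
      cases q with
      | zero => rw [pr_eg_zero]; exact zero_mem _
      | succ q => rw [pr_eg_succ]; exact OId_mul hj (ih q)
  exact (Submodule.mem_iInf _).1 (this hx) q

variable {dep emp : Finset (Fin n) → Prop}

lemma osIdeal_OId (hdep : ∀ S, dep S ↔ CZ α S ∧ DepL α S) (hemp : ∀ S, emp S ↔ ¬ CZ α S) {q : ℕ}
    {f : ExtDeg n q ℂ} (hf : f ∈ osIdeal dep emp q) : Ph q f ∈ OId α Finset.univ := by
  have : osIdeal dep emp q ≤ (OId α Finset.univ).comap (Ph q) := by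
    rw [osIdeal, Submodule.span_le]
    rintro _ (⟨S, U, hS, rfl⟩ | ⟨W, ⟨S, hSW, hS⟩, rfl⟩)
    · show Ph q (osGen S U q) ∈ OId α Finset.univ
      rw [Ph_osGen]
      refine OId_pr q (OId_em (fun _ _ => Finset.mem_univ _) (Submodule.subset_span ?_))
      refine IdGen.dep _ (fun _ _ => Finset.mem_univ _) ?_ ?_
      · rw [Finset.sort_toFinset]; exact ((hdep S).1 hS).1
      · rw [Finset.sort_toFinset]; exact ((hdep S).1 hS).2
    · show Ph q (osBasisVec W) ∈ OId α Finset.univ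
      rw [Ph_basisVec]
      refine Submodule.subset_span (IdGen.emp _ (fun _ _ => Finset.mem_univ _) ?_)
      rw [Finset.sort_toFinset]
      rintro ⟨u, hu⟩
      exact (hemp S).1 hS ⟨u, fun j hj => hu j (hSW hj)⟩
  exact this hf

lemma osIdeal_wedge {q : ℕ} (j : Fin n) {f : ExtDeg n q ℂ} (hf : f ∈ osIdeal dep emp q) :
    wedgeGen ℂ q j f ∈ osIdeal dep emp (q+1) := by
  have : osIdeal dep emp q ≤ (osIdeal dep emp (q+1)).comap (wedgeGen ℂ q j) := by
    conv_lhs => rw [osIdeal]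
    rw [Submodule.span_le]
    have inj : ∀ (c : ℂ) (f g : ExtDeg n (q+1) ℂ), Ph (q+1) f = c • Ph (q+1) g → f = c • g := by
      intro c f g h
      rw [← sub_eq_zero]
      apply Ph_inj
      rw [map_sub, map_smul, h, sub_self]
    rintro _ (⟨S, U, hS, rfl⟩ | ⟨W, ⟨S, hSW, hS⟩, rfl⟩)
    · show wedgeGen ℂ q j (osGen S U q) ∈ osIdeal dep emp (q+1)
      have e : ∃ c : ℂ, wedgeGen ℂ q j (osGen S U q) = c • osGen S (insert j U) (q+1) := by
        by_cases hj : j ∈ U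
        · refine ⟨0, inj _ _ _ ?_⟩
          rw [Ph_wedge, Ph_osGen, ← pr_eg_succ, ← mul_assoc, eg_eS, if_pos hj, zero_mul, map_zero, zero_smul]
        · refine ⟨(-1) ^ posIn j U, inj _ _ _ ?_⟩
          rw [Ph_wedge, Ph_osGen, ← pr_eg_succ, ← mul_assoc, eg_eS, if_neg hj, smul_mul_assoc, map_smul, Ph_osGen]
      obtain ⟨c, e⟩ := e
      rw [e]
      exact Submodule.smul_mem _ _ (Submodule.subset_span (Or.inl ⟨S, _, hS, rfl⟩))
    · show wedgeGen ℂ q j (osBasisVec W) ∈ osIdeal dep emp (q+1)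
      by_cases hj : j ∈ W.1
      · have : wedgeGen ℂ q j (osBasisVec W) = 0 := by
          apply Ph_inj
          rw [Ph_wedge, Ph_basisVec, eg_eS, if_pos hj]
        rw [this]; exact zero_mem _
      · have : wedgeGen ℂ q j (osBasisVec W) = (-1 : ℂ) ^ posIn j W.1 •
            osBasisVec ⟨insert j W.1, by rw [Finset.card_insert_of_notMem hj, W.2]⟩ := by
          apply inj
          rw [Ph_wedge, Ph_basisVec, eg_eS, if_neg hj, Ph_basisVec]
        rw [this]
        exact Submodule.smul_mem _ _ (Submodule.subset_span (Or.inr ⟨_,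
          ⟨S, hSW.trans (Finset.subset_insert _ _), hS⟩, rfl⟩))
  exact this hf

lemma OId_osIdeal (hdep : ∀ S, dep S ↔ CZ α S ∧ DepL α S) (hemp : ∀ S, emp S ↔ ¬ CZ α S) {q : ℕ}
    {f : ExtDeg n q ℂ} (hf : Ph q f ∈ OId α Finset.univ) : f ∈ osIdeal dep emp q := by
  have : OId α Finset.univ ≤ ⨅ q, ((osIdeal dep emp q).map (Ph q)).comap (pr q) := by
    conv_lhs => rw [OId]
    rw [Submodule.span_le]
    intro x hx
    show x ∈ ⨅ q, ((osIdeal dep emp q).map (Ph q)).comap (pr q)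
    rw [Submodule.mem_iInf]
    induction hx with
    | dep L hT hz hd =>
      intro q
      rw [Submodule.mem_comap]
      obtain ⟨ε, e⟩ := em_eS L
      rw [e, map_smul, map_smul]
      refine Submodule.smul_mem _ _ ⟨osGen L.toFinset ∅ q, Submodule.subset_span (Or.inl ⟨_, _, (hdep _).2 ⟨hz, hd⟩, rfl⟩), ?_⟩
      rw [Ph_osGen, eS_empty, one_mul]
    | emp L hT hz =>
      intro q
      rw [Submodule.mem_comap]
      obtain ⟨ε, e⟩ := em_eS L
      rw [e, map_smul, pr_eS]
      split_ifs with h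
      · exact Submodule.smul_mem _ _ ⟨osBasisVec ⟨_, h⟩, Submodule.subset_span (Or.inr ⟨_, ⟨_, subset_rfl,
          (hemp _).2 hz⟩, rfl⟩), Ph_basisVec _ _⟩
      · rw [smul_zero]; exact zero_mem _
    | mul j hj x _ ih =>
      intro q
      rw [Submodule.mem_comap]
      cases q with
      | zero => rw [pr_eg_zero]; exact zero_mem _
      | succ q =>
        obtain ⟨g, hg, e⟩ := ih q
        rw [pr_eg_succ, ← e]
        exact ⟨_, osIdeal_wedge j hg, Ph_wedge _ _ _⟩
  obtain ⟨g, hg, e⟩ := (Submodule.mem_iInf _).1 (this hf) q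
  rw [pr_Ph] at e
  have : g = f := by
    rw [← sub_eq_zero]
    apply Ph_inj
    rw [map_sub, e, sub_self]
  rwa [← this]

lemma psi_ker (h0 : ∀ j, α j ≠ 0) (hdep : ∀ S, dep S ↔ CZ α S ∧ DepL α S) (hemp : ∀ S, emp S ↔ ¬ CZ α S) {q : ℕ}
    {f : ExtDeg n q ℂ} : psi α (Ph q f) = 0 ↔ f ∈ osIdeal dep emp q :=
  ⟨fun h => OId_osIdeal hdep hemp (psi_inj Finset.univ l α (fun j _ => h0 j) _ (FT_univ _) h),
   fun h => psi_OId (fun j _ => h0 j) (osIdeal_OId hdep hemp h)⟩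

end ker

section degree
variable {l : ℕ}

/-- degree projections on forms -/
def PiF (q : ℕ) : Form l →ₗ[ℂ] Form l := LinearMap.lcomp ℂ (KK l) (pr q)

lemma PiF_apply (q : ℕ) (z : Form l) (x : XA l) : PiF q z x = z (pr q x) := rfl

lemma PiF_EE_succ (q : ℕ) (θ : Module.Dual ℂ (Fin l → ℂ)) (z : Form l) : PiF (q+1) (EE θ z) = EE θ (PiF q z) := by
  refine LinearMap.ext fun x => ?_
  rw [PiF_apply, EE_apply, EE_apply, PiF_apply, pr_ctr]

lemma PiF_EE_zero (θ : Module.Dual ℂ (Fin l → ℂ)) (z : Form l) : PiF 0 (EE θ z) = 0 := by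
  refine LinearMap.ext fun x => ?_
  rw [PiF_apply, EE_apply, ctr_pr_zero, map_zero]; rfl

lemma PiF_ksmul (q : ℕ) (c : KK l) (z : Form l) : PiF q (c • z) = c • PiF q z := rfl

lemma PiF_DF (q : ℕ) (j : Fin l) (z : Form l) : PiF q (DF j z) = DF j (PiF q z) := rfl

lemma dd_eq_sum (z : Form l) : dd z = ∑ j, DF j (EE (dx j) z) := by simp [dd]

lemma PiF_dd_succ (q : ℕ) (z : Form l) : PiF (q+1) (dd z) = dd (PiF q z) := by
  rw [dd_eq_sum, dd_eq_sum, map_sum]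
  exact Finset.sum_congr rfl fun j _ => by rw [PiF_DF, PiF_EE_succ]

lemma PiF_dd_zero (z : Form l) : PiF 0 (dd z) = 0 := by
  rw [dd_eq_sum, map_sum]
  exact Finset.sum_eq_zero fun j _ => by rw [PiF_DF, PiF_EE_zero, map_zero]

lemma PiF_wl_succ (q : ℕ) (a : Aff l) (z : Form l) : PiF (q+1) (wl a z) = wl a (PiF q z) := by
  rw [wl_def, wl_def, PiF_ksmul, PiF_EE_succ]

lemma PiF_wl_zero (a : Aff l) (z : Form l) : PiF 0 (wl a z) = 0 := by
  rw [wl_def, PiF_ksmul, PiF_EE_zero, smul_zero]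

lemma oneF_eg (j : Fin l) (x : XA l) : oneF l (eg j * x) = 0 := by
  simp [oneF, ExteriorAlgebra.algebraMapInv, eg]

lemma PiF_one_zero : PiF 0 (oneF l) = oneF l := by
  refine LinearMap.ext fun x => ?_
  refine XA_ext (f := PiF 0 (oneF l)) (g := oneF l) ?_ (fun j x _ => ?_) x
  · rw [PiF_apply, pr_one_zero]
  · rw [PiF_apply, pr_eg_zero, oneF_eg, map_zero]

lemma PiF_one_succ (q : ℕ) : PiF (q+1) (oneF l) = 0 := by
  refine LinearMap.ext fun x => ?_
  refine XA_ext (f := PiF (q+1) (oneF l)) (g := 0) ?_ (fun j x _ => ?_) x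
  · rw [PiF_apply, pr_one_succ, map_zero]; rfl
  · rw [PiF_apply, pr_eg_succ, oneF_eg]; rfl

lemma PiF_Om (q : ℕ) {A : Set (Aff l)} {z : Form l} (hz : z ∈ Om A) : PiF q z ∈ Om A := fun x => hz (pr q x)

lemma PiF_PiF (q : ℕ) (z : Form l) : PiF q (PiF q z) = PiF q z := by
  refine LinearMap.ext fun x => ?_
  rw [PiF_apply, PiF_apply, PiF_apply, pr_pr]

lemma PiF_psi {n : ℕ} (α : Fin n → Aff l) (q : ℕ) (x : XA n) : PiF q (psi α x) = psi α (pr q x) := by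
  suffices h : x ∈ ⨅ q, LinearMap.eqLocus (PiF q ∘ₗ psi α) (psi α ∘ₗ pr q) from (Submodule.mem_iInf _).1 h q
  refine XA_ind ?_ ?_ x
  · rw [Submodule.mem_iInf]
    intro q
    show PiF q (psi α 1) = psi α (pr q 1)
    cases q with
    | zero => rw [pr_one_zero, psi_one, PiF_one_zero]
    | succ q => rw [pr_one_succ, psi_one, PiF_one_succ, map_zero]
  · intro j x hx
    rw [Submodule.mem_iInf] at hx ⊢
    intro q
    show PiF q (psi α (eg j * x)) = psi α (pr q (eg j * x))
    cases q with
    | zero => rw [pr_eg_zero, psi_eg, PiF_wl_zero, map_zero]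
    | succ q =>
      rw [pr_eg_succ, psi_eg, psi_eg, PiF_wl_succ]
      exact congrArg _ (hx q)

end degree
end RV

end

noncomputable section
namespace RV

def qdim {V : Type*} [AddCommGroup V] [Module ℂ V] (Z B : Submodule ℂ V) : ℕ :=
  Module.finrank ℂ (↥Z ⧸ Submodule.comap Z.subtype B)

lemma quot_finrank {V W : Type*} [AddCommGroup V] [Module ℂ V] [AddCommGroup W] [Module ℂ W]
    (Z B : Submodule ℂ V) (Z' B' : Submodule ℂ W) (g : V →ₗ[ℂ] W) (hg : ∀ z ∈ Z, g z ∈ Z')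
    (hk : ∀ z ∈ Z, (g z ∈ B' ↔ z ∈ B)) (hs : ∀ w ∈ Z', ∃ z ∈ Z, w - g z ∈ B') :
    qdim Z B = qdim Z' B' := by
  unfold qdim
  let T : Z →ₗ[ℂ] (↥Z' ⧸ Submodule.comap Z'.subtype B') :=
    (Submodule.mkQ _) ∘ₗ (LinearMap.restrict g hg)
  have hT : Function.Surjective T := by
    intro w
    obtain ⟨w, rfl⟩ := Submodule.mkQ_surjective _ w
    obtain ⟨z, hz, h⟩ := hs w.1 w.2
    refine ⟨⟨z, hz⟩, ?_⟩
    refine Eq.symm ((Submodule.Quotient.eq _).2 ?_)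
    exact h
  have hker : LinearMap.ker T = Submodule.comap Z.subtype B := by
    ext z
    rw [LinearMap.mem_ker]
    refine (Submodule.Quotient.mk_eq_zero _).trans ?_
    exact hk z.1 z.2
  rw [← hker]
  exact (T.quotKerEquivOfSurjective hT).finrank_eq

variable {n l : ℕ}

def ns (α : Fin n → Aff l) (lam : Fin n → ℂ) : Form l →ₗ[ℂ] Form l := dd + ∑ j, lam j • wl (α j)

lemma ns_apply (α : Fin n → Aff l) (lam : Fin n → ℂ) (z : Form l) :
    ns α lam z = dd z + ∑ j, lam j • wl (α j) z := by simp [ns]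

lemma PiF_ns_succ (α : Fin n → Aff l) (lam : Fin n → ℂ) (q : ℕ) (z : Form l) :
    PiF (q+1) (ns α lam z) = ns α lam (PiF q z) := by
  simp [ns_apply, PiF_dd_succ, PiF_wl_succ]

lemma PiF_ns_zero (α : Fin n → Aff l) (lam : Fin n → ℂ) (z : Form l) :
    PiF 0 (ns α lam z) = 0 := by
  simp [ns_apply, PiF_dd_zero, PiF_wl_zero]

lemma nab_unit (α : Fin n → Aff l) (lam : Fin n → ℂ) (z : VF Unit l) (k : Unit) :
    nab α (fun j => lam j • (1 : Matrix Unit Unit ℂ)) z k = ns α lam (z ()) := by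
  rw [nab_apply, aa_apply, ns_apply]
  simp [cw, mm_apply]

lemma flat_unit (α : Fin n → Aff l) (lam : Fin n → ℂ) :
    Flat α (fun j => lam j • (1 : Matrix Unit Unit ℂ)) := by
  intro z
  have h : ∀ z : VF Unit l, ∀ k, aa α (fun j => lam j • (1 : Matrix Unit Unit ℂ)) z k = ∑ j, lam j • wl (α j) (z ()) := by
    intro z k
    rw [aa_apply]
    simp [cw, mm_apply]
  ext1 k
  rw [h, h]
  exact rep_aux α lam _

lemma ns_ns (α : Fin n → Aff l) (lam : Fin n → ℂ) (z : Form l) : ns α lam (ns α lam z) = 0 := by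
  have := congrFun (nab_nab α _ (flat_unit α lam) (fun _ => z)) ()
  rw [nab_unit, nab_unit] at this
  exact this

lemma ns_Om (α : Fin n → Aff l) (lam : Fin n → ℂ) {z : Form l} (hz : z ∈ Om (Set.range α)) :
    ns α lam z ∈ Om (Set.range α) := by
  rw [ns_apply]
  exact add_mem (Om_dd hz) (Submodule.sum_mem _ fun j _ => Submodule.smul_mem _ _ (Om_wl (Set.mem_range_self j) hz))

/-- the nonresonance condition -/
def Star (lam : Fin n → ℂ) : Prop := ∀ (S : Finset (Fin n)) (k : ℤ), ∑ j ∈ S, lam j = k → k = 0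

lemma ns_claim (α : Fin n → Aff l) (h0 : ∀ j, α j ≠ 0) (lam : Fin n → ℂ) (hs : Star lam) {y : Form l}
    (hy : y ∈ Om (Set.range α)) (hn : ns α lam y ∈ Br (Set.range α)) :
    ∃ y' ∈ Om (Set.range α), y - ns α lam y' ∈ Br (Set.range α) := by
  let G : Set ℂ := {μ | ∃ S : Finset (Fin n), μ = ∑ j ∈ S, lam j}
  have hG : GoodG G := by
    refine ⟨⟨∅, by simp⟩, ?_⟩
    rintro k ⟨S, hS⟩
    exact hs S k hS.symm
  have hE : ∀ S : Finset (Fin n), EigIn G (∑ i ∈ S, lam i • (1 : Matrix Unit Unit ℂ)) := by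
    intro S μ x hx e
    refine ⟨S, ?_⟩
    rw [← Finset.sum_smul, Matrix.smul_mulVec, Matrix.one_mulVec] at e
    exact (smul_left_injective ℂ hx e).symm
  obtain ⟨y', h1, h2⟩ := claim_all hG l (Set.range α) (Set.finite_range α)
    (by rintro ⟨j, hj⟩; exact h0 j hj) (Fin n) Unit α (fun j => lam j • (1 : Matrix Unit Unit ℂ))
    (fun i => ⟨i, rfl⟩) (flat_unit α lam) ⟨fun u => hE _, fun v => hE _⟩ (fun _ => y)
    (mem_pv.2 fun _ => hy) (mem_pv.2 fun k => by rw [nab_unit]; exact hn)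
  refine ⟨y' (), mem_pv.1 h1 (), ?_⟩
  have := mem_pv.1 h2 ()
  rw [Pi.sub_apply, nab_unit] at this
  exact this

def ZO (α : Fin n → Aff l) (lam : Fin n → ℂ) (q : ℕ) : Submodule ℂ (Form l) :=
  Om (Set.range α) ⊓ LinearMap.ker (ns α lam) ⊓ LinearMap.ker (PiF q - LinearMap.id)

lemma mem_ZO {α : Fin n → Aff l} {lam : Fin n → ℂ} {q : ℕ} {z : Form l} :
    z ∈ ZO α lam q ↔ z ∈ Om (Set.range α) ∧ ns α lam z = 0 ∧ PiF q z = z := by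
  simp [ZO, sub_eq_zero, and_assoc]

def BO (α : Fin n → Aff l) (lam : Fin n → ℂ) : Submodule ℂ (Form l) := (Om (Set.range α)).map (ns α lam)

lemma mem_BO {α : Fin n → Aff l} {lam : Fin n → ℂ} {z : Form l} :
    z ∈ BO α lam ↔ ∃ y ∈ Om (Set.range α), ns α lam y = z := by
  simp [BO]

lemma psi_Br (α : Fin n → Aff l) (x : XA n) : psi α x ∈ Br (Set.range α) :=
  psi_FT (T := Finset.univ) (fun j _ => Set.mem_range_self j) (FT_univ _)

lemma ns_psi (α : Fin n → Aff l) (lam : Fin n → ℂ) (q : ℕ) (f : ExtDeg n q ℂ) :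
    ns α lam (psi α (Ph q f)) = psi α (Ph (q+1) (dLam lam q f)) := by
  rw [Ph_dLam, ns_apply, dd_Br (psi_Br α _), zero_add, Finset.sum_mul, map_sum]
  refine Finset.sum_congr rfl fun j _ => ?_
  rw [smul_mul_assoc, map_smul, psi_eg]

theorem os_finrank {α : Fin n → Aff l} (h0 : ∀ j, α j ≠ 0) {dep emp : Finset (Fin n) → Prop}
    (hdep : ∀ S, dep S ↔ CZ α S ∧ DepL α S) (hemp : ∀ S, emp S ↔ ¬ CZ α S) {lam : Fin n → ℂ} (hs : Star lam)
    (q : ℕ) : Module.finrank ℂ (osCohomology dep emp lam q) =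
      qdim (ZO α lam q) (BO α lam) := by
  have hker : ∀ {q : ℕ} {f : ExtDeg n q ℂ}, psi α (Ph q f) = 0 ↔ f ∈ osIdeal dep emp q :=
    psi_ker h0 hdep hemp
  have hcoc : ∀ f : ExtDeg n q ℂ, f ∈ osCocycles dep emp lam q ↔ ns α lam (psi α (Ph q f)) = 0 := by
    intro f
    rw [ns_psi, hker]; rfl
  show qdim (osCocycles dep emp lam q) (osCobound dep emp lam q) = _
  refine quot_finrank _ _ _ _ (psi α ∘ₗ Ph q) ?_ ?_ ?_
  · intro f hf
    refine mem_ZO.2 ⟨Br_le_Om _ (psi_Br α _), (hcoc f).1 hf, ?_⟩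
    show PiF q (psi α (Ph q f)) = psi α (Ph q f)
    rw [PiF_psi, pr_Ph]
  · intro f hf
    show psi α (Ph q f) ∈ BO α lam ↔ _
    rw [mem_BO]
    cases q with
    | zero =>
      constructor
      · rintro ⟨y, hy, e⟩
        show f ∈ osIdeal dep emp 0
        rw [← hker]
        have := congrArg (PiF 0) e
        rw [PiF_ns_zero, PiF_psi, pr_Ph] at this
        exact this.symm
      · intro h
        exact ⟨0, zero_mem _, by rw [map_zero, hker.2 h]⟩
    | succ q =>
      constructor
      · rintro ⟨y, hy, e⟩
        obtain ⟨y', hy', hb⟩ := ns_claim α h0 lam hs hy (by rw [e]; exact psi_Br α _)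
        obtain ⟨x, -, hx⟩ := Br_psi (T := Finset.univ) (α := α) (by rintro a ⟨j, rfl⟩; exact ⟨j, Finset.mem_univ _, rfl⟩) hb
        obtain ⟨g, hg⟩ := Ph_surj q x
        have e2 : ns α lam (psi α x) = psi α (Ph (q+1) f) := by
          rw [hx, map_sub, ns_ns, sub_zero, e]
        have e3 := congrArg (PiF (q+1)) e2
        rw [PiF_ns_succ, PiF_psi, PiF_psi, pr_Ph, ← hg, ns_psi] at e3
        have e4 : f - dLam lam q g ∈ osIdeal dep emp (q+1) := by
          rw [← hker, map_sub, map_sub, e3, sub_self]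
        show f ∈ osIdeal dep emp (q+1) ⊔ LinearMap.range (dLam lam q)
        exact Submodule.mem_sup.2 ⟨_, e4, _, ⟨g, rfl⟩, by abel⟩
      · intro h
        change f ∈ osIdeal dep emp (q+1) ⊔ LinearMap.range (dLam lam q) at h
        obtain ⟨i, hi, _, ⟨g, rfl⟩, rfl⟩ := Submodule.mem_sup.1 h
        refine ⟨psi α (Ph q g), Br_le_Om _ (psi_Br α _), ?_⟩
        rw [ns_psi, map_add, map_add, hker.2 hi, zero_add]
  · intro z hz
    obtain ⟨h1, h2, h3⟩ := mem_ZO.1 hz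
    obtain ⟨y', hy', hb⟩ := ns_claim α h0 lam hs h1 (by rw [h2]; exact zero_mem _)
    obtain ⟨x, -, hx⟩ := Br_psi (T := Finset.univ) (α := α) (by rintro a ⟨j, rfl⟩; exact ⟨j, Finset.mem_univ _, rfl⟩) hb
    obtain ⟨f, hf⟩ := Ph_surj q x
    have e : psi α (Ph q f) = z - PiF q (ns α lam y') := by
      rw [hf, ← PiF_psi, hx, map_sub, h3]
    have hB : ∃ w ∈ Om (Set.range α), ns α lam w = PiF q (ns α lam y') := by
      cases q with
      | zero => exact ⟨0, zero_mem _, by rw [map_zero, PiF_ns_zero]⟩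
      | succ q => exact ⟨PiF q y', PiF_Om q hy', (PiF_ns_succ _ _ _ _).symm⟩
    refine ⟨f, ?_, ?_⟩
    · rw [hcoc, e, map_sub, h2, zero_sub, neg_eq_zero]
      obtain ⟨w, -, hw⟩ := hB
      rw [← hw, ns_ns]
    · show z - psi α (Ph q f) ∈ _
      rw [e, sub_sub_cancel]
      exact mem_BO.2 hB

def Sim (α : Fin n → Aff l) (lam mu : Fin n → ℂ) : Prop :=
  ∃ φ ∈ RA (Set.range α), ∃ φ' ∈ RA (Set.range α), φ * φ' = 1 ∧ ∀ z, ns α lam (φ • z) = φ • ns α mu z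

lemma Sim.trans {α : Fin n → Aff l} {a b c : Fin n → ℂ} (h : Sim α a b) (h' : Sim α b c) : Sim α a c := by
  obtain ⟨φ, h1, ψ, h2, h3, h4⟩ := h
  obtain ⟨φ', h1', ψ', h2', h3', h4'⟩ := h'
  refine ⟨φ * φ', mul_mem h1 h1', ψ * ψ', mul_mem h2 h2', ?_, fun z => ?_⟩
  · rw [mul_mul_mul_comm, h3, h3', one_mul]
  · rw [mul_smul, h4, h4', mul_smul]

lemma Sim.symm {α : Fin n → Aff l} {a b : Fin n → ℂ} (h : Sim α a b) : Sim α b a := by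
  obtain ⟨φ, h1, ψ, h2, h3, h4⟩ := h
  refine ⟨ψ, h2, φ, h1, by rw [mul_comm, h3], fun z => ?_⟩
  have := h4 (ψ • z)
  rw [smul_smul, h3, one_smul] at this
  rw [this, smul_smul, mul_comm ψ, h3, one_smul]

lemma Sim.refl (α : Fin n → Aff l) (a : Fin n → ℂ) : Sim α a a :=
  ⟨1, one_mem _, 1, one_mem _, one_mul _, fun z => by rw [one_smul, one_smul]⟩

lemma Sim.step {α : Fin n → Aff l} (h0 : ∀ j, α j ≠ 0) (lam : Fin n → ℂ) (j : Fin n) :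
    Sim α lam (lam + Pi.single j 1) := by
  refine ⟨affK (α j), affK_mem _ _, (affK (α j))⁻¹, inv_mem ⟨j, rfl⟩, mul_inv_cancel₀ (affK_ne (h0 j)), fun z => ?_⟩
  rw [ns_apply, ns_apply, dd_aff_smul]
  simp only [wl_ksmul, Pi.add_apply, add_smul, Finset.sum_add_distrib]
  have e : ∑ i, (Pi.single j 1 : Fin n → ℂ) i • wl (α i) z = wl (α j) z := by
    rw [Finset.sum_eq_single j]
    · simp
    · intro i _ hi; simp [hi]
    · simp
  rw [e]
  have e2 : affK (α j) • wl (α j) z = EE (α j).2 z := by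
    rw [wl_def, smul_smul, mul_inv_cancel₀ (affK_ne (h0 j)), one_smul]
  rw [smul_add, smul_add, e2, Finset.smul_sum]
  have e3 : ∀ i, affK (α j) • (lam i • wl (α i) z) = lam i • (affK (α j) • wl (α i) z) := fun i => by
    rw [smul_comm]
  simp only [e3]
  abel

lemma Sim.step_int {α : Fin n → Aff l} (h0 : ∀ j, α j ≠ 0) (lam : Fin n → ℂ) (j : Fin n) (k : ℤ) :
    Sim α lam (lam + Pi.single j (k : ℂ)) := by
  induction k using Int.induction_on with
  | zero => simpa using Sim.refl α lam
  | succ i ih =>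
    refine ih.trans ?_
    have := Sim.step h0 (lam + Pi.single j ((i : ℤ) : ℂ)) j
    rw [add_assoc, ← Pi.single_add] at this
    have e : (((i : ℤ) + 1 : ℤ) : ℂ) = ((i : ℤ) : ℂ) + 1 := by push_cast; rfl
    rw [e]; exact this
  | pred i ih =>
    refine ih.trans (Sim.symm ?_)
    have := Sim.step h0 (lam + Pi.single j ((-(i : ℤ) - 1 : ℤ) : ℂ)) j
    rw [add_assoc, ← Pi.single_add] at this
    have e : ((-(i : ℤ) : ℤ) : ℂ) = ((-(i : ℤ) - 1 : ℤ) : ℂ) + 1 := by push_cast; ring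
    rw [e]; exact this

lemma Sim.int {α : Fin n → Aff l} (h0 : ∀ j, α j ≠ 0) (lam : Fin n → ℂ) (k : Fin n → ℤ) :
    Sim α lam (lam + fun j => (k j : ℂ)) := by
  have : ∀ S : Finset (Fin n), Sim α lam (lam + ∑ j ∈ S, Pi.single j (k j : ℂ)) := by
    intro S
    induction S using Finset.induction_on with
    | empty => simpa using Sim.refl α lam
    | insert j S hj ih =>
      rw [Finset.sum_insert hj, add_comm (Pi.single j _), ← add_assoc]
      exact ih.trans (Sim.step_int h0 _ j (k j))
  have h := this Finset.univ
  rwa [Finset.univ_sum_single] at h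

theorem Sim.finrank {α : Fin n → Aff l} {a b : Fin n → ℂ} (h : Sim α a b) (q : ℕ) :
    qdim (ZO α b q) (BO α b) =
    qdim (ZO α a q) (BO α a) := by
  have h' := h.symm
  obtain ⟨φ, h1, ψ, h2, h3, h4⟩ := h
  have h5 : ∀ z, ns α b (ψ • z) = ψ • ns α a z := by
    intro z
    have := h4 (ψ • z)
    rw [smul_smul, h3, one_smul] at this
    rw [this, smul_smul, mul_comm ψ, h3, one_smul]
  have h3' : ψ * φ = 1 := by rw [mul_comm, h3]
  let g : Form l →ₗ[ℂ] Form l := 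
    { toFun := fun z => φ • z
      map_add' := fun x y => smul_add _ _ _
      map_smul' := fun c x => smul_comm _ _ _ }
  refine quot_finrank _ _ _ _ g ?_ ?_ ?_
  · intro z hz
    obtain ⟨e1, e2, e3⟩ := mem_ZO.1 hz
    refine mem_ZO.2 ⟨Om_ksmul h1 e1, ?_, ?_⟩
    · show ns α a (φ • z) = 0
      rw [h4, e2, smul_zero]
    · show PiF q (φ • z) = φ • z
      rw [PiF_ksmul, e3]
  · intro z hz
    show φ • z ∈ BO α a ↔ _
    rw [mem_BO, mem_BO]
    constructor
    · rintro ⟨y, hy, e⟩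
      exact ⟨ψ • y, Om_ksmul h2 hy, by rw [h5, e, smul_smul, h3', one_smul]⟩
    · rintro ⟨y, hy, e⟩
      exact ⟨φ • y, Om_ksmul h1 hy, by rw [h4, e]⟩
  · intro w hw
    obtain ⟨e1, e2, e3⟩ := mem_ZO.1 hw
    refine ⟨ψ • w, mem_ZO.2 ⟨Om_ksmul h2 e1, by rw [h5, e2, smul_zero], by rw [PiF_ksmul, e3]⟩, ?_⟩
    show w - φ • (ψ • w) ∈ _
    rw [smul_smul, h3, one_smul, sub_self]
    exact zero_mem _

theorem thmC {α : Fin n → Aff l} (h0 : ∀ j, α j ≠ 0) {dep emp : Finset (Fin n) → Prop}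
    (hdep : ∀ S, dep S ↔ CZ α S ∧ DepL α S) (hemp : ∀ S, emp S ↔ ¬ CZ α S) {lam : Fin n → ℂ} (hs : Star lam)
    (k : Fin n → ℤ) (hs' : Star (lam + fun j => (k j : ℂ))) (q : ℕ) :
    Module.finrank ℂ (osCohomology dep emp lam q) =
      Module.finrank ℂ (osCohomology dep emp (lam + fun j => (k j : ℂ)) q) := by
  rw [os_finrank h0 hdep hemp hs, os_finrank h0 hdep hemp hs', (Sim.int h0 lam k).finrank q]

def af (b : Fin n → Fin (l + 1) → ℂ) (j : Fin n) : Aff l := (b j 0, ∑ k, b j k.succ • dx k)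

lemma af_ev (b : Fin n → Fin (l + 1) → ℂ) (j : Fin n) (u : Fin l → ℂ) : (af b j).ev u = alphaForm b j u := by
  simp [af, Aff.ev, alphaForm, dx]

lemma af_single (b : Fin n → Fin (l + 1) → ℂ) (j : Fin n) (k : Fin l) : (af b j).2 (Pi.single k 1) = linPart b j k := by
  simp [af, linPart, dx, Pi.single_apply]

lemma af_ne {b : Fin n → Fin (l + 1) → ℂ} (hb : IsArrangement b) (j : Fin n) : af b j ≠ 0 := by
  intro h
  obtain ⟨k, hk⟩ := hb j
  have := af_single b j k
  rw [h] at this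
  exact hk this.symm

lemma empS_iff (b : Fin n → Fin (l + 1) → ℂ) (S : Finset (Fin n)) : empS b S ↔ ¬ CZ (af b) S := by
  simp [empS, CZ, af_ev]

lemma depS_iff (b : Fin n → Fin (l + 1) → ℂ) (S : Finset (Fin n)) : depS b S ↔ CZ (af b) S ∧ DepL (af b) S := by
  have h1 : (∃ u, ∀ j ∈ S, alphaForm b j u = 0) ↔ CZ (af b) S := by simp [CZ, af_ev]
  rw [depS, h1]
  refine and_congr_right fun _ => ?_
  have h2 : ∀ c : Fin n → ℂ, (∑ j ∈ S, c j • (af b j).2 = 0 ↔ ∑ j ∈ S, c j • linPart b j = 0) := by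
    intro c
    constructor
    · intro h
      ext k
      have := congrArg (fun f => f (Pi.single k 1)) h
      simpa [LinearMap.sum_apply, af_single] using this
    · intro h
      refine LinearMap.pi_ext' fun k => LinearMap.ext_ring ?_
      have := congrFun h k
      simpa [LinearMap.sum_apply, af_single] using this
  have h3 : DepL (af b) S ↔ ¬ LinearIndependent ℂ (fun j : S => linPart b j) := by
    rw [DepL]
    have : LinearIndependent ℂ (fun j : S => linPart b j) ↔ LinearIndepOn ℂ (linPart b) (S : Set (Fin n)) := Iff.rfl
    rw [this, linearIndepOn_finset_iff]
    push Not
    refine exists_congr fun c => ?_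
    rw [h2]
    tauto
  rw [h3, linearIndependent_iff_card_le_finrank_span, not_le, Fintype.card_coe]
  have : Set.range (fun j : S => linPart b j) = linPart b '' (S : Set (Fin n)) := by
    ext x; simp
  rw [Set.finrank, this]

end RV

end

noncomputable section
namespace RV

lemma semicont {V W : Type*} [AddCommGroup V] [Module ℂ V] [AddCommGroup W] [Module ℂ W]
    [FiniteDimensional ℂ V] [FiniteDimensional ℂ W] (T0 T1 : V →ₗ[ℂ] W) (r : ℕ)
    (h : ∀ k : ℤ, Module.finrank ℂ (LinearMap.range (T0 + (k : ℂ) • T1)) ≤ r) (t : ℂ) :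
    Module.finrank ℂ (LinearMap.range (T0 + t • T1)) ≤ r := by
  set T := T0 + t • T1 with hT
  obtain ⟨s, hs⟩ := T.rangeRestrict.exists_rightInverse_of_surjective T.range_rangeRestrict
  obtain ⟨p, hp⟩ := (LinearMap.range T).exists_isCompl
  let R := LinearMap.range T
  obtain ⟨g, hg⟩ := R.subtype.exists_leftInverse_of_injective R.ker_subtype
  let C : Module.End ℂ R := g ∘ₗ T1 ∘ₗ s
  have key : ∀ u : ℂ, g ∘ₗ (T0 + u • T1) ∘ₗ s = 1 + (u - t) • C := by
    intro u
    ext1 x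
    have e1 : T (s x) = x := by
      have := LinearMap.congr_fun hs x
      exact congrArg Subtype.val this
    have e2 : g (x : W) = x := LinearMap.congr_fun hg x
    have e3 : (T0 + u • T1) (s x) = T (s x) + (u - t) • T1 (s x) := by
      simp only [hT, LinearMap.add_apply, LinearMap.smul_apply, sub_smul]; abel
    show g ((T0 + u • T1) (s x)) = x + (u - t) • g (T1 (s x))
    rw [e3, map_add, map_smul, e1, e2]
  have hfin : Set.Finite {k : ℤ | C.HasEigenvalue (-((k : ℂ) - t)⁻¹)} := by
    refine Set.Finite.preimage (f := fun k : ℤ => (-((k : ℂ) - t)⁻¹)) ?_ (Module.End.finite_hasEigenvalue C)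
    intro a _ b _ hab
    simpa using hab
  obtain ⟨k, hk⟩ : ∃ k : ℤ, k ∉ {k : ℤ | C.HasEigenvalue (-((k : ℂ) - t)⁻¹)} :=
    Set.Infinite.exists_notMem_finite (s := Set.univ) Set.infinite_univ hfin |>.imp fun _ h => h.2
  refine le_trans ?_ (h k)
  have inj : Function.Injective ((T0 + (k : ℂ) • T1) ∘ₗ s) := by
    rw [← LinearMap.ker_eq_bot, LinearMap.ker_eq_bot']
    intro x hx
    by_contra hx0
    have e : (1 + ((k : ℂ) - t) • C) x = 0 := by
      rw [← key]
      show g (((T0 + (k : ℂ) • T1) ∘ₗ s) x) = 0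
      rw [hx, map_zero]
    have e' : x + ((k : ℂ) - t) • C x = 0 := e
    by_cases h0 : (k : ℂ) - t = 0
    · rw [h0, zero_smul, add_zero] at e'
      exact hx0 e'
    · apply hk
      refine Module.End.hasEigenvalue_of_hasEigenvector (x := x) ⟨Module.End.mem_eigenspace_iff.2 ?_, hx0⟩
      have := congrArg (fun y => ((k : ℂ) - t)⁻¹ • y) e'
      simp only [smul_add, smul_smul, inv_mul_cancel₀ h0, one_smul, smul_zero] at this
      rw [neg_smul]
      exact eq_neg_of_add_eq_zero_right this
  rw [← LinearMap.finrank_range_of_inj inj]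
  exact Submodule.finrank_mono (LinearMap.range_comp_le_range _ _)

lemma exists_scale {n : ℕ} (lam : Fin n → ℂ) : ∃ c : ℂ, c ≠ 0 ∧ ∀ (S : Finset (Fin n)) (k : ℤ),
    c * ∑ j ∈ S, lam j = k → ∑ j ∈ S, lam j = 0 := by
  have hc : Set.Countable (Set.range (fun p : Finset (Fin n) × ℤ => (p.2 : ℂ) / ∑ j ∈ p.1, lam j) ∪ {0}) :=
    (Set.countable_range _).union (Set.countable_singleton 0)
  have : ∃ c, c ∉ (Set.range (fun p : Finset (Fin n) × ℤ => (p.2 : ℂ) / ∑ j ∈ p.1, lam j) ∪ {0}) := by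
    by_contra hcon
    push Not at hcon
    have : (Set.univ : Set ℂ).Countable := hc.mono fun c _ => hcon c
    exact not_countable_complex this
  obtain ⟨c, hc⟩ := this
  refine ⟨c, fun h => hc (Or.inr h), fun S k e => ?_⟩
  by_contra h0
  exact hc (Or.inl ⟨(S, k), by rw [eq_comm, eq_div_iff h0]; exact e⟩)

def Lsub {n : ℕ} (F : Finset (Finset (Fin n))) : Submodule ℂ (Fin n → ℂ) where
  carrier := {x | ∀ S ∈ F, ∑ j ∈ S, x j = 0}
  zero_mem' := fun S _ => by simp
  add_mem' := fun {x y} hx hy S hS => by simp [Finset.sum_add_distrib, hx S hS, hy S hS]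
  smul_mem' := fun c x hx S hS => by simp [← Finset.mul_sum, hx S hS]

lemma mem_Lsub {n : ℕ} {F : Finset (Finset (Fin n))} {x : Fin n → ℂ} :
    x ∈ Lsub F ↔ ∀ S ∈ F, ∑ j ∈ S, x j = 0 := Iff.rfl

lemma clear_den {n : ℕ} (q : Fin n → ℚ) : ∃ N : ℕ, N ≠ 0 ∧ ∃ v : Fin n → ℤ, ∀ j, (v j : ℚ) = N * q j := by
  refine ⟨∏ j, (q j).den, Finset.prod_ne_zero_iff.2 fun j _ => (q j).den_nz,
    fun j => (∏ i ∈ Finset.univ.erase j, (q i).den : ℕ) * (q j).num, fun j => ?_⟩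
  rw [← Finset.prod_erase_mul _ _ (Finset.mem_univ j)]
  push_cast
  rw [mul_assoc, Rat.den_mul_eq_num]

lemma int_span {n : ℕ} (F : Finset (Finset (Fin n))) (x : Fin n → ℂ) (hx : x ∈ Lsub F) :
    ∃ (ι : Type) (I : Finset ι) (t : ι → ℂ) (v : ι → Fin n → ℤ), (∀ i, (fun j => (v i j : ℂ)) ∈ Lsub F) ∧
      x = ∑ i ∈ I, t i • (fun j => (v i j : ℂ)) := by
  let B := Module.Basis.ofVectorSpace ℚ ℂ
  let I := Finset.univ.biUnion (fun j : Fin n => (B.repr (x j)).support)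
  choose N hN v hv using fun i => clear_den (fun j => B.repr (x j) i)
  refine ⟨_, I, fun i => B i / (N i : ℂ), v, ?_, ?_⟩
  · intro i S hS
    have h1 := congrArg (fun y => B.coord i y) (hx S hS)
    simp only [map_sum, map_zero, Module.Basis.coord_apply] at h1
    have h2 : ∑ j ∈ S, (v i j : ℚ) = 0 := by
      simp only [hv, ← Finset.mul_sum, h1, mul_zero]
    show ∑ j ∈ S, (v i j : ℂ) = 0
    exact_mod_cast h2
  · ext j
    have h1 : x j = ∑ i ∈ I, (B.repr (x j) i) • B i := by
      conv_lhs => rw [← B.linearCombination_repr (x j)]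
      rw [Finsupp.linearCombination_apply, Finsupp.sum_of_support_subset]
      · exact Finset.subset_biUnion_of_mem (fun j : Fin n => (B.repr (x j)).support) (Finset.mem_univ j)
      · simp
    rw [h1, Finset.sum_apply]
    refine Finset.sum_congr rfl fun i _ => ?_
    have h2 : (v i j : ℂ) = N i * (B.repr (x j) i : ℂ) := by exact_mod_cast congrArg (fun y : ℚ => (y : ℂ)) (hv i j)
    have h3 : (N i : ℂ) ≠ 0 := by exact_mod_cast hN i
    simp only [Pi.smul_apply, smul_eq_mul, h2]
    rw [Rat.smul_def]
    field_simp

variable {n : ℕ}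

lemma dLam_add (x y : Fin n → ℂ) (q : ℕ) : dLam (x + y) q = dLam x q + dLam y q := by
  simp [dLam, add_smul, Finset.sum_add_distrib]

lemma dLam_smul (c : ℂ) (x : Fin n → ℂ) (q : ℕ) : dLam (c • x) q = c • dLam x q := by
  simp [dLam, mul_smul, Finset.smul_sum]

lemma dLam_dLam (x : Fin n → ℂ) (q : ℕ) (f : ExtDeg n q ℂ) : dLam x (q+1) (dLam x q f) = 0 := by
  apply Ph_inj
  rw [Ph_dLam, Ph_dLam, ← mul_assoc]
  have : (∑ j, x j • (eg j : XA n)) = ExteriorAlgebra.ι ℂ x := by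
    conv_rhs => rw [← Finset.univ_sum_single x]
    rw [map_sum]
    refine Finset.sum_congr rfl fun j _ => ?_
    rw [show (Pi.single j (x j) : Fin n → ℂ) = x j • Pi.single j 1 by rw [← Pi.single_smul]; simp, map_smul]
    rfl
  rw [this, ExteriorAlgebra.ι_sq_zero, zero_mul]

lemma dLam_ideal {dep emp : Finset (Fin n) → Prop} (x : Fin n → ℂ) (q : ℕ) {f : ExtDeg n q ℂ}
    (hf : f ∈ osIdeal dep emp q) : dLam x q f ∈ osIdeal dep emp (q+1) := by
  rw [dLam, LinearMap.sum_apply]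
  exact Submodule.sum_mem _ fun j _ => Submodule.smul_mem _ _ (osIdeal_wedge j hf)

lemma rank_quot {V : Type*} [AddCommGroup V] [Module ℂ V] [FiniteDimensional ℂ V] (Z B : Submodule ℂ V) (h : B ≤ Z) :
    Module.finrank ℂ (↥Z ⧸ Submodule.comap Z.subtype B) + Module.finrank ℂ B = Module.finrank ℂ Z := by
  rw [← (Submodule.comapSubtypeEquivOfLe h).finrank_eq]
  exact Submodule.finrank_quotient_add_finrank _

lemma rank_sup {U V : Type*} [AddCommGroup U] [Module ℂ U] [AddCommGroup V] [Module ℂ V] [FiniteDimensional ℂ V]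
    (I : Submodule ℂ V) (f : U →ₗ[ℂ] V) :
    Module.finrank ℂ ↥(I ⊔ LinearMap.range f) = Module.finrank ℂ (LinearMap.range (I.mkQ ∘ₗ f)) + Module.finrank ℂ I := by
  rw [← rank_quot _ _ (le_sup_left : I ≤ I ⊔ LinearMap.range f)]
  congr 1
  have e := LinearMap.quotKerEquivRange (I.mkQ ∘ₗ (I ⊔ LinearMap.range f).subtype)
  rw [LinearMap.ker_comp, Submodule.ker_mkQ, LinearMap.range_comp, Submodule.range_subtype, Submodule.map_sup,
    Submodule.mkQ_map_self, bot_sup_eq, ← LinearMap.range_comp] at e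
  exact e.finrank_eq

lemma finrank_subprod {U V : Type*} [AddCommGroup U] [Module ℂ U] [AddCommGroup V] [Module ℂ V]
    [FiniteDimensional ℂ U] [FiniteDimensional ℂ V] (p : Submodule ℂ U) (r : Submodule ℂ V) :
    Module.finrank ℂ ↥(p.prod r) = Module.finrank ℂ p + Module.finrank ℂ r := by
  have h : LinearMap.range (p.subtype.prodMap r.subtype) = p.prod r := by
    rw [LinearMap.range_prodMap, Submodule.range_subtype, Submodule.range_subtype]
  rw [← Module.finrank_prod, ← h]
  exact LinearMap.finrank_range_of_inj (Prod.map_injective.2 ⟨p.injective_subtype, r.injective_subtype⟩)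

lemma rank_family (dep emp : Finset (Fin n) → Prop) (q : ℕ) :
    ∃ (V W : Type) (_ : AddCommGroup V) (_ : Module ℂ V) (_ : AddCommGroup W) (_ : Module ℂ W)
      (_ : FiniteDimensional ℂ V) (_ : FiniteDimensional ℂ W) (D : (Fin n → ℂ) → (V →ₗ[ℂ] W)) (c : ℕ),
      (∀ x y, D (x + y) = D x + D y) ∧ (∀ (a : ℂ) x, D (a • x) = a • D x) ∧
      ∀ x, Module.finrank ℂ (osCohomology dep emp x q) + Module.finrank ℂ (LinearMap.range (D x)) = c := by
  have hZ : ∀ x : Fin n → ℂ, Module.finrank ℂ (LinearMap.range ((osIdeal dep emp (q+1)).mkQ ∘ₗ dLam x q)) +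
      Module.finrank ℂ (osCocycles dep emp x q) = Module.finrank ℂ (ExtDeg n q ℂ) := by
    intro x
    rw [← LinearMap.finrank_range_add_finrank_ker ((osIdeal dep emp (q+1)).mkQ ∘ₗ dLam x q), LinearMap.ker_comp,
      Submodule.ker_mkQ]
    rfl
  have hI : ∀ (x : Fin n → ℂ) q, osIdeal dep emp q ≤ osCocycles dep emp x q := fun x q f hf => dLam_ideal x q hf
  cases q with
  | zero =>
    refine ⟨ExtDeg n 0 ℂ, ExtDeg n 1 ℂ ⧸ osIdeal dep emp 1, inferInstance, inferInstance, inferInstance,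
      inferInstance, inferInstance, inferInstance, fun x => (osIdeal dep emp 1).mkQ ∘ₗ dLam x 0, 
      Module.finrank ℂ (ExtDeg n 0 ℂ) - Module.finrank ℂ (osIdeal dep emp 0), ?_, ?_, ?_⟩
    · intro x y; simp only [dLam_add, LinearMap.comp_add]
    · intro a x; simp only [dLam_smul, LinearMap.comp_smul]
    · intro x
      have h1 := hZ x
      have h2 := rank_quot (osCocycles dep emp x 0) (osCobound dep emp x 0) (hI x 0)
      have h3 : Module.finrank ℂ (osCobound dep emp x 0) = Module.finrank ℂ (osIdeal dep emp 0) := rfl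
      change Module.finrank ℂ (LinearMap.range ((osIdeal dep emp 1).mkQ ∘ₗ dLam x 0)) + _ = _ at h1
      unfold osCohomology
      dsimp only
      omega
  | succ q =>
    refine ⟨ExtDeg n (q+1) ℂ × ExtDeg n q ℂ, (ExtDeg n (q+2) ℂ ⧸ osIdeal dep emp (q+2)) × 
      (ExtDeg n (q+1) ℂ ⧸ osIdeal dep emp (q+1)), inferInstance, inferInstance, inferInstance,
      inferInstance, inferInstance, inferInstance, fun x => ((osIdeal dep emp (q+2)).mkQ ∘ₗ dLam x (q+1)).prodMap
        ((osIdeal dep emp (q+1)).mkQ ∘ₗ dLam x q), 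
      Module.finrank ℂ (ExtDeg n (q+1) ℂ) - Module.finrank ℂ (osIdeal dep emp (q+1)), ?_, ?_, ?_⟩
    · intro x y; simp only [dLam_add, LinearMap.comp_add]; rfl
    · intro a x; simp only [dLam_smul, LinearMap.comp_smul]; rfl
    · intro x
      have h1 := hZ x
      have hB : osCobound dep emp x (q+1) ≤ osCocycles dep emp x (q+1) := by
        refine sup_le (hI x _) ?_
        rintro _ ⟨f, rfl⟩
        show dLam x (q+1) (dLam x q f) ∈ osIdeal dep emp (q+1+1)
        rw [dLam_dLam]; exact zero_mem _
      have h2 := rank_quot _ _ hB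
      have h3 := rank_sup (osIdeal dep emp (q+1)) (dLam x q)
      have h3' : Module.finrank ℂ (osCobound dep emp x (q+1)) = 
        Module.finrank ℂ ↥(osIdeal dep emp (q+1) ⊔ LinearMap.range (dLam x q)) := rfl
      have h4 : Module.finrank ℂ (LinearMap.range (((osIdeal dep emp (q+2)).mkQ ∘ₗ dLam x (q+1)).prodMap
        ((osIdeal dep emp (q+1)).mkQ ∘ₗ dLam x q))) = Module.finrank ℂ (LinearMap.range ((osIdeal dep emp (q+2)).mkQ ∘ₗ dLam x (q+1)))
          + Module.finrank ℂ (LinearMap.range ((osIdeal dep emp (q+1)).mkQ ∘ₗ dLam x q)) := by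
        rw [LinearMap.range_prodMap, finrank_subprod]
      rw [h4]
      unfold osCohomology
      change Module.finrank ℂ (LinearMap.range ((osIdeal dep emp (q+2)).mkQ ∘ₗ dLam x (q+1))) + _ = _ at h1
      omega

theorem top {ℓ : ℕ} (b : Fin n → Fin (ℓ + 1) → ℂ) (hb : IsArrangement b) (q m : ℕ) :
    ∃ 𝒮 : Finset (Submodule ℂ (Fin n → ℂ)), resonanceVariety b q m = ⋃ W ∈ 𝒮, (W : Set (Fin n → ℂ)) := by
  obtain ⟨V, W, _, _, _, _, _, _, D, c0, Dadd, Dsmul, hD⟩ := rank_family (depS b) (empS b) q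
  have hC : ∀ {lam : Fin n → ℂ}, Star lam → ∀ k : Fin n → ℤ, Star (lam + fun j => (k j : ℂ)) → lam ∈ resonanceVariety b q m →
      (lam + fun j => (k j : ℂ)) ∈ resonanceVariety b q m := by
    intro lam hs k hs' h
    have := thmC (fun j => af_ne hb j) (depS_iff b) (empS_iff b) hs k hs' q
    show m ≤ _
    rw [← this]; exact h
  have hmem : ∀ x, x ∈ resonanceVariety b q m ↔ Module.finrank ℂ (LinearMap.range (D x)) + m ≤ c0 := by
    intro x
    have := hD x
    show m ≤ _ ↔ _
    omega
  have main : ∀ lam ∈ resonanceVariety b q m,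
      (Lsub (Finset.univ.filter fun S => ∑ j ∈ S, lam j = 0) : Set (Fin n → ℂ)) ⊆ resonanceVariety b q m := by
    intro lam hlam μ hμ
    set F : Finset (Finset (Fin n)) := Finset.univ.filter fun S => ∑ j ∈ S, lam j = 0 with hF
    obtain ⟨c, hc0, hc⟩ := exists_scale lam
    have hcl : c • lam ∈ resonanceVariety b q m := by
      rw [hmem] at hlam ⊢
      rw [Dsmul, LinearMap.range_smul _ _ hc0]
      exact hlam
    have hsum : ∀ S, ∑ j ∈ S, (c • lam) j = c * ∑ j ∈ S, lam j := fun S => by simp [Finset.mul_sum]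
    have hs : Star (c • lam) := by
      intro S k e
      rw [hsum] at e
      rw [hc S k e, mul_zero] at e
      exact_mod_cast e.symm
    have hk : ∀ k : Fin n → ℤ, (fun j => (k j : ℂ)) ∈ Lsub F → (c • lam + fun j => (k j : ℂ)) ∈ resonanceVariety b q m := by
      intro k hk
      refine hC hs k ?_ hcl
      intro S k' e
      simp only [Pi.add_apply, Finset.sum_add_distrib, hsum] at e
      have e1 : c * ∑ j ∈ S, lam j = ((k' - ∑ j ∈ S, k j : ℤ) : ℂ) := by
        push_cast; rw [← e]; ring
      have e2 := hc S _ e1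
      have e3 := hk S (by simp [hF, e2])
      simp only at e3
      rw [e2, e3, mul_zero, add_zero] at e
      exact_mod_cast e.symm
    have hlF : lam ∈ Lsub F := by
      intro S hS
      simpa [hF] using hS
    obtain ⟨ι, I, t, v, hv, hx⟩ := int_span F (μ - c • lam) (sub_mem hμ (Submodule.smul_mem _ _ hlF))
    have ind : ∀ I : Finset ι, ∀ k : Fin n → ℤ, (fun j => (k j : ℂ)) ∈ Lsub F →
        (c • lam + (fun j => (k j : ℂ)) + ∑ i ∈ I, t i • (fun j => (v i j : ℂ))) ∈ resonanceVariety b q m := by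
      intro I
      induction I using Finset.induction_on with
      | empty => intro k h; simpa using hk k h
      | insert i I hi ih =>
        intro k h
        have hc0m : m ≤ c0 := by
          have := (hmem _).1 hlam
          omega
        have key := semicont (D (c • lam + (fun j => (k j : ℂ)) + ∑ i ∈ I, t i • (fun j => (v i j : ℂ))))
          (D (fun j => (v i j : ℂ))) (c0 - m) ?_ (t i)
        · rw [hmem, Finset.sum_insert hi, add_comm (t i • _), ← add_assoc, Dadd, Dsmul]
          omega
        · intro s
          have h1 := ih (fun j => k j + s * v i j) (by
            have := add_mem h (Submodule.smul_mem _ (s : ℂ) (hv i))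
            convert this using 1
            ext j; simp)
          rw [hmem] at h1
          rw [← Dsmul, ← Dadd]
          have e : (c • lam + (fun j => (k j : ℂ)) + ∑ i ∈ I, t i • (fun j => (v i j : ℂ))) + (s : ℂ) • (fun j => (v i j : ℂ))
            = (c • lam + (fun j => ((k j + s * v i j : ℤ) : ℂ)) + ∑ i ∈ I, t i • (fun j => (v i j : ℂ))) := by
            ext j; simp; ring
          rw [e]
          omega
    have := ind I 0 (by
      convert zero_mem (Lsub F) using 1
      ext j; simp)
    rw [← hx] at this
    convert this using 1
    ext j; simp
  refine ⟨(Finset.univ.image Lsub).filter fun L => (L : Set (Fin n → ℂ)) ⊆ resonanceVariety b q m, ?_⟩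
  ext x
  simp only [Set.mem_iUnion, Finset.mem_filter, Finset.mem_image, Finset.mem_univ, true_and, exists_prop]
  constructor
  · intro hx
    exact ⟨_, ⟨⟨_, rfl⟩, main x hx⟩, fun S hS => by simpa using hS⟩
  · rintro ⟨L, ⟨-, hL⟩, hx⟩
    exact hL hx

end RV

end

noncomputable section

variable {n ℓ : ℕ}

/-- **Corollary (Cohen–Orlik).** Each resonance variety `R^q_m(A)` is the union of a
finite arrangement of linear subspaces of `ℂ^n`. -/
theorem resonanceVariety_eq_union_of_subspaces
    (b : Fin n → Fin (ℓ + 1) → ℂ) (hb : IsArrangement b) (q m : ℕ) :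
    ∃ 𝒮 : Finset (Submodule ℂ (Fin n → ℂ)),
      resonanceVariety b q m = ⋃ W ∈ 𝒮, (W : Set (Fin n → ℂ)) := by
  exact RV.top b hb q m

end
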